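/- arXiv:0906.2848 — 3 statements merged into one kernel-verified Lean document; each statement's English description precedes it below -/
import Mathlib

section
/- (Corollary 1.3.) If M is a positive integer with M ≡ 1 (mod 8) and the Jacobi symbol (M|7) = 1, then (1,8,8,0,0,0)(M) = (1,14,14,0,0,0)(M) + 2·(2,7,14,0,0,0)(M). If M ≡ 1 (mod 8), 7 | M and 7² ∤ M, then (1,8,8,0,0,0)(M) = 2·(1,14,14,0,0,0)(M) + 4·(2,7,14,0,0,0)(M). -/
/-- The number of representations of `M` by the ternary quadratic form
`a x² + b y² + c z² + d y z + e z x + f x y`. -/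
noncomputable def rep (a b c d e f M : ℤ) : ℕ :=
  {p : ℤ × ℤ × ℤ | M = a * p.1 ^ 2 + b * p.2.1 ^ 2 + c * p.2.2 ^ 2
      + d * p.2.1 * p.2.2 + e * p.2.2 * p.1 + f * p.1 * p.2.1}.ncard

section
open Complex Real

noncomputable def Th (c a b : ℝ) (τ : ℂ) : ℂ :=
  ∑' n : ℤ, cexp (π * I * c * (n + a) ^ 2 * τ + 2 * π * I * b * (n + a))

lemma Th_eq (c a b : ℝ) (τ : ℂ) : Th c a b τ =
    cexp (π * I * c * a ^ 2 * τ + 2 * π * I * b * a) * jacobiTheta₂ (c * a * τ + b) (c * τ) := by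
  unfold Th jacobiTheta₂ jacobiTheta₂_term
  rw [← tsum_mul_left]
  refine tsum_congr fun n => ?_
  rw [← Complex.exp_add]
  congr 1
  ring

lemma Th_diff (c a b : ℝ) (hc : 0 < c) {τ : ℂ} (hτ : 0 < τ.im) :
    DifferentiableAt ℂ (Th c a b) τ := by
  have h1 : Th c a b = fun τ : ℂ => cexp (π * I * c * a ^ 2 * τ + 2 * π * I * b * a) *
      jacobiTheta₂ (c * a * τ + b) (c * τ) := by
    ext τ; exact Th_eq c a b τ
  rw [h1]
  have h2 : 0 < ((c : ℂ) * τ).im := by simp; positivity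
  have h3 := (hasFDerivAt_jacobiTheta₂ ((c : ℂ) * a * τ + b) h2).differentiableAt
  have h4 : DifferentiableAt ℂ (fun τ : ℂ => (((c : ℂ) * a * τ + b, (c : ℂ) * τ) : ℂ × ℂ)) τ := by
    fun_prop
  have h5 := DifferentiableAt.comp τ h3 h4
  refine DifferentiableAt.mul (by fun_prop) h5

lemma Th_S (c a b : ℝ) (hc : 0 < c) {τ : ℂ} (hτ : 0 < τ.im) :
    Th c a b (-1 / τ) = (-I * (τ / c)) ^ (1 / 2 : ℂ) *
      ∑' m : ℤ, cexp (2 * π * I * m * a + π * I * (m - b) ^ 2 * τ / c) := by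
  have hτ0 : τ ≠ 0 := by rintro rfl; simp at hτ
  have hc0 : (c : ℂ) ≠ 0 := by exact_mod_cast hc.ne'
  have hx : (-I * (τ / c)) ^ (1 / 2 : ℂ) ≠ 0 := by
    rw [Complex.cpow_ne_zero_iff]; left
    exact mul_ne_zero (by simp) (div_ne_zero hτ0 hc0)
  have fe := jacobiTheta₂_functional_equation (-a + b * τ / c) (τ / c)
  have e1 : (-(a:ℂ) + b * τ / c) / (τ / c) = c * a * (-1 / τ) + b := by
    field_simp
  have e2 : -1 / (τ / (c:ℂ)) = c * (-1 / τ) := by field_simp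
  rw [e1, e2] at fe
  rw [Th_eq]
  have e3 : jacobiTheta₂ (c * a * (-1 / τ) + b) (c * (-1 / τ)) =
      (-I * (τ / c)) ^ (1 / 2 : ℂ) * cexp (π * I * (-a + b * τ / c) ^ 2 / (τ / c)) *
        jacobiTheta₂ (-a + b * τ / c) (τ / c) := by
    rw [fe]
    have : cexp (π * I * (-a + b * τ / c) ^ 2 / (τ / c)) *
        cexp (-π * I * (-a + b * τ / c) ^ 2 / (τ / c)) = 1 := by
      rw [← Complex.exp_add, ← Complex.exp_zero]; congr 1; ring
    generalize jacobiTheta₂ _ _ = J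
    generalize cexp (π * I * (-a + b * τ / c) ^ 2 / (τ / c)) = E1 at this ⊢
    generalize cexp (-π * I * (-a + b * τ / c) ^ 2 / (τ / c)) = E2 at this ⊢
    generalize (-I * (τ / c)) ^ (1 / 2 : ℂ) = X at hx ⊢
    have hX : X * X⁻¹ = 1 := mul_inv_cancel₀ hx
    rw [one_div]
    linear_combination (-J) * this - E1 * E2 * J * hX
  rw [e3, mul_left_comm, ← mul_assoc, mul_assoc, mul_assoc]
  rw [mul_assoc]
  congr 1
  rw [← mul_assoc, ← Complex.exp_add]
  unfold jacobiTheta₂ jacobiTheta₂_term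
  rw [← tsum_mul_left]
  rw [← (Equiv.neg ℤ).tsum_eq]
  refine tsum_congr fun n => ?_
  rw [← Complex.exp_add]
  congr 1
  simp only [Equiv.neg_apply]
  push_cast
  field_simp
  ring
end

section
open Complex Real

lemma Th_summable (c a b : ℝ) (hc : 0 < c) {τ : ℂ} (hτ : 0 < τ.im) :
    Summable fun n : ℤ => cexp (π * I * c * (n + a) ^ 2 * τ + 2 * π * I * b * (n + a)) := by
  have h2 : 0 < ((c : ℂ) * τ).im := by simp; positivity
  have := (hasSum_jacobiTheta₂_term ((c : ℂ) * a * τ + b) h2).summable.mul_left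
    (cexp (π * I * c * a ^ 2 * τ + 2 * π * I * b * a))
  refine this.congr fun n => ?_
  unfold jacobiTheta₂_term
  rw [← Complex.exp_add]
  congr 1
  ring

lemma Th_shift (c a b : ℝ) (τ : ℂ) : Th c (a + 1) b τ = Th c a b τ := by
  unfold Th
  rw [← (Equiv.addRight (1:ℤ)).tsum_eq (fun n : ℤ => cexp (π * I * c * (n + a) ^ 2 * τ + 2 * π * I * b * (n + a)))]
  refine tsum_congr fun n => ?_
  simp only [Equiv.coe_addRight]
  push_cast
  congr 1; ring

lemma Th_neg (c a b : ℝ) (τ : ℂ) : Th c (-a) (-b) τ = Th c a b τ := by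
  unfold Th
  rw [← (Equiv.neg ℤ).tsum_eq (fun n : ℤ => cexp (π * I * c * (n + a) ^ 2 * τ + 2 * π * I * b * (n + a)))]
  refine tsum_congr fun n => ?_
  simp only [Equiv.neg_apply]
  push_cast
  congr 1; ring

lemma tsum_split (f : ℤ → ℂ) (hf : Summable f) :
    ∑' m, f m = ∑ k : Fin 7, ∑' n : ℤ, f (7 * n + (k : ℕ)) := by
  have e := Int.divModEquiv 7
  let e : ℤ ≃ Fin 7 × ℤ := (Int.divModEquiv 7).trans (Equiv.prodComm _ _)
  have hs : Summable (f ∘ e.symm) := e.symm.summable_iff.2 hf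
  rw [← e.symm.tsum_eq f, Summable.tsum_prod (f := fun x => f (e.symm x)) hs, tsum_fintype]
  refine Finset.sum_congr rfl fun k _ => tsum_congr fun n => ?_
  congr 1
  simp [e, Int.divModEquiv]
  ring

noncomputable def gG (j : ℤ) (τ : ℂ) : ℂ := Th 7 (j / 7) 0 τ
noncomputable def gK (j : ℤ) (τ : ℂ) : ℂ := Th 7 (j / 7) (7 / 2) τ
noncomputable def gH (j : ℤ) (τ : ℂ) : ℂ := Th 7 (j / 7 + 1 / 2) 0 τ
noncomputable def t3 (τ : ℂ) : ℂ := Th 1 0 0 τ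
noncomputable def t4 (τ : ℂ) : ℂ := Th 1 0 (1 / 2) τ
noncomputable def t2 (τ : ℂ) : ℂ := Th 1 (1 / 2) 0 τ

lemma exp_int (n : ℤ) : cexp (2 * π * I * n) = 1 := by
  rw [mul_comm]; exact Complex.exp_int_mul_two_pi_mul_I n

lemma exp_eq_of (x y : ℂ) (n : ℤ) (h : x = y + 2 * π * I * n) : cexp x = cexp y := by
  rw [h, Complex.exp_add, exp_int, mul_one]

lemma gG_per (j : ℤ) (τ : ℂ) : gG (7 - j) τ = gG j τ := by
  unfold gG
  rw [← Th_neg 7 (j / 7) 0, ← Th_shift 7 (-(j / 7))]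
  congr 1
  · push_cast; ring
  · simp

lemma gH_per (j : ℤ) (τ : ℂ) : gH (7 - j) τ = gH j τ := by
  unfold gH
  rw [← Th_neg 7 (j / 7 + 1 / 2) 0, ← Th_shift 7 (-(j / 7 + 1 / 2)), ← Th_shift 7 (-(j / 7 + 1 / 2) + 1)]
  congr 1
  · push_cast; ring
  · simp

lemma gK_per (j : ℤ) (τ : ℂ) : gK (7 - j) τ = gK j τ := by
  unfold gK
  rw [← Th_neg 7 (j / 7) (7 / 2), ← Th_shift 7 (-(j / 7))]
  rw [show (-(j / 7 : ℝ) + 1) = ((7 - j : ℤ) : ℝ) / 7 by push_cast; ring]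
  unfold Th
  refine tsum_congr fun n => ?_
  refine exp_eq_of _ _ (7 * n + (7 - j)) ?_
  push_cast; ring

/-- kappa -/
noncomputable def kap (c : ℝ) (τ : ℂ) : ℂ := (-I * (τ / c)) ^ (1 / 2 : ℂ)

lemma S_summable (c a b : ℝ) (hc : 0 < c) {τ : ℂ} (hτ : 0 < τ.im) :
    Summable fun m : ℤ => cexp (2 * π * I * m * a + π * I * (m - b) ^ 2 * τ / c) := by
  have := (Th_summable (1 / c) (-b) a (by positivity) hτ).mul_left (cexp (2 * π * I * a * b))
  refine this.congr fun n => ?_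
  rw [← Complex.exp_add]
  congr 1
  push_cast
  ring

lemma gG_S (j : ℤ) {τ : ℂ} (hτ : 0 < τ.im) : gG j (-1 / τ) =
    kap 7 τ * ∑ k : Fin 7, cexp (2 * π * I * j * (k : ℕ) / 7) * gG (k : ℕ) τ := by
  unfold gG kap
  rw [Th_S _ _ _ (by norm_num) hτ, tsum_split _ (S_summable _ _ _ (by norm_num) hτ)]
  congr 1
  refine Finset.sum_congr rfl fun k _ => ?_
  unfold Th
  rw [← tsum_mul_left]
  refine tsum_congr fun n => ?_
  rw [← Complex.exp_add]
  refine exp_eq_of _ _ (n * j) ?_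
  push_cast; ring

lemma gH_S (j : ℤ) {τ : ℂ} (hτ : 0 < τ.im) : gH j (-1 / τ) =
    kap 7 τ * ∑ k : Fin 7, cexp (2 * π * I * j * (k : ℕ) / 7) * gK (k : ℕ) τ := by
  unfold gH gK kap
  rw [Th_S _ _ _ (by norm_num) hτ, tsum_split _ (S_summable _ _ _ (by norm_num) hτ)]
  congr 1
  refine Finset.sum_congr rfl fun k _ => ?_
  unfold Th
  rw [← tsum_mul_left]
  refine tsum_congr fun n => ?_
  rw [← Complex.exp_add]
  refine exp_eq_of _ _ (n * j) ?_
  push_cast; ring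

lemma gK_S (j : ℤ) {τ : ℂ} (hτ : 0 < τ.im) : gK j (-1 / τ) =
    kap 7 τ * ∑ k : Fin 7, cexp (2 * π * I * j * (k : ℕ) / 7) * gH (k : ℕ) τ := by
  unfold gH gK kap
  rw [Th_S _ _ _ (by norm_num) hτ, tsum_split _ (S_summable _ _ _ (by norm_num) hτ)]
  congr 1
  refine Finset.sum_congr rfl fun k _ => ?_
  rw [← (Equiv.addRight (1:ℤ)).tsum_eq]
  unfold Th
  rw [← tsum_mul_left]
  refine tsum_congr fun n => ?_
  rw [← Complex.exp_add]
  refine exp_eq_of _ _ ((n + 1) * j) ?_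
  simp only [Equiv.coe_addRight]
  push_cast; ring

lemma t3_S {τ : ℂ} (hτ : 0 < τ.im) : t3 (-1 / τ) = kap 1 τ * t3 τ := by
  unfold t3 kap
  rw [Th_S _ _ _ (by norm_num) hτ]
  congr 1
  refine tsum_congr fun n => ?_
  congr 1; push_cast; ring

lemma t2_S {τ : ℂ} (hτ : 0 < τ.im) : t2 (-1 / τ) = kap 1 τ * t4 τ := by
  unfold t2 t4 kap
  rw [Th_S _ _ _ (by norm_num) hτ]
  congr 1
  refine tsum_congr fun n => ?_
  congr 1; push_cast; ring

lemma t4_S {τ : ℂ} (hτ : 0 < τ.im) : t4 (-1 / τ) = kap 1 τ * t2 τ := by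
  unfold t2 t4 kap
  rw [Th_S _ _ _ (by norm_num) hτ]
  congr 1
  rw [← (Equiv.addRight (1:ℤ)).tsum_eq]
  refine tsum_congr fun n => ?_
  simp only [Equiv.coe_addRight]
  congr 1; push_cast; ring

lemma gG_T (j : ℤ) (τ : ℂ) : gG j (τ + 1) = cexp (8 * π * I * j ^ 2 / 7) * gK j τ := by
  unfold gG gK Th
  rw [← tsum_mul_left]
  refine tsum_congr fun n => ?_
  rw [← Complex.exp_add]
  obtain ⟨r, hr⟩ := Int.even_mul_succ_self n
  obtain ⟨s, hs⟩ := Int.even_mul_succ_self j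
  have hr' : (n:ℂ) * (n + 1) = r + r := by exact_mod_cast hr
  have hs' : (j:ℂ) * (j + 1) = s + s := by exact_mod_cast hs
  refine exp_eq_of _ _ (7 * r - 7 * n + n * j - s) ?_
  push_cast
  linear_combination (7 * π * I) * hr' - π * I * hs'

lemma gK_T (j : ℤ) (τ : ℂ) : gK j (τ + 1) = cexp (8 * π * I * j ^ 2 / 7) * gG j τ := by
  unfold gG gK Th
  rw [← tsum_mul_left]
  refine tsum_congr fun n => ?_
  rw [← Complex.exp_add]
  obtain ⟨r, hr⟩ := Int.even_mul_succ_self n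
  obtain ⟨s, hs⟩ := Int.even_mul_succ_self j
  have hr' : (n:ℂ) * (n + 1) = r + r := by exact_mod_cast hr
  have hs' : (j:ℂ) * (j + 1) = s + s := by exact_mod_cast hs
  refine exp_eq_of _ _ (7 * r + n * j - s + j) ?_
  push_cast
  linear_combination (7 * π * I) * hr' - π * I * hs'

lemma gH_T (j : ℤ) (τ : ℂ) : gH j (τ + 1) = cexp (-(π * I / 4)) * cexp (8 * π * I * j ^ 2 / 7) * gH j τ := by
  unfold gH Th
  rw [← tsum_mul_left]
  refine tsum_congr fun n => ?_
  rw [← Complex.exp_add, ← Complex.exp_add]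
  obtain ⟨r, hr⟩ := Int.even_mul_succ_self n
  obtain ⟨s, hs⟩ := Int.even_mul_succ_self j
  have hr' : (n:ℂ) * (n + 1) = r + r := by exact_mod_cast hr
  have hs' : (j:ℂ) * (j + 1) = s + s := by exact_mod_cast hs
  refine exp_eq_of _ _ (7 * r + n * j - s + j + 1) ?_
  push_cast
  linear_combination (7 * π * I) * hr' - π * I * hs'

lemma t3_T (τ : ℂ) : t3 (τ + 1) = t4 τ := by
  unfold t3 t4 Th
  refine tsum_congr fun n => ?_
  obtain ⟨r, hr⟩ := Int.even_mul_succ_self n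
  have hr' : (n:ℂ) * (n + 1) = r + r := by exact_mod_cast hr
  refine exp_eq_of _ _ (r - n) ?_
  push_cast
  linear_combination (π * I) * hr'

lemma t4_T (τ : ℂ) : t4 (τ + 1) = t3 τ := by
  unfold t3 t4 Th
  refine tsum_congr fun n => ?_
  obtain ⟨r, hr⟩ := Int.even_mul_succ_self n
  have hr' : (n:ℂ) * (n + 1) = r + r := by exact_mod_cast hr
  refine exp_eq_of _ _ r ?_
  push_cast
  linear_combination (π * I) * hr'

lemma t2_T (τ : ℂ) : t2 (τ + 1) = cexp (π * I / 4) * t2 τ := by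
  unfold t2 Th
  rw [← tsum_mul_left]
  refine tsum_congr fun n => ?_
  rw [← Complex.exp_add]
  obtain ⟨r, hr⟩ := Int.even_mul_succ_self n
  have hr' : (n:ℂ) * (n + 1) = r + r := by exact_mod_cast hr
  refine exp_eq_of _ _ r ?_
  push_cast
  linear_combination (π * I) * hr'
end

section
open Complex Real

lemma pol0 (a b c d x y z : ℂ) (hy : y = x ^ 2 - 2) (hz : z = -1 - x - y)
    (hx : x ^ 3 + x ^ 2 - 2 * x - 1 = 0) :
    8 * (a + x * b + y * c + z * d) * (a + y * b + z * c + x * d) * (a + z * b + x * c + y * d) - (a + 2 * (b + c + d)) ^ 3 = -7 * ((8 * b * c * d - a ^ 3) + 2 * ((b * a ^ 2 + 2 * c ^ 2 * a + 4 * d ^ 2 * c) + (c * a ^ 2 + 2 * d ^ 2 * a + 4 * b ^ 2 * d) + (d * a ^ 2 + 2 * b ^ 2 * a + 4 * c ^ 2 * b))) := by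
  subst hz; subst hy
  linear_combination ((-8) * b^2 * c * x^3 + (8) * b * c^2 * x^3 - (8) * c^2 * d * x^3 + (8) * b^2 * d * x^3 -
    (8) * b * d^2 * x^3 + (8) * c * d^2 * x^3 - (8) * b^3 * x^2 + (16) * b^2 * d * x^2 -
    (48) * b * c * d * x^2 + (16) * b * c^2 * x^2 - (8) * c^3 * x^2 + (16) * c * d^2 * x^2
    - (8) * d^3 * x^2 + (8) * b^2 * c * x^2 + (8) * c^2 * d * x^2 + (8) * b * d^2 * x^2 -
    (8) * a * b^2 * x + (8) * a * b * d * x + (8) * a * b * c * x + (8) * a * c * d * x +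
    (40) * b^2 * c * x - (24) * b * c * d * x - (32) * b * c^2 * x - (32) * b^2 * d * x +
    (40) * b * d^2 * x + (40) * c^2 * d * x - (8) * a * c^2 * x - (32) * c * d^2 * x - (8)
    * a * d^2 * x + (8) * b^3 - (16) * b^2 * d - (8) * b^2 * c + (48) * b * c * d - (16) *
    b * c^2 + (8) * c^3 - (8) * c^2 * d - (16) * c * d^2 - (8) * b * d^2 + (8) * d^3) * hx

lemma pol1 (a b c d x y z : ℂ) (hy : y = x ^ 2 - 2) (hz : z = -1 - x - y)
    (hx : x ^ 3 + x ^ 2 - 2 * x - 1 = 0) :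
    (a + x * b + y * c + z * d) * (a + 2 * (b + c + d)) ^ 2 + 2 * (a + y * b + z * c + x * d) ^ 2 * (a + 2 * (b + c + d)) + 4 * (a + z * b + x * c + y * d) ^ 2 * (a + y * b + z * c + x * d) = -7 * ((8 * b * c * d - a ^ 3) + x * (b * a ^ 2 + 2 * c ^ 2 * a + 4 * d ^ 2 * c) + y * (c * a ^ 2 + 2 * d ^ 2 * a + 4 * b ^ 2 * d) + z * (d * a ^ 2 + 2 * b ^ 2 * a + 4 * c ^ 2 * b)) := by
  subst hz; subst hy
  linear_combination ((4) * b^3 * x^3 - (4) * b^2 * c * x^3 - (8) * b^2 * d * x^3 + (8) * b * c * d * x^3 + (4)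
    * b * d^2 * x^3 - (4) * c * d^2 * x^3 + (4) * b^3 * x^2 - (16) * b^2 * c * x^2 + (4) *
    b^2 * d * x^2 + (16) * b * c * d * x^2 + (8) * b * c^2 * x^2 - (12) * b * d^2 * x^2 -
    (8) * c^2 * d * x^2 + (4) * d^3 * x^2 - (2) * a * b^2 * x + (32) * b^2 * d * x + (4) *
    a * b * c * x + (8) * b * c^2 * x - (40) * b * c * d * x - (4) * b^2 * c * x + (2) * a
    * c^2 * x + (4) * c^2 * d * x - (8) * a * c * d * x - (12) * b * d^2 * x + (20) * c *
    d^2 * x + (4) * a * d^2 * x - (4) * b^3 * x - (4) * d^3 * x + (8) * a * b * c - (12) *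
    a * b * d + (4) * b^2 * d + (24) * b * d^2 - (16) * b * c * d - (6) * a * c^2 + (4) *
    c^3 + (4) * a * c * d - (16) * c * d^2 + (4) * a * d^2 - (8) * b^3 + (8) * c^2 * d -
    (4) * d^3 + (2) * a * b^2 + (4) * b^2 * c) * hx

lemma pol2 (a b c d x y z : ℂ) (hy : y = x ^ 2 - 2) (hz : z = -1 - x - y)
    (hx : x ^ 3 + x ^ 2 - 2 * x - 1 = 0) :
    (a + y * b + z * c + x * d) * (a + 2 * (b + c + d)) ^ 2 + 2 * (a + z * b + x * c + y * d) ^ 2 * (a + 2 * (b + c + d)) + 4 * (a + x * b + y * c + z * d) ^ 2 * (a + z * b + x * c + y * d) = -7 * ((8 * b * c * d - a ^ 3) + y * (b * a ^ 2 + 2 * c ^ 2 * a + 4 * d ^ 2 * c) + z * (c * a ^ 2 + 2 * d ^ 2 * a + 4 * b ^ 2 * d) + x * (d * a ^ 2 + 2 * b ^ 2 * a + 4 * c ^ 2 * b)) := by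
  subst hz; subst hy
  linear_combination ((-4) * b * c^2 * x^3 + (4) * c^2 * d * x^3 + (8) * b * c * d * x^3 - (8) * c * d^2 * x^3 -
    (4) * b * d^2 * x^3 + (4) * d^3 * x^3 - (8) * b^2 * c * x^2 + (16) * b * c * d * x^2 +
    (8) * b^2 * d * x^2 - (16) * b * d^2 * x^2 + (4) * c^3 * x^2 + (4) * c * d^2 * x^2 -
    (12) * c^2 * d * x^2 + (4) * d^3 * x^2 + (2) * a * b^2 * x + (4) * b^2 * c * x + (4) *
    a * b * d * x - (40) * b * c * d * x - (4) * b * d^2 * x + (8) * b^2 * d * x - (2) * a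
    * d^2 * x + (32) * c * d^2 * x - (8) * a * b * c * x + (20) * b * c^2 * x + (4) * a *
    c^2 * x - (12) * c^2 * d * x - (4) * c^3 * x - (4) * d^3 * x - (6) * a * b^2 + (4) *
    b^3 + (8) * a * b * d - (16) * b * c * d + (4) * a * b * c - (16) * b * c^2 - (12) * a
    * c * d + (24) * c^2 * d + (4) * c * d^2 + (4) * a * c^2 + (8) * b^2 * c - (4) * c^3 -
    (8) * d^3 + (4) * b * d^2 + (2) * a * d^2) * hx

lemma pol3 (a b c d x y z : ℂ) (hy : y = x ^ 2 - 2) (hz : z = -1 - x - y)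
    (hx : x ^ 3 + x ^ 2 - 2 * x - 1 = 0) :
    (a + z * b + x * c + y * d) * (a + 2 * (b + c + d)) ^ 2 + 2 * (a + x * b + y * c + z * d) ^ 2 * (a + 2 * (b + c + d)) + 4 * (a + y * b + z * c + x * d) ^ 2 * (a + x * b + y * c + z * d) = -7 * ((8 * b * c * d - a ^ 3) + z * (b * a ^ 2 + 2 * c ^ 2 * a + 4 * d ^ 2 * c) + x * (c * a ^ 2 + 2 * d ^ 2 * a + 4 * b ^ 2 * d) + y * (d * a ^ 2 + 2 * b ^ 2 * a + 4 * c ^ 2 * b)) := by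
  subst hz; subst hy
  linear_combination ((4) * b^2 * c * x^3 - (4) * b^2 * d * x^3 - (8) * b * c^2 * x^3 + (8) * b * c * d * x^3 +
    (4) * c^3 * x^3 - (4) * c^2 * d * x^3 + (4) * b^3 * x^2 + (4) * b * c^2 * x^2 + (16) *
    b * c * d * x^2 - (12) * b^2 * c * x^2 - (8) * b * d^2 * x^2 + (4) * c^3 * x^2 - (16)
    * c^2 * d * x^2 + (8) * c * d^2 * x^2 - (2) * a * c^2 * x + (32) * b * c^2 * x + (4) *
    a * c * d * x - (40) * b * c * d * x + (8) * c * d^2 * x - (4) * c^2 * d * x + (2) * a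
    * d^2 * x + (4) * b * d^2 * x - (8) * a * b * d * x + (4) * a * b^2 * x - (12) * b^2 *
    c * x + (20) * b^2 * d * x - (4) * b^3 * x - (4) * c^3 * x - (12) * a * b * c + (24) *
    b^2 * c + (4) * b * c^2 + (4) * a * b * d - (16) * b^2 * d + (8) * a * c * d - (16) *
    b * c * d - (6) * a * d^2 + (4) * d^3 + (4) * a * b^2 - (4) * b^3 + (8) * b * d^2 -
    (8) * c^3 + (2) * a * c^2 + (4) * c^2 * d) * hx


noncomputable def z7 : ℂ := cexp (2 * π * I / 7)

lemma z7_pow : z7 ^ 7 = 1 := by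
  unfold z7
  rw [← Complex.exp_nat_mul, ← exp_int 1]
  congr 1; push_cast; ring

lemma z7_sum : 1 + z7 + z7 ^ 2 + z7 ^ 3 + z7 ^ 4 + z7 ^ 5 + z7 ^ 6 = 0 := by
  have h : IsPrimitiveRoot z7 7 := Complex.isPrimitiveRoot_exp 7 (by norm_num)
  have := h.geom_sum_eq_zero (by norm_num)
  simp [Finset.sum_range_succ] at this
  linear_combination this

noncomputable def c1 : ℂ := z7 + z7 ^ 6
noncomputable def c2 : ℂ := z7 ^ 2 + z7 ^ 5
noncomputable def c3 : ℂ := z7 ^ 3 + z7 ^ 4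

lemma c2_eq : c2 = c1 ^ 2 - 2 := by
  unfold c1 c2
  linear_combination (-2 - z7 ^ 5) * z7_pow

lemma c3_eq : c3 = -1 - c1 - c2 := by
  unfold c1 c2 c3
  linear_combination z7_sum

lemma c1_eq : c1 ^ 3 + c1 ^ 2 - 2 * c1 - 1 = 0 := by
  have h3 : c1 * c2 = c1 + c3 := by
    unfold c1 c2 c3
    linear_combination (z7 + z7 ^ 4) * z7_pow
  have := c2_eq
  have := c3_eq
  linear_combination h3 + c3_eq - (1 + c1) * c2_eq

def ee (v : Fin 4 → ℂ) : Fin 4 → ℂ :=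
  ![8 * v 1 * v 2 * v 3 - v 0 ^ 3,
    v 1 * v 0 ^ 2 + 2 * v 2 ^ 2 * v 0 + 4 * v 3 ^ 2 * v 2,
    v 2 * v 0 ^ 2 + 2 * v 3 ^ 2 * v 0 + 4 * v 1 ^ 2 * v 3,
    v 3 * v 0 ^ 2 + 2 * v 1 ^ 2 * v 0 + 4 * v 2 ^ 2 * v 1]

noncomputable def hat (v : Fin 4 → ℂ) : Fin 4 → ℂ :=
  ![v 0 + 2 * (v 1 + v 2 + v 3),
    v 0 + c1 * v 1 + c2 * v 2 + c3 * v 3,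
    v 0 + c2 * v 1 + c3 * v 2 + c1 * v 3,
    v 0 + c3 * v 1 + c1 * v 2 + c2 * v 3]

lemma hat_add (v w : Fin 4 → ℂ) : hat (v + w) = hat v + hat w := by
  funext j; fin_cases j <;> simp [hat] <;> ring

lemma hat_smul (r : ℂ) (w : Fin 4 → ℂ) : hat (r • w) = r • hat w := by
  funext j; fin_cases j <;> simp [hat] <;> ring

lemma ee_smul (r : ℂ) (w : Fin 4 → ℂ) : ee (r • w) = r ^ 3 • ee w := by
  funext j; fin_cases j <;> simp [ee] <;> ring

lemma ee_hat (v : Fin 4 → ℂ) : ee (hat v) = (-7 : ℂ) • hat (ee v) := by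
  funext j
  fin_cases j
  · exact pol0 _ _ _ _ _ _ _ c2_eq c3_eq c1_eq
  · exact pol1 _ _ _ _ _ _ _ c2_eq c3_eq c1_eq
  · exact pol2 _ _ _ _ _ _ _ c2_eq c3_eq c1_eq
  · exact pol3 _ _ _ _ _ _ _ c2_eq c3_eq c1_eq

lemma sum_hat (f : ℤ → ℂ) (hf : ∀ j, f (7 - j) = f j) (j : Fin 4) :
    ∑ k : Fin 7, cexp (2 * π * I * ((j : ℕ) : ℤ) * (k : ℕ) / 7) * f (k : ℕ) =
      hat (fun i => f (i : ℕ)) j := by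
  have e : ∀ k : Fin 7, cexp (2 * π * I * ((j : ℕ) : ℤ) * (k : ℕ) / 7) = z7 ^ ((j : ℕ) * k) := by
    intro k
    unfold z7
    rw [← Complex.exp_nat_mul]
    congr 1; push_cast; ring
  simp_rw [e]
  have f4 : f 4 = f 3 := by rw [← hf 3]; norm_num
  have f5 : f 5 = f 2 := by rw [← hf 2]; norm_num
  have f6 : f 6 = f 1 := by rw [← hf 1]; norm_num
  have h7 := z7_pow
  have p8 : z7 ^ 8 = z7 := by linear_combination z7 * h7
  have p9 : z7 ^ 9 = z7 ^ 2 := by linear_combination z7 ^ 2 * h7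
  have p10 : z7 ^ 10 = z7 ^ 3 := by linear_combination z7 ^ 3 * h7
  have p12 : z7 ^ 12 = z7 ^ 5 := by linear_combination z7 ^ 5 * h7
  have p15 : z7 ^ 15 = z7 := by linear_combination (z7 ^ 8 + z7) * h7
  have p18 : z7 ^ 18 = z7 ^ 4 := by linear_combination (z7 ^ 11 + z7 ^ 4) * h7
  rw [Fin.sum_univ_seven]
  fin_cases j <;> simp [hat, f4, f5, f6, p8, p9, p10, p12, p15, p18, c1, c2, c3] <;> ring

noncomputable def vG (τ : ℂ) : Fin 4 → ℂ := fun j => gG (j : ℕ) τ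
noncomputable def vH (τ : ℂ) : Fin 4 → ℂ := fun j => gH (j : ℕ) τ
noncomputable def vK (τ : ℂ) : Fin 4 → ℂ := fun j => gK (j : ℕ) τ

lemma vG_S {τ : ℂ} (hτ : 0 < τ.im) : vG (-1 / τ) = kap 7 τ • hat (vG τ) := by
  funext j
  simp only [vG, Pi.smul_apply, smul_eq_mul]
  rw [gG_S _ hτ, sum_hat (fun k => gG k τ) (fun j => gG_per j τ)]
  rfl

lemma vH_S {τ : ℂ} (hτ : 0 < τ.im) : vH (-1 / τ) = kap 7 τ • hat (vK τ) := by
  funext j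
  simp only [vH, Pi.smul_apply, smul_eq_mul]
  rw [gH_S _ hτ, sum_hat (fun k => gK k τ) (fun j => gK_per j τ)]
  rfl

lemma vK_S {τ : ℂ} (hτ : 0 < τ.im) : vK (-1 / τ) = kap 7 τ • hat (vH τ) := by
  funext j
  simp only [vK, Pi.smul_apply, smul_eq_mul]
  rw [gK_S _ hτ, sum_hat (fun k => gH k τ) (fun j => gH_per j τ)]
  rfl

noncomputable def D3 (τ : ℂ) : Fin 4 → ℂ :=
  ee (vG τ) + (-(t3 τ * t2 τ)) • vH τ + (t3 τ * t4 τ) • vK τ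
noncomputable def D4 (τ : ℂ) : Fin 4 → ℂ :=
  ee (vK τ) + (-(t4 τ * t2 τ)) • vH τ + (t4 τ * t3 τ) • vG τ
noncomputable def D2 (τ : ℂ) : Fin 4 → ℂ :=
  ee (vH τ) + (t2 τ * t4 τ) • vK τ + (-(t2 τ * t3 τ)) • vG τ

lemma kap_sq (c : ℝ) (τ : ℂ) : kap c τ ^ 2 = -I * (τ / c) := by
  unfold kap
  rw [one_div]
  exact_mod_cast Complex.cpow_nat_inv_pow (-I * (τ / c)) (n := 2) (by norm_num)

lemma kap_rel (τ : ℂ) : kap 1 τ ^ 2 = 7 * kap 7 τ ^ 2 := by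
  rw [kap_sq, kap_sq]; push_cast; ring

lemma D3_S {τ : ℂ} (hτ : 0 < τ.im) : D3 (-1 / τ) = (-7 * kap 7 τ ^ 3) • hat (D3 τ) := by
  unfold D3
  rw [vG_S hτ, vH_S hτ, vK_S hτ, t2_S hτ, t3_S hτ, t4_S hτ, ee_smul, ee_hat]
  simp only [hat_add, hat_smul]
  have := kap_rel τ
  funext j
  simp only [Pi.add_apply, Pi.smul_apply, smul_eq_mul]
  linear_combination (-(kap 7 τ * t3 τ * t4 τ * hat (vK τ) j) +
    kap 7 τ * t3 τ * t2 τ * hat (vH τ) j) * this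

lemma D4_S {τ : ℂ} (hτ : 0 < τ.im) : D4 (-1 / τ) = (-7 * kap 7 τ ^ 3) • hat (D2 τ) := by
  unfold D4 D2
  rw [vG_S hτ, vH_S hτ, vK_S hτ, t2_S hτ, t3_S hτ, t4_S hτ, ee_smul, ee_hat]
  simp only [hat_add, hat_smul]
  have := kap_rel τ
  funext j
  simp only [Pi.add_apply, Pi.smul_apply, smul_eq_mul]
  linear_combination (-(kap 7 τ * t2 τ * t4 τ * hat (vK τ) j) +
    kap 7 τ * t3 τ * t2 τ * hat (vG τ) j) * this

lemma D2_S {τ : ℂ} (hτ : 0 < τ.im) : D2 (-1 / τ) = (-7 * kap 7 τ ^ 3) • hat (D4 τ) := by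
  unfold D4 D2
  rw [vG_S hτ, vH_S hτ, vK_S hτ, t2_S hτ, t3_S hτ, t4_S hτ, ee_smul, ee_hat]
  simp only [hat_add, hat_smul]
  have := kap_rel τ
  funext j
  simp only [Pi.add_apply, Pi.smul_apply, smul_eq_mul]
  linear_combination (-(kap 7 τ * t3 τ * t4 τ * hat (vG τ) j) +
    kap 7 τ * t4 τ * t2 τ * hat (vH τ) j) * this

/-- phases -/
noncomputable def zz : Fin 4 → ℂ := fun j => cexp (8 * π * I * ((j : ℕ) : ℤ) ^ 2 / 7)

lemma zz0 : zz 0 = 1 := by simp [zz]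
lemma zz1 : zz 1 = z7 ^ 4 := by
  unfold zz z7; rw [← Complex.exp_nat_mul]; congr 1; simp; ring
lemma zz2 : zz 2 = z7 ^ 2 := by
  unfold zz z7; rw [← Complex.exp_nat_mul]
  refine exp_eq_of _ _ 2 ?_
  simp; ring
lemma zz3 : zz 3 = z7 := by
  unfold zz z7
  refine exp_eq_of _ _ 5 ?_
  simp; ring

lemma zz_norm (j : Fin 4) : ‖zz j‖ = 1 := by
  unfold zz
  have : (8 * π * I * ((j : ℕ) : ℤ) ^ 2 / 7 : ℂ) = ((8 * π * ((j : ℕ) : ℤ) ^ 2 / 7 : ℝ) : ℂ) * I := by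
    push_cast; ring
  rw [this, Complex.norm_exp_ofReal_mul_I]

lemma ee_zz (v : Fin 4 → ℂ) : ee (fun j => zz j * v j) = fun j => zz j * ee v j := by
  have h7 := z7_pow
  funext j
  fin_cases j
  · simp [ee, zz0, zz1, zz2, zz3]
    linear_combination (8 * v 1 * v 2 * v 3) * h7
  · simp [ee, zz0, zz1, zz2, zz3]
    ring
  · simp [ee, zz0, zz1, zz2, zz3]
    linear_combination (4 * v 1 ^ 2 * v 3 * z7 ^ 2) * h7
  · simp [ee, zz0, zz1, zz2, zz3]
    linear_combination (4 * v 2 ^ 2 * v 1 * z7 + 2 * v 1 ^ 2 * v 0 * z7) * h7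

lemma vG_T (τ : ℂ) : vG (τ + 1) = fun j => zz j * vK τ j := by
  funext j; exact gG_T _ _
lemma vK_T (τ : ℂ) : vK (τ + 1) = fun j => zz j * vG τ j := by
  funext j; exact gK_T _ _
lemma vH_T (τ : ℂ) : vH (τ + 1) = cexp (-(π * I / 4)) • fun j => zz j * vH τ j := by
  funext j
  simp only [Pi.smul_apply, smul_eq_mul]
  rw [← mul_assoc]
  exact gH_T _ _

lemma xi_mul : cexp (π * I / 4) * cexp (-(π * I / 4)) = 1 := by
  rw [← Complex.exp_add]; simp

lemma D3_T (τ : ℂ) (j : Fin 4) : D3 (τ + 1) j = zz j * D4 τ j := by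
  unfold D3 D4
  rw [vG_T, vH_T, vK_T, t2_T, t3_T, t4_T, ee_zz]
  simp only [Pi.add_apply, Pi.smul_apply, smul_eq_mul]
  linear_combination (-t4 τ * t2 τ * zz j * vH τ j) * xi_mul

lemma D4_T (τ : ℂ) (j : Fin 4) : D4 (τ + 1) j = zz j * D3 τ j := by
  unfold D3 D4
  rw [vG_T, vH_T, vK_T, t2_T, t3_T, t4_T, ee_zz]
  simp only [Pi.add_apply, Pi.smul_apply, smul_eq_mul]
  linear_combination (-t3 τ * t2 τ * zz j * vH τ j) * xi_mul

lemma D2_T (τ : ℂ) (j : Fin 4) : D2 (τ + 1) j = cexp (-(π * I / 4)) ^ 3 * zz j * D2 τ j := by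
  have h4 : cexp (-(π * I / 4)) ^ 4 = -1 := by
    rw [← Complex.exp_nat_mul, ← Complex.exp_neg_pi_mul_I]
    congr 1; push_cast; ring
  have h3 : cexp (π * I / 4) = - cexp (-(π * I / 4)) ^ 3 := by
    linear_combination cexp (π * I / 4) * h4 - cexp (-(π * I / 4)) ^ 3 * xi_mul
  unfold D2
  rw [vG_T, vH_T, vK_T, t2_T, t3_T, t4_T, ee_smul, ee_zz, h3]
  simp only [Pi.add_apply, Pi.smul_apply, smul_eq_mul]
  ring

noncomputable def Nrm (v : Fin 4 → ℂ) : ℝ := ‖v 0‖ ^ 2 + 2 * (‖v 1‖ ^ 2 + ‖v 2‖ ^ 2 + ‖v 3‖ ^ 2)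

lemma conj_z7 : (starRingEnd ℂ) z7 = z7 ^ 6 := by
  have h : (starRingEnd ℂ) z7 * z7 = 1 := by
    unfold z7
    rw [← Complex.exp_conj, ← Complex.exp_add, ← Complex.exp_zero]
    congr 1
    simp [map_ofNat (starRingEnd ℂ)]
    ring
  linear_combination (-(starRingEnd ℂ) z7) * z7_pow + z7 ^ 6 * h

lemma Nrm_eq (v : Fin 4 → ℂ) : (Nrm v : ℂ) = v 0 * (starRingEnd ℂ) (v 0) +
   2 * (v 1 * (starRingEnd ℂ) (v 1) + v 2 * (starRingEnd ℂ) (v 2) + v 3 * (starRingEnd ℂ) (v 3)) := by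
  unfold Nrm
  simp only [Complex.mul_conj, Complex.normSq_eq_norm_sq]
  push_cast; ring

lemma Nrm_hat (v : Fin 4 → ℂ) : Nrm (hat v) = 7 * Nrm v := by
  have k1 : (starRingEnd ℂ) c1 = c1 := by
    unfold c1; simp only [map_add, map_pow, conj_z7]
    linear_combination (z7 * (1 + z7 ^ 7 + z7 ^ 14 + z7 ^ 21 + z7 ^ 28)) * z7_pow
  have k2 : (starRingEnd ℂ) c2 = c2 := by
    rw [c2_eq]; simp [k1, map_ofNat (starRingEnd ℂ)]
  have k3 : (starRingEnd ℂ) c3 = c3 := by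
    rw [c3_eq]; simp [k1, k2]
  have s1 : c1 + c2 + c3 = -1 := by linear_combination c3_eq
  have s2 : c1 ^ 2 + c2 ^ 2 + c3 ^ 2 = 5 := by
    have := c1_eq
    rw [c3_eq, c2_eq]
    linear_combination (2 * c1) * this
  have s3 : c1 * c2 + c2 * c3 + c3 * c1 = -2 := by
    have : (c1 + c2 + c3) ^ 2 = 1 := by rw [s1]; norm_num
    linear_combination (this - s2) / 2
  have : (Nrm (hat v) : ℂ) = ((7 * Nrm v : ℝ) : ℂ) := by
    push_cast
    rw [Nrm_eq, Nrm_eq]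
    simp only [hat, Matrix.cons_val, map_add, map_mul, k1, k2, k3, map_ofNat]
    generalize (starRingEnd ℂ) (v 0) = y0
    generalize (starRingEnd ℂ) (v 1) = y1
    generalize (starRingEnd ℂ) (v 2) = y2
    generalize (starRingEnd ℂ) (v 3) = y3
    linear_combination 2 * (v 0 * (y1 + y2 + y3) + y0 * (v 1 + v 2 + v 3)) * s1
      + 2 * (v 1 * y1 + v 2 * y2 + v 3 * y3) * s2
      + 2 * (v 1 * y2 + v 1 * y3 + v 2 * y1 + v 2 * y3 + v 3 * y1 + v 3 * y2) * s3
  exact_mod_cast this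

lemma Nrm_smul (r : ℂ) (v : Fin 4 → ℂ) : Nrm (r • v) = ‖r‖ ^ 2 * Nrm v := by
  simp [Nrm]; ring

noncomputable def NN (τ : ℂ) : ℝ := Nrm (D2 τ) + Nrm (D3 τ) + Nrm (D4 τ)

lemma NN_T (τ : ℂ) : NN (τ + 1) = NN τ := by
  have h : ‖cexp (-(π * I / 4))‖ = 1 := by
    have : (-(π * I / 4) : ℂ) = ((-(π / 4) : ℝ) : ℂ) * I := by push_cast; ring
    rw [this, Complex.norm_exp_ofReal_mul_I]
  simp only [NN, Nrm, D2_T, D3_T, D4_T, norm_mul, norm_pow, zz_norm, h]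
  ring

lemma NN_S {τ : ℂ} (hτ : 0 < τ.im) : NN (-1 / τ) = ‖τ‖ ^ 3 * NN τ := by
  simp only [NN, D2_S hτ, D3_S hτ, D4_S hτ, Nrm_smul, Nrm_hat]
  have h : ‖kap 7 τ‖ ^ 2 = ‖τ‖ / 7 := by
    rw [← norm_pow, kap_sq]; simp
  have h2 : ‖-7 * kap 7 τ ^ 3‖ ^ 2 = ‖τ‖ ^ 3 / 7 := by
    rw [norm_mul, norm_pow]
    have : (‖(-7:ℂ)‖ * ‖kap 7 τ‖ ^ 3) ^ 2 = ‖(-7:ℂ)‖ ^ 2 * (‖kap 7 τ‖ ^ 2) ^ 3 := by ring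
    rw [this, h]; simp; ring
  rw [h2]; ring
end

section
open Complex Real

noncomputable def WW (τ : ℂ) : ℝ := rexp (-(π * τ.im / 28))

lemma WW_pos (τ : ℂ) : 0 < WW τ := Real.exp_pos _
lemma WW_le (τ : ℂ) (h : 1 ≤ τ.im) : WW τ ≤ 1 := by
  unfold WW; rw [Real.exp_le_one_iff]; have := Real.pi_pos
  have : 0 ≤ π * τ.im / 28 := by positivity
  linarith

def OO (e : ℕ) (f : ℂ → ℂ) : Prop := ∃ C : ℝ, 0 ≤ C ∧ ∀ τ : ℂ, 1 ≤ τ.im → ‖f τ‖ ≤ C * WW τ ^ e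

lemma OO.add {e : ℕ} {f g : ℂ → ℂ} (hf : OO e f) (hg : OO e g) : OO e (fun τ => f τ + g τ) := by
  obtain ⟨C, hC, h⟩ := hf
  obtain ⟨D, hD, k⟩ := hg
  refine ⟨C + D, by positivity, fun τ hτ => ?_⟩
  have := norm_add_le (f τ) (g τ)
  have := h τ hτ
  have := k τ hτ
  linarith

lemma OO.neg {e : ℕ} {f : ℂ → ℂ} (hf : OO e f) : OO e (fun τ => - f τ) := by
  obtain ⟨C, hC, h⟩ := hf
  exact ⟨C, hC, fun τ hτ => by rw [norm_neg]; exact h τ hτ⟩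

lemma OO.sub {e : ℕ} {f g : ℂ → ℂ} (hf : OO e f) (hg : OO e g) : OO e (fun τ => f τ - g τ) := by
  simpa [sub_eq_add_neg] using hf.add hg.neg

lemma OO.mono {e e' : ℕ} {f : ℂ → ℂ} (hf : OO e f) (h : e' ≤ e) : OO e' f := by
  obtain ⟨C, hC, k⟩ := hf
  refine ⟨C, hC, fun τ hτ => (k τ hτ).trans ?_⟩
  exact mul_le_mul_of_nonneg_left (pow_le_pow_of_le_one (WW_pos τ).le (WW_le τ hτ) h) hC

lemma OO.mul {e e' : ℕ} {f g : ℂ → ℂ} (hf : OO e f) (hg : OO e' g) :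
    OO (e + e') (fun τ => f τ * g τ) := by
  obtain ⟨C, hC, h⟩ := hf
  obtain ⟨D, hD, k⟩ := hg
  refine ⟨C * D, by positivity, fun τ hτ => ?_⟩
  rw [norm_mul, pow_add]
  have := mul_le_mul (h τ hτ) (k τ hτ) (norm_nonneg _) (mul_nonneg hC (pow_nonneg (WW_pos τ).le _))
  linarith

lemma OO.const (c : ℂ) : OO 0 (fun _ => c) := ⟨‖c‖, norm_nonneg _, fun τ hτ => by simp⟩

lemma summable_natAbs (r : ℝ) (h0 : 0 ≤ r) (h1 : r < 1) : Summable fun n : ℤ => r ^ n.natAbs := by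
  refine Summable.of_nat_of_neg ?_ ?_ <;> simpa using summable_geometric_of_lt_one h0 h1

lemma OO_series (ε : ℤ → ℂ) (p : ℤ → ℤ) (e : ℕ) (K : ℤ) (hε : ∀ n, ‖ε n‖ ≤ 2)
    (h : ∀ n, ε n = 0 ∨ (e ≤ p n ∧ e + |n| ≤ p n + K)) :
    OO e (fun τ => ∑' n : ℤ, ε n * cexp (π * I * (p n : ℤ) * τ / 28)) := by
  have hπ := Real.pi_pos
  set r : ℝ := rexp (-(π / 28)) with hr
  have hr0 : 0 < r := Real.exp_pos _
  have hr1 : r < 1 := by rw [hr, Real.exp_lt_one_iff]; linarith [div_pos hπ (by norm_num : (0:ℝ) < 28)]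
  have hs := summable_natAbs r hr0.le hr1
  refine ⟨2 * rexp (π * K / 28) * ∑' n : ℤ, r ^ n.natAbs, ?_, fun τ hτ => ?_⟩
  · have : 0 ≤ ∑' n : ℤ, r ^ n.natAbs := tsum_nonneg fun n => by positivity
    positivity
  · have hh := hs.hasSum.mul_left (2 * rexp (π * K / 28) * WW τ ^ e)
    refine (tsum_of_norm_bounded hh fun n => ?_).trans (le_of_eq (by ring))
    rcases h n with h0 | ⟨h1, h2⟩
    · rw [h0]; simp; have := WW_pos τ; positivity
    · rw [norm_mul]
      have e1 : ‖cexp (π * I * (p n : ℤ) * τ / 28)‖ = rexp (-(π * (p n) * τ.im / 28)) := by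
        rw [Complex.norm_exp]
        congr 1
        have : (π * I * (p n : ℤ) * τ / 28 : ℂ) = ((π * p n / 28 : ℝ) : ℂ) * (I * τ) := by
          push_cast; ring
        rw [this, Complex.re_ofReal_mul]
        simp; ring
      have e2 : rexp (-(π * (p n) * τ.im / 28)) ≤ rexp (π * K / 28) * WW τ ^ e * r ^ n.natAbs := by
        rw [hr, WW, ← Real.exp_nat_mul, ← Real.exp_nat_mul, ← Real.exp_add, ← Real.exp_add]
        apply Real.exp_le_exp.2
        have a1 : (e : ℝ) ≤ p n := by exact_mod_cast h1
        have a2 : (e : ℝ) + (n.natAbs : ℝ) ≤ p n + K := by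
          have h4 : (n.natAbs : ℝ) = ((|n| : ℤ) : ℝ) := by rw [← Int.natCast_natAbs n]; rfl
          rw [h4]
          exact_mod_cast h2
        have a3 : (n.natAbs : ℝ) - K ≤ (p n - e) * τ.im := by nlinarith
        have a4 := mul_le_mul_of_nonneg_left a3 hπ.le
        linarith
      rw [e1]
      have := mul_le_mul (hε n) e2 (Real.exp_pos _).le (by norm_num)
      linarith

noncomputable def sg (m : ℤ) : ℂ := if Even m then 1 else -1

lemma exp_sg (m : ℤ) : cexp (π * I * m) = sg m := by
  unfold sg
  split_ifs with h
  · obtain ⟨r, rfl⟩ := h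
    rw [← exp_int r]; congr 1; push_cast; ring
  · rw [Int.not_even_iff_odd] at h
    obtain ⟨r, rfl⟩ := h
    rw [← Complex.exp_pi_mul_I]
    refine exp_eq_of _ _ r ?_
    push_cast; ring

lemma sg_norm (m : ℤ) : ‖sg m‖ = 1 := by unfold sg; split_ifs <;> simp

lemma gG_ser (j : ℤ) (τ : ℂ) :
    gG j τ = ∑' n : ℤ, cexp (π * I * ((4 * (7 * n + j) ^ 2 : ℤ) : ℂ) * τ / 28) := by
  unfold gG Th
  refine tsum_congr fun n => ?_
  congr 1; push_cast; ring

lemma gK_ser (j : ℤ) (τ : ℂ) :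
    gK j τ = ∑' n : ℤ, sg (7 * n + j) * cexp (π * I * ((4 * (7 * n + j) ^ 2 : ℤ) : ℂ) * τ / 28) := by
  unfold gK Th
  refine tsum_congr fun n => ?_
  rw [← exp_sg, ← Complex.exp_add]
  congr 1; push_cast; ring

lemma gH_ser (j : ℤ) (τ : ℂ) :
    gH j τ = ∑' n : ℤ, cexp (π * I * (((14 * n + 2 * j + 7) ^ 2 : ℤ) : ℂ) * τ / 28) := by
  unfold gH Th
  refine tsum_congr fun n => ?_
  congr 1; push_cast; ring

lemma t3_ser (τ : ℂ) : t3 τ = ∑' n : ℤ, cexp (π * I * ((28 * n ^ 2 : ℤ) : ℂ) * τ / 28) := by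
  unfold t3 Th
  refine tsum_congr fun n => ?_
  congr 1; push_cast; ring

lemma t4_ser (τ : ℂ) : t4 τ = ∑' n : ℤ, sg n * cexp (π * I * ((28 * n ^ 2 : ℤ) : ℂ) * τ / 28) := by
  unfold t4 Th
  refine tsum_congr fun n => ?_
  rw [← exp_sg, ← Complex.exp_add]
  congr 1; push_cast; ring

lemma t2_ser (τ : ℂ) : t2 τ = ∑' n : ℤ, cexp (π * I * ((7 * (2 * n + 1) ^ 2 : ℤ) : ℂ) * τ / 28) := by
  unfold t2 Th
  refine tsum_congr fun n => ?_
  congr 1; push_cast; ring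

lemma OO.congr {e : ℕ} {f g : ℂ → ℂ} (hf : OO e f) (h : ∀ τ : ℂ, 1 ≤ τ.im → f τ = g τ) : OO e g := by
  obtain ⟨C, hC, k⟩ := hf
  exact ⟨C, hC, fun τ hτ => by rw [← h τ hτ]; exact k τ hτ⟩

lemma sq_bd (m s : ℤ) (hs : 0 ≤ s) (h : s ≤ m ∨ m ≤ -s) : s ^ 2 ≤ m ^ 2 := by
  rcases h with h | h <;> nlinarith

lemma gG_O (j : ℤ) (s : ℕ) (hj : 0 ≤ j) (hj' : j ≤ 3) (hs : (s : ℤ) ≤ j) : OO (4 * s ^ 2) (gG j) := by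
  have := OO_series (fun _ => 1) (fun n => 4 * (7 * n + j) ^ 2) (4 * s ^ 2) 100 (by simp) ?_
  · refine this.congr fun τ _ => ?_
    rw [gG_ser]; simp
  · intro n
    right
    have h2 : (s : ℤ) ^ 2 ≤ (7 * n + j) ^ 2 := by
      apply sq_bd _ _ (by positivity)
      omega
    push_cast
    refine ⟨by linarith, ?_⟩
    rcases abs_cases n with ⟨h, h'⟩ | ⟨h, h'⟩ <;> rw [h] <;> nlinarith

lemma gK_O (j : ℤ) (s : ℕ) (hj : 0 ≤ j) (hj' : j ≤ 3) (hs : (s : ℤ) ≤ j) : OO (4 * s ^ 2) (gK j) := by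
  have := OO_series (fun n => sg (7 * n + j)) (fun n => 4 * (7 * n + j) ^ 2) (4 * s ^ 2) 100
    (fun n => by rw [sg_norm]; norm_num) ?_
  · refine this.congr fun τ _ => ?_
    rw [gK_ser]
  · intro n
    right
    have h2 : (s : ℤ) ^ 2 ≤ (7 * n + j) ^ 2 := by
      apply sq_bd _ _ (by positivity)
      omega
    push_cast
    refine ⟨by linarith, ?_⟩
    rcases abs_cases n with ⟨h, h'⟩ | ⟨h, h'⟩ <;> rw [h] <;> nlinarith

lemma gH_O (j : ℤ) (s : ℕ) (hj : 0 ≤ j) (hj' : j ≤ 3) (hs : (s : ℤ) ≤ 7 - 2 * j) :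
    OO (s ^ 2) (gH j) := by
  have := OO_series (fun n => 1) (fun n => (14 * n + 2 * j + 7) ^ 2) (s ^ 2) 100
    (by simp) ?_
  · refine this.congr fun τ _ => ?_
    rw [gH_ser]; simp
  · intro n
    right
    have h2 : (s : ℤ) ^ 2 ≤ (14 * n + 2 * j + 7) ^ 2 := by
      apply sq_bd _ _ (by positivity)
      omega
    push_cast
    refine ⟨by linarith, ?_⟩
    rcases abs_cases n with ⟨h, h'⟩ | ⟨h, h'⟩ <;> rw [h] <;> nlinarith

lemma t2_O : OO 7 t2 := by
  have := OO_series (fun n => 1) (fun n => 7 * (2 * n + 1) ^ 2) 7 100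
    (by simp) ?_
  · refine this.congr fun τ _ => ?_
    rw [t2_ser]; simp
  · intro n
    right
    have h2 : (1 : ℤ) ^ 2 ≤ (2 * n + 1) ^ 2 := by
      apply sq_bd _ _ (by positivity)
      omega
    push_cast
    refine ⟨by linarith, ?_⟩
    rcases abs_cases n with ⟨h, h'⟩ | ⟨h, h'⟩ <;> rw [h] <;> nlinarith

lemma ser_sub_one (ε : ℤ → ℂ) (p : ℤ → ℤ) (h0 : p 0 = 0) (hε : ε 0 = 1) (τ : ℂ)
    (hs : Summable fun n : ℤ => ε n * cexp (π * I * (p n : ℤ) * τ / 28)) :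
    ∑' n : ℤ, (if n = 0 then 0 else ε n) * cexp (π * I * (p n : ℤ) * τ / 28) =
    ∑' n : ℤ, ε n * cexp (π * I * (p n : ℤ) * τ / 28) - 1 := by
  rw [hs.tsum_eq_add_tsum_ite 0]
  simp only [h0, hε]
  simp

lemma one_O (ε : ℤ → ℂ) (c : ℤ) (hc : 28 ≤ c) (hε : ∀ n, ‖ε n‖ = 1) :
   OO 8 (fun τ => ∑' n : ℤ, (if n = 0 then 0 else ε n) * cexp (π * I * ((c * n ^ 2 : ℤ) : ℂ) * τ / 28)) := by
  refine OO_series (fun n => if n = 0 then 0 else ε n) (fun n => c * n ^ 2) 8 8 ?_ ?_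
  · intro n
    split_ifs <;> simp [hε]
  · intro n
    by_cases hn : n = 0
    · left; simp [hn]
    right
    have h2 : (1 : ℤ) ^ 2 ≤ n ^ 2 := by
      apply sq_bd _ _ (by positivity)
      omega
    push_cast
    have h3 : 28 * n ^ 2 ≤ c * n ^ 2 := mul_le_mul_of_nonneg_right hc (sq_nonneg n)
    refine ⟨by nlinarith, ?_⟩
    rcases abs_cases n with ⟨h, h'⟩ | ⟨h, h'⟩ <;> rw [h] <;> nlinarith

lemma ser_summable (ε : ℤ → ℂ) (c : ℤ) (hc : 0 < c) (hε : ∀ n, ‖ε n‖ = 1) (τ : ℂ) (hτ : 0 < τ.im) :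
    Summable fun n : ℤ => ε n * cexp (π * I * ((c * n ^ 2 : ℤ) : ℂ) * τ / 28) := by
  have := Th_summable (c / 28) 0 0 (by positivity) hτ
  have := this.norm
  refine Summable.of_norm ?_
  refine this.congr fun n => ?_
  rw [norm_mul, hε, one_mul]
  congr 2; push_cast; ring

lemma g0_O : OO 8 (fun τ => gG 0 τ - 1) := by
  refine (one_O (fun _ => 1) 196 (by norm_num) (by simp)).congr fun τ hτ => ?_
  rw [ser_sub_one _ _ (by simp) rfl _ (ser_summable (fun _ => 1) 196 (by norm_num) (by simp) τ (by linarith)), gG_ser]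
  congr 1
  refine tsum_congr fun n => ?_
  rw [one_mul]; congr 1; push_cast; ring

lemma k0_O : OO 8 (fun τ => gK 0 τ - 1) := by
  refine (one_O (fun n => sg (7 * n)) 196 (by norm_num) (by simp [sg_norm])).congr fun τ hτ => ?_
  rw [ser_sub_one _ _ (by simp) (by simp [sg]) _ (ser_summable (fun n => sg (7 * n)) 196 (by norm_num) (by simp [sg_norm]) τ (by linarith)), gK_ser]
  congr 1
  refine tsum_congr fun n => ?_
  rw [add_zero]; congr 2; push_cast; ring

lemma t3_O : OO 8 (fun τ => t3 τ - 1) := by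
  refine (one_O (fun _ => 1) 28 (by norm_num) (by simp)).congr fun τ hτ => ?_
  rw [ser_sub_one _ _ (by simp) rfl _ (ser_summable (fun _ => 1) 28 (by norm_num) (by simp) τ (by linarith)), t3_ser]
  congr 1
  refine tsum_congr fun n => ?_
  rw [one_mul]

lemma t4_O : OO 8 (fun τ => t4 τ - 1) := by
  refine (one_O sg 28 (by norm_num) (by simp [sg_norm])).congr fun τ hτ => ?_
  rw [ser_sub_one _ _ (by simp) (by simp [sg]) _ (ser_summable sg 28 (by norm_num) (by simp [sg_norm]) τ (by linarith)), t4_ser]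

lemma gG_summable (j : ℤ) {τ : ℂ} (hτ : 0 < τ.im) :
    Summable fun n : ℤ => cexp (π * I * ((4 * (7 * n + j) ^ 2 : ℤ) : ℂ) * τ / 28) := by
  refine (Th_summable 7 (j / 7) 0 (by norm_num) hτ).congr fun n => ?_
  congr 1; push_cast; ring

lemma gk_O : OO 8 (fun τ => gG 1 τ + gK 1 τ) := by
  have := OO_series (fun n => 1 + sg (7 * n + 1)) (fun n => 4 * (7 * n + 1) ^ 2) 8 100
    (fun n => (norm_add_le _ _).trans (by rw [sg_norm]; norm_num)) ?_
  · refine this.congr fun τ hτ => ?_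
    have hs := gG_summable 1 (τ := τ) (by linarith)
    rw [gK_ser, gG_ser, ← Summable.tsum_add hs]
    · refine tsum_congr fun n => ?_
      ring
    · refine Summable.of_norm (hs.norm.congr fun n => ?_)
      rw [norm_mul, sg_norm, one_mul]
  · intro n
    by_cases hn : n = 0
    · left; rw [hn]; simp [sg]
    right
    have h2 : (6 : ℤ) ^ 2 ≤ (7 * n + 1) ^ 2 := by
      apply sq_bd _ _ (by positivity)
      omega
    push_cast
    refine ⟨by linarith, ?_⟩
    rcases abs_cases n with ⟨h, h'⟩ | ⟨h, h'⟩ <;> rw [h] <;> nlinarith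

lemma D3_O (j : Fin 4) : OO 8 (fun τ => D3 τ j) := by
  have g0 := gG_O 0 0 (by norm_num) (by norm_num) (by norm_num)
  have g1 := gG_O 1 1 (by norm_num) (by norm_num) (by norm_num)
  have g2 := gG_O 2 2 (by norm_num) (by norm_num) (by norm_num)
  have g3 := gG_O 3 3 (by norm_num) (by norm_num) (by norm_num)
  have k0 := gK_O 0 0 (by norm_num) (by norm_num) (by norm_num)
  have k1 := gK_O 1 1 (by norm_num) (by norm_num) (by norm_num)
  have k2 := gK_O 2 2 (by norm_num) (by norm_num) (by norm_num)
  have k3 := gK_O 3 3 (by norm_num) (by norm_num) (by norm_num)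
  have h0 := gH_O 0 7 (by norm_num) (by norm_num) (by norm_num)
  have h1 := gH_O 1 5 (by norm_num) (by norm_num) (by norm_num)
  have h2 := gH_O 2 3 (by norm_num) (by norm_num) (by norm_num)
  have h3 := gH_O 3 1 (by norm_num) (by norm_num) (by norm_num)
  have u3 : OO 0 t3 := ((t3_O.mono (Nat.zero_le 8)).add (OO.const 1)).congr fun τ _ => by ring
  have u4 : OO 0 t4 := ((t4_O.mono (Nat.zero_le 8)).add (OO.const 1)).congr fun τ _ => by ring
  fin_cases j
  · refine (((((((OO.const 8).mul g1).mul g2).mul g3).mono (e' := 8) (by norm_num)).add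
      ((g0_O.mul (((g0.mul g0).add g0).add (OO.const 1))).neg.mono (e' := 8) (by norm_num))).add
      ((((u3.mul t2_O).mul h0).neg.mono (e' := 8) (by norm_num)).add
      (((((t3_O.mul u4).mul k0).mono (e' := 8) (by norm_num)).add
        ((t4_O.mul k0).mono (e' := 8) (by norm_num))).add k0_O))).congr fun τ _ => ?_
    simp [D3, ee, vG, vH, vK, Matrix.vecHead, Matrix.vecTail]
    ring
  · refine ((((((g1.mul g0_O).mul (g0.add (OO.const 1))).mono (e' := 8) (by norm_num)).add
      ((((OO.const 2).mul (g2.mul g2)).mul g0).mono (e' := 8) (by norm_num))).add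
      ((((OO.const 4).mul (g3.mul g3)).mul g2).mono (e' := 8) (by norm_num))).add
      ((((u3.mul t2_O).mul h1).neg.mono (e' := 8) (by norm_num)).add
      (((((t3_O.mul u4).mul k1).mono (e' := 8) (by norm_num)).add
        ((t4_O.mul k1).mono (e' := 8) (by norm_num))).add gk_O))).congr fun τ _ => ?_
    simp [D3, ee, vG, vH, vK, Matrix.vecHead, Matrix.vecTail]
    ring
  · refine (((((g2.mul (g0.mul g0)).mono (e' := 8) (by norm_num)).add
      ((((OO.const 2).mul (g3.mul g3)).mul g0).mono (e' := 8) (by norm_num))).add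
      ((((OO.const 4).mul (g1.mul g1)).mul g3).mono (e' := 8) (by norm_num))).add
      ((((u3.mul t2_O).mul h2).neg.mono (e' := 8) (by norm_num)).add
      (((u3.mul u4).mul k2).mono (e' := 8) (by norm_num)))).congr fun τ _ => ?_
    simp [D3, ee, vG, vH, vK, Matrix.vecHead, Matrix.vecTail]
    ring
  · refine (((((g3.mul (g0.mul g0)).mono (e' := 8) (by norm_num)).add
      ((((OO.const 2).mul (g1.mul g1)).mul g0).mono (e' := 8) (by norm_num))).add
      ((((OO.const 4).mul (g2.mul g2)).mul g1).mono (e' := 8) (by norm_num))).add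
      ((((u3.mul t2_O).mul h3).neg.mono (e' := 8) (by norm_num)).add
      (((u3.mul u4).mul k3).mono (e' := 8) (by norm_num)))).congr fun τ _ => ?_
    simp [D3, ee, vG, vH, vK, Matrix.vecHead, Matrix.vecTail]
    ring

lemma D4_O (j : Fin 4) : OO 8 (fun τ => D4 τ j) := by
  have g0 := gG_O 0 0 (by norm_num) (by norm_num) (by norm_num)
  have g1 := gG_O 1 1 (by norm_num) (by norm_num) (by norm_num)
  have g2 := gG_O 2 2 (by norm_num) (by norm_num) (by norm_num)
  have g3 := gG_O 3 3 (by norm_num) (by norm_num) (by norm_num)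
  have k0 := gK_O 0 0 (by norm_num) (by norm_num) (by norm_num)
  have k1 := gK_O 1 1 (by norm_num) (by norm_num) (by norm_num)
  have k2 := gK_O 2 2 (by norm_num) (by norm_num) (by norm_num)
  have k3 := gK_O 3 3 (by norm_num) (by norm_num) (by norm_num)
  have h0 := gH_O 0 7 (by norm_num) (by norm_num) (by norm_num)
  have h1 := gH_O 1 5 (by norm_num) (by norm_num) (by norm_num)
  have h2 := gH_O 2 3 (by norm_num) (by norm_num) (by norm_num)
  have h3 := gH_O 3 1 (by norm_num) (by norm_num) (by norm_num)
  have u3 : OO 0 t3 := ((t3_O.mono (Nat.zero_le 8)).add (OO.const 1)).congr fun τ _ => by ring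
  have u4 : OO 0 t4 := ((t4_O.mono (Nat.zero_le 8)).add (OO.const 1)).congr fun τ _ => by ring
  fin_cases j
  · refine (((((((OO.const 8).mul k1).mul k2).mul k3).mono (e' := 8) (by norm_num)).add
      ((k0_O.mul (((k0.mul k0).add k0).add (OO.const 1))).neg.mono (e' := 8) (by norm_num))).add
      ((((u4.mul t2_O).mul h0).neg.mono (e' := 8) (by norm_num)).add
      (((((t4_O.mul u3).mul g0).mono (e' := 8) (by norm_num)).add
        ((t3_O.mul g0).mono (e' := 8) (by norm_num))).add g0_O))).congr fun τ _ => ?_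
    simp [D4, ee, vG, vH, vK, Matrix.vecHead, Matrix.vecTail]
    ring
  · refine ((((((k1.mul k0_O).mul (k0.add (OO.const 1))).mono (e' := 8) (by norm_num)).add
      ((((OO.const 2).mul (k2.mul k2)).mul k0).mono (e' := 8) (by norm_num))).add
      ((((OO.const 4).mul (k3.mul k3)).mul k2).mono (e' := 8) (by norm_num))).add
      ((((u4.mul t2_O).mul h1).neg.mono (e' := 8) (by norm_num)).add
      (((((t4_O.mul u3).mul g1).mono (e' := 8) (by norm_num)).add
        ((t3_O.mul g1).mono (e' := 8) (by norm_num))).add gk_O))).congr fun τ _ => ?_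
    simp [D4, ee, vG, vH, vK, Matrix.vecHead, Matrix.vecTail]
    ring
  · refine (((((k2.mul (k0.mul k0)).mono (e' := 8) (by norm_num)).add
      ((((OO.const 2).mul (k3.mul k3)).mul k0).mono (e' := 8) (by norm_num))).add
      ((((OO.const 4).mul (k1.mul k1)).mul k3).mono (e' := 8) (by norm_num))).add
      ((((u4.mul t2_O).mul h2).neg.mono (e' := 8) (by norm_num)).add
      (((u4.mul u3).mul g2).mono (e' := 8) (by norm_num)))).congr fun τ _ => ?_
    simp [D4, ee, vG, vH, vK, Matrix.vecHead, Matrix.vecTail]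
    ring
  · refine (((((k3.mul (k0.mul k0)).mono (e' := 8) (by norm_num)).add
      ((((OO.const 2).mul (k1.mul k1)).mul k0).mono (e' := 8) (by norm_num))).add
      ((((OO.const 4).mul (k2.mul k2)).mul k1).mono (e' := 8) (by norm_num))).add
      ((((u4.mul t2_O).mul h3).neg.mono (e' := 8) (by norm_num)).add
      (((u4.mul u3).mul g3).mono (e' := 8) (by norm_num)))).congr fun τ _ => ?_
    simp [D4, ee, vG, vH, vK, Matrix.vecHead, Matrix.vecTail]
    ring

lemma D2_O (j : Fin 4) : OO 8 (fun τ => D2 τ j) := by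
  have g0 := gG_O 0 0 (by norm_num) (by norm_num) (by norm_num)
  have g1 := gG_O 1 1 (by norm_num) (by norm_num) (by norm_num)
  have g2 := gG_O 2 2 (by norm_num) (by norm_num) (by norm_num)
  have g3 := gG_O 3 3 (by norm_num) (by norm_num) (by norm_num)
  have k0 := gK_O 0 0 (by norm_num) (by norm_num) (by norm_num)
  have k1 := gK_O 1 1 (by norm_num) (by norm_num) (by norm_num)
  have k2 := gK_O 2 2 (by norm_num) (by norm_num) (by norm_num)
  have k3 := gK_O 3 3 (by norm_num) (by norm_num) (by norm_num)
  have h0 := gH_O 0 7 (by norm_num) (by norm_num) (by norm_num)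
  have h1 := gH_O 1 5 (by norm_num) (by norm_num) (by norm_num)
  have h2 := gH_O 2 3 (by norm_num) (by norm_num) (by norm_num)
  have h3 := gH_O 3 1 (by norm_num) (by norm_num) (by norm_num)
  have u3 : OO 0 t3 := ((t3_O.mono (Nat.zero_le 8)).add (OO.const 1)).congr fun τ _ => by ring
  have u4 : OO 0 t4 := ((t4_O.mono (Nat.zero_le 8)).add (OO.const 1)).congr fun τ _ => by ring
  fin_cases j
  · refine (((((((OO.const 8).mul h1).mul h2).mul h3).mono (e' := 8) (by norm_num)).add
      (((h0.mul h0).mul h0).neg.mono (e' := 8) (by norm_num))).add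
      ((t2_O.mul ((((t4_O.mul k0).mono (e' := 8) (by norm_num)).add k0_O).sub
        (((t3_O.mul g0).mono (e' := 8) (by norm_num)).add g0_O))).mono (e' := 8) (by norm_num))).congr fun τ _ => ?_
    simp [D2, ee, vG, vH, vK, Matrix.vecHead, Matrix.vecTail]
    ring
  · refine (((((h1.mul (h0.mul h0)).mono (e' := 8) (by norm_num)).add
      ((((OO.const 2).mul (h2.mul h2)).mul h0).mono (e' := 8) (by norm_num))).add
      ((((OO.const 4).mul (h3.mul h3)).mul h2).mono (e' := 8) (by norm_num))).add
      ((((t2_O.mul u4).mul k1).mono (e' := 8) (by norm_num)).sub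
      (((t2_O.mul u3).mul g1).mono (e' := 8) (by norm_num)))).congr fun τ _ => ?_
    simp [D2, ee, vG, vH, vK, Matrix.vecHead, Matrix.vecTail]
    ring
  · refine (((((h2.mul (h0.mul h0)).mono (e' := 8) (by norm_num)).add
      ((((OO.const 2).mul (h3.mul h3)).mul h0).mono (e' := 8) (by norm_num))).add
      ((((OO.const 4).mul (h1.mul h1)).mul h3).mono (e' := 8) (by norm_num))).add
      ((((t2_O.mul u4).mul k2).mono (e' := 8) (by norm_num)).sub
      (((t2_O.mul u3).mul g2).mono (e' := 8) (by norm_num)))).congr fun τ _ => ?_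
    simp [D2, ee, vG, vH, vK, Matrix.vecHead, Matrix.vecTail]
    ring
  · refine (((((h3.mul (h0.mul h0)).mono (e' := 8) (by norm_num)).add
      ((((OO.const 2).mul (h1.mul h1)).mul h0).mono (e' := 8) (by norm_num))).add
      ((((OO.const 4).mul (h2.mul h2)).mul h1).mono (e' := 8) (by norm_num))).add
      ((((t2_O.mul u4).mul k3).mono (e' := 8) (by norm_num)).sub
      (((t2_O.mul u3).mul g3).mono (e' := 8) (by norm_num)))).congr fun τ _ => ?_
    simp [D2, ee, vG, vH, vK, Matrix.vecHead, Matrix.vecTail]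
    ring
end

section
open Complex Real UpperHalfPlane

lemma eta_T_norm (τ : ℂ) : ‖ModularForm.eta (τ + 1)‖ = ‖ModularForm.eta τ‖ := by
  unfold ModularForm.eta
  have h : ∀ n, ModularForm.eta_q n (τ + 1) = ModularForm.eta_q n τ := by
    intro n
    rw [ModularForm.eta_q_eq_cexp, ModularForm.eta_q_eq_cexp]
    refine exp_eq_of _ _ (n + 1) ?_
    push_cast; ring
  simp only [h, norm_mul]
  congr 1
  simp [Function.Periodic.qParam, Complex.norm_exp]

lemma eta_S_norm {τ : ℂ} (hτ : 0 < τ.im) :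
    ‖ModularForm.eta (-1 / τ)‖ ^ 2 = ‖τ‖ * ‖ModularForm.eta τ‖ ^ 2 := by
  have h := ModularForm.eta_comp_eq_csqrt_I_inv (show τ ∈ upperHalfPlaneSet from hτ)
  simp only [Function.comp, Pi.smul_apply, Pi.mul_apply, smul_eq_mul] at h
  have sq : ∀ z : ℂ, ‖Complex.sqrt z‖ ^ 2 = ‖z‖ := by
    intro z
    rw [← norm_pow]
    congr 1
    unfold Complex.sqrt
    exact_mod_cast Complex.cpow_nat_inv_pow z (n := 2) (by norm_num)
  rw [h]
  simp only [norm_mul, norm_inv, mul_pow, inv_pow, sq]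
  simp

noncomputable def QQ (τ : ℂ) : ℝ := NN τ / ‖ModularForm.eta τ‖ ^ 6

lemma QQ_T (τ : ℂ) : QQ (τ + 1) = QQ τ := by
  unfold QQ; rw [NN_T, eta_T_norm]

lemma QQ_S {τ : ℂ} (hτ : 0 < τ.im) : QQ (-1 / τ) = QQ τ := by
  unfold QQ
  have hτ0 : τ ≠ 0 := by rintro rfl; simp at hτ
  have h : ‖ModularForm.eta (-1 / τ)‖ ^ 6 = ‖τ‖ ^ 3 * ‖ModularForm.eta τ‖ ^ 6 := by
    have := eta_S_norm hτ
    calc _ = (‖ModularForm.eta (-1 / τ)‖ ^ 2) ^ 3 := by ring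
      _ = _ := by rw [this]; ring
  rw [NN_S hτ, h, mul_div_mul_left]
  have := norm_pos_iff.2 hτ0
  positivity

open ModularGroup in
lemma QQ_inv (g : Matrix.SpecialLinearGroup (Fin 2) ℤ) (τ : ℍ) : QQ ((g • τ : ℍ) : ℂ) = QQ τ := by
  have : g ∈ Subgroup.closure {S, T} := by simp [SpecialLinearGroup.SL2Z_generators]
  induction this using Subgroup.closure_induction generalizing τ with
  | one => simp
  | mem x hx =>
    rcases hx with rfl | rfl
    · rw [UpperHalfPlane.modular_S_smul]
      rw [← QQ_S τ.2]
      congr 1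
      simp [neg_div, inv_neg]
    · rw [UpperHalfPlane.modular_T_smul, ← QQ_T (τ : ℂ)]
      congr 1
      simp [add_comm]
  | mul x y _ _ hx hy => rw [mul_smul, hx, hy]
  | inv x _ hx =>
    rw [← hx (x⁻¹ • τ), smul_inv_smul]

noncomputable def lam : Fin 4 → ℂ := ![1, (√2 : ℝ), (√2 : ℝ), (√2 : ℝ)]

noncomputable def FF (τ : ℂ) : EuclideanSpace ℂ (Fin 3 × Fin 4) :=
  WithLp.toLp 2 fun p => lam p.2 * (![D2 τ, D3 τ, D4 τ] p.1 p.2) / ModularForm.eta τ ^ 3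

lemma FF_norm (τ : ℂ) : ‖FF τ‖ ^ 2 = QQ τ := by
  rw [EuclideanSpace.norm_sq_eq, Fintype.sum_prod_type, Fin.sum_univ_three]
  simp only [Fin.sum_univ_four, FF, QQ, NN, Nrm, lam]
  simp [norm_pow, div_pow, mul_pow, abs_of_nonneg (Real.sqrt_nonneg 2)]
  ring

lemma gdiff {τ : ℂ} (hτ : 0 < τ.im) (j : ℤ) : DifferentiableAt ℂ (gG j) τ ∧
    DifferentiableAt ℂ (gH j) τ ∧ DifferentiableAt ℂ (gK j) τ :=
  ⟨Th_diff _ _ _ (by norm_num) hτ, Th_diff _ _ _ (by norm_num) hτ, Th_diff _ _ _ (by norm_num) hτ⟩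

lemma tdiff {τ : ℂ} (hτ : 0 < τ.im) : DifferentiableAt ℂ t2 τ ∧
    DifferentiableAt ℂ t3 τ ∧ DifferentiableAt ℂ t4 τ :=
  ⟨Th_diff _ _ _ (by norm_num) hτ, Th_diff _ _ _ (by norm_num) hτ, Th_diff _ _ _ (by norm_num) hτ⟩

lemma ee_diff {v : ℂ → Fin 4 → ℂ} {τ : ℂ} (h : ∀ j, DifferentiableAt ℂ (fun τ => v τ j) τ) (j : Fin 4) :
    DifferentiableAt ℂ (fun τ => ee (v τ) j) τ := by
  have h0 := h 0
  have h1 := h 1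
  have h2 := h 2
  have h3 := h 3
  fin_cases j <;> simp only [ee] <;> simp <;> fun_prop

lemma DDdiff {τ : ℂ} (hτ : 0 < τ.im) (j : Fin 4) : DifferentiableAt ℂ (fun τ => D2 τ j) τ ∧
    DifferentiableAt ℂ (fun τ => D3 τ j) τ ∧ DifferentiableAt ℂ (fun τ => D4 τ j) τ := by
  obtain ⟨a2, a3, a4⟩ := tdiff hτ
  have hG : ∀ j, DifferentiableAt ℂ (fun τ => vG τ j) τ := fun j => (gdiff hτ _).1
  have hH : ∀ j, DifferentiableAt ℂ (fun τ => vH τ j) τ := fun j => (gdiff hτ _).2.1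
  have hK : ∀ j, DifferentiableAt ℂ (fun τ => vK τ j) τ := fun j => (gdiff hτ _).2.2
  have eG := ee_diff hG j
  have eH := ee_diff hH j
  have eK := ee_diff hK j
  have hGj := hG j
  have hHj := hH j
  have hKj := hK j
  simp only [D2, D3, D4, Pi.add_apply, Pi.smul_apply, smul_eq_mul]
  refine ⟨?_, ?_, ?_⟩ <;> fun_prop

lemma FF_diff {τ : ℂ} (hτ : 0 < τ.im) : DifferentiableAt ℂ FF τ := by
  rw [differentiableAt_euclidean]
  intro p
  have h := DDdiff hτ p.2
  have he : DifferentiableAt ℂ ModularForm.eta τ :=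
    ModularForm.differentiableAt_eta_of_mem_upperHalfPlaneSet hτ
  have he0 : ModularForm.eta τ ≠ 0 := ModularForm.eta_ne_zero hτ
  obtain ⟨i, j⟩ := p
  simp only [FF]
  refine DifferentiableAt.div (DifferentiableAt.mul (by fun_prop) ?_) (by fun_prop) (by positivity)
  fin_cases i
  · exact h.1
  · exact h.2.1
  · exact h.2.2
end

section
open Complex Real UpperHalfPlane

lemma NN_O : ∃ C : ℝ, 0 ≤ C ∧ ∀ τ : ℂ, 1 ≤ τ.im → NN τ ≤ C * WW τ ^ 16 := by
  have key : ∀ D : ℂ → Fin 4 → ℂ, (∀ j, OO 8 (fun τ => D τ j)) →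
      ∃ C : ℝ, 0 ≤ C ∧ ∀ τ : ℂ, 1 ≤ τ.im → Nrm (D τ) ≤ C * WW τ ^ 16 := by
    intro D h
    obtain ⟨C0, p0, h0⟩ := h 0
    obtain ⟨C1, p1, h1⟩ := h 1
    obtain ⟨C2, p2, h2⟩ := h 2
    obtain ⟨C3, p3, h3⟩ := h 3
    refine ⟨C0 ^ 2 + 2 * (C1 ^ 2 + C2 ^ 2 + C3 ^ 2), by positivity, fun τ hτ => ?_⟩
    have q0 := pow_le_pow_left₀ (norm_nonneg _) (h0 τ hτ) 2
    have q1 := pow_le_pow_left₀ (norm_nonneg _) (h1 τ hτ) 2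
    have q2 := pow_le_pow_left₀ (norm_nonneg _) (h2 τ hτ) 2
    have q3 := pow_le_pow_left₀ (norm_nonneg _) (h3 τ hτ) 2
    unfold Nrm
    calc _ ≤ (C0 * WW τ ^ 8) ^ 2 + 2 * ((C1 * WW τ ^ 8) ^ 2 + (C2 * WW τ ^ 8) ^ 2 + (C3 * WW τ ^ 8) ^ 2) := by
          linarith
      _ = _ := by ring
  obtain ⟨A, pA, hA⟩ := key _ D2_O
  obtain ⟨B, pB, hB⟩ := key _ D3_O
  obtain ⟨C, pC, hC⟩ := key _ D4_O
  refine ⟨A + B + C, by positivity, fun τ hτ => ?_⟩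
  have := hA τ hτ
  have := hB τ hτ
  have := hC τ hτ
  unfold NN
  linarith

lemma Nrm_nonneg (v : Fin 4 → ℂ) : 0 ≤ Nrm v := by unfold Nrm; positivity
lemma NN_nonneg (τ : ℂ) : 0 ≤ NN τ := by
  unfold NN; have := Nrm_nonneg (D2 τ); have := Nrm_nonneg (D3 τ); have := Nrm_nonneg (D4 τ); linarith
lemma QQ_nonneg (τ : ℂ) : 0 ≤ QQ τ := div_nonneg (NN_nonneg τ) (by positivity)

lemma eta_lower : ∃ c A : ℝ, 0 < c ∧ ∀ τ : ℂ, A ≤ τ.im → 1 ≤ τ.im →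
    WW τ ^ 56 ≤ c * ‖ModularForm.eta τ‖ ^ 24 := by
  obtain ⟨c, hc, h⟩ := ModularForm.exp_isBigO_discriminant.exists_pos
  have h := h.bound
  rw [UpperHalfPlane.atImInfty, Filter.eventually_comap, Filter.eventually_atTop] at h
  obtain ⟨A, hA⟩ := h
  refine ⟨c, A, hc, fun τ h1 h2 => ?_⟩
  have := hA τ.im h1 ⟨τ, by linarith⟩ rfl
  rw [Real.norm_of_nonneg (Real.exp_pos _).le] at this
  convert this using 1
  · unfold WW
    rw [← Real.exp_nat_mul]
    congr 1
    show _ = -2 * π * τ.im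
    push_cast; ring
  · unfold ModularForm.discriminant
    rw [norm_pow]

lemma QQ_decay (ε : ℝ) (hε : 0 < ε) : ∃ A : ℝ, 1 ≤ A ∧ ∀ τ : ℂ, A ≤ τ.im → QQ τ < ε := by
  obtain ⟨C, hC, h1⟩ := NN_O
  obtain ⟨c, A, hc, h2⟩ := eta_lower
  have hB : 0 ≤ 2 * (C ^ 4 * c + 1) / ε ^ 4 := by positivity
  refine ⟨max 1 A + 2 * (C ^ 4 * c + 1) / ε ^ 4, by linarith [le_max_left 1 A], fun τ hτ => ?_⟩
  have a1 : 1 ≤ τ.im := by linarith [le_max_left 1 A]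
  have a2 : A ≤ τ.im := by linarith [le_max_right 1 A]
  have a3 : 2 * (C ^ 4 * c + 1) / ε ^ 4 ≤ τ.im := by linarith [le_max_left 1 A]
  have k1 := h1 τ a1
  have k2 := h2 τ a2 a1
  have hw := WW_pos τ
  have he : 0 < ‖ModularForm.eta τ‖ :=
    norm_pos_iff.2 (ModularForm.eta_ne_zero (show τ ∈ upperHalfPlaneSet from (by show 0 < τ.im; linarith)))
  have k3 : QQ τ ^ 4 ≤ C ^ 4 * c * WW τ ^ 8 := by
    unfold QQ
    rw [div_pow, div_le_iff₀ (by positivity)]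
    calc NN τ ^ 4 ≤ (C * WW τ ^ 16) ^ 4 := pow_le_pow_left₀ (NN_nonneg τ) k1 4
      _ = C ^ 4 * WW τ ^ 8 * WW τ ^ 56 := by ring
      _ ≤ C ^ 4 * WW τ ^ 8 * (c * ‖ModularForm.eta τ‖ ^ 24) := by gcongr
      _ = _ := by ring
  have k4 : WW τ ^ 8 * τ.im ≤ 2 := by
    have e : WW τ ^ 8 = (rexp (2 * π * τ.im / 7))⁻¹ := by
      unfold WW
      rw [← Real.exp_nat_mul, ← Real.exp_neg]; congr 1; push_cast; ring
    rw [e, inv_mul_le_iff₀ (Real.exp_pos _)]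
    have := Real.add_one_le_exp (2 * π * τ.im / 7)
    have := Real.pi_gt_three
    nlinarith
  have k5 : QQ τ ^ 4 < ε ^ 4 := by
    rw [div_le_iff₀ (by positivity)] at a3
    have hw8 : 0 < WW τ ^ 8 := by positivity
    have : 2 * (C ^ 4 * c + 1) * WW τ ^ 8 ≤ ε ^ 4 * 2 := by
      calc _ ≤ τ.im * ε ^ 4 * WW τ ^ 8 := by gcongr
        _ = ε ^ 4 * (WW τ ^ 8 * τ.im) := by ring
        _ ≤ _ := by gcongr
    linarith
  exact lt_of_pow_lt_pow_left₀ 4 hε.le k5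

lemma FF_cont {τ : ℂ} (hτ : 0 < τ.im) : ContinuousAt QQ τ := by
  have : QQ = fun τ => ‖FF τ‖ ^ 2 := by ext τ; rw [FF_norm]
  rw [this]
  exact ((FF_diff hτ).continuousAt.norm).pow 2

theorem QQ_zero {τ₀ : ℂ} (h0 : 0 < τ₀.im) : QQ τ₀ = 0 := by
  by_contra hne
  have hpos : 0 < QQ τ₀ := lt_of_le_of_ne (QQ_nonneg _) (Ne.symm hne)
  obtain ⟨A, hA1, hA⟩ := QQ_decay _ hpos
  set C : Set ℂ := Set.Icc (-(1/2) : ℝ) (1/2) ×ℂ Set.Icc (1/2 : ℝ) A with hC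
  have hCc : IsCompact C := isCompact_Icc.reProdIm isCompact_Icc
  have hred : ∀ τ : ℂ, 0 < τ.im → QQ τ < QQ τ₀ ∨ ∃ σ ∈ C, QQ σ = QQ τ := by
    intro τ hτ
    obtain ⟨g, hg⟩ := ModularGroup.exists_smul_mem_fd ⟨τ, hτ⟩
    have hi := QQ_inv g ⟨τ, hτ⟩
    set σ := g • (⟨τ, hτ⟩ : ℍ) with hσ
    have h3 := ModularGroup.three_le_four_mul_im_sq_of_mem_fd hg
    have hip := σ.im_pos
    by_cases h : A ≤ σ.im
    · left
      have := hA σ h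
      rw [hi] at this
      exact this
    · right
      refine ⟨σ, ?_, hi⟩
      rw [hC, Complex.mem_reProdIm]
      refine ⟨abs_le.1 hg.2, ?_, ?_⟩
      · show 1 / 2 ≤ σ.im
        nlinarith
      · exact (not_le.1 h).le
  have hCpos : ∀ σ ∈ C, 0 < σ.im := by
    intro σ hσ
    rw [hC, Complex.mem_reProdIm] at hσ
    linarith [hσ.2.1]
  obtain ⟨σ₀, hσ₀, hσ₀'⟩ := (hred τ₀ h0).resolve_left (lt_irrefl _)
  obtain ⟨p, hp, hmax⟩ := hCc.exists_isMaxOn ⟨σ₀, hσ₀⟩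
    (fun σ hσ => (FF_cont (hCpos σ hσ)).continuousWithinAt : ContinuousOn QQ C)
  have hp0 : QQ τ₀ ≤ QQ p := by rw [← hσ₀']; exact hmax hσ₀
  have hglob : ∀ τ : ℂ, 0 < τ.im → QQ τ ≤ QQ p := by
    intro τ hτ
    rcases hred τ hτ with h | ⟨σ, hσ, h⟩
    · linarith
    · rw [← h]; exact hmax hσ
  have hU : IsPreconnected {z : ℂ | 0 < z.im} := (convex_halfSpace_im_gt 0).isPreconnected
  have hO : IsOpen {z : ℂ | 0 < z.im} := isOpen_lt continuous_const Complex.continuous_im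
  have hd : DifferentiableOn ℂ FF {z : ℂ | 0 < z.im} :=
    fun z hz => (FF_diff hz).differentiableWithinAt
  have hm : IsMaxOn (norm ∘ FF) {z : ℂ | 0 < z.im} p := by
    intro z hz
    have := hglob z hz
    rw [← FF_norm, ← FF_norm] at this
    exact le_of_sq_le_sq this (norm_nonneg _)
  have heq := Complex.norm_eqOn_of_isPreconnected_of_isMaxOn hU hO hd (hCpos p hp) hm
  have hz : (0:ℝ) < (A * Complex.I : ℂ).im := by simp; linarith
  have e := heq hz
  simp only [Function.comp, Function.const] at e
  have e2 : QQ (A * Complex.I) = QQ p := by rw [← FF_norm, ← FF_norm, e]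
  have := hA (A * Complex.I) (by simp)
  linarith

theorem D3_zero {τ : ℂ} (h0 : 0 < τ.im) (j : Fin 4) : D3 τ j = 0 := by
  have h := QQ_zero h0
  unfold QQ at h
  have he : 0 < ‖ModularForm.eta τ‖ :=
    norm_pos_iff.2 (ModularForm.eta_ne_zero (show τ ∈ upperHalfPlaneSet from h0))
  have hN : NN τ = 0 := by
    rcases div_eq_zero_iff.1 h with h | h
    · exact h
    · exact absurd h (by positivity)
  unfold NN at hN
  have a2 := Nrm_nonneg (D2 τ)
  have a3 := Nrm_nonneg (D3 τ)
  have a4 := Nrm_nonneg (D4 τ)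
  have h3 : Nrm (D3 τ) = 0 := by linarith
  unfold Nrm at h3
  have b0 := sq_nonneg ‖D3 τ 0‖
  have b1 := sq_nonneg ‖D3 τ 1‖
  have b2 := sq_nonneg ‖D3 τ 2‖
  have b3 := sq_nonneg ‖D3 τ 3‖
  have : ‖D3 τ j‖ ^ 2 = 0 := by fin_cases j <;> simp only [Fin.zero_eta, Fin.mk_one, Fin.reduceFinMk] <;> linarith
  simpa using this
end

section
open Complex Real

lemma coeff_zero (a : ℕ → ℂ)
    (h : ∀ τ : ℂ, 0 < τ.im → HasSum (fun n => a n * cexp (π * I * (n : ℂ) * τ / 28)) 0) (n : ℕ) :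
    a n = 0 := by
  have hπ : (π : ℂ) ≠ 0 := by exact_mod_cast Real.pi_ne_zero
  have h1 : ∀ z : ℂ, z ≠ 0 → ‖z‖ < 1 → HasSum (fun n => z ^ n * a n) 0 := by
    intro z h0 hz
    have hl : 28 * Complex.log z / (π * I) = ((28 / π : ℝ) : ℂ) * (Complex.log z * (-I)) := by
      push_cast; field_simp; simp
    have := h (28 * Complex.log z / (π * I)) (by
      rw [hl, Complex.im_ofReal_mul]
      apply mul_pos (div_pos (by norm_num) Real.pi_pos)
      simp [Complex.log_re]
      exact Real.log_neg (norm_pos_iff.2 h0) hz)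
    convert this using 2 with n
    rw [mul_comm]
    congr 1
    rw [show π * I * (n : ℂ) * (28 * Complex.log z / (π * I)) / 28 = n * Complex.log z by field_simp,
      Complex.exp_nat_mul, Complex.exp_log h0]
  have hev : ∀ᶠ z : ℂ in nhds 0, ‖z‖ < 1 := by
    have : Filter.Tendsto (fun z : ℂ => ‖z‖) (nhds 0) (nhds 0) := by
      simpa using (continuous_norm (E := ℂ)).tendsto 0
    exact this.eventually (gt_mem_nhds one_pos)
  let f : ℂ → ℂ := fun z => if z = 0 then a 0 else 0
  have hp : HasFPowerSeriesAt f (FormalMultilinearSeries.ofScalars ℂ a) 0 := by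
    rw [hasFPowerSeriesAt_iff]
    filter_upwards [hev] with z hz
    simp only [FormalMultilinearSeries.coeff_ofScalars, smul_eq_mul, zero_add, f]
    split_ifs with h0
    · subst h0
      convert hasSum_single 0 _ using 1
      · simp
      · intro n hn; simp [hn]
    · exact h1 z h0 hz
  have hz : ∀ᶠ z in nhds 0, f z = 0 := by
    refine hp.analyticAt.eventually_eq_zero_or_eventually_ne_zero.resolve_right fun hne => ?_
    have : ∀ᶠ z in nhdsWithin (0:ℂ) {0}ᶜ, False := by
      filter_upwards [hne, self_mem_nhdsWithin] with z h1 h2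
      exact h1 (if_neg h2)
    exact this.exists.elim fun _ h => h
  have := hp.eq_zero_of_eventually hz
  rw [FormalMultilinearSeries.ofScalars_series_eq_zero] at this
  rw [this]; rfl

lemma fib_sum {ι : Type*} (c : ι → ℂ) (p : ι → ℕ) (τ s : ℂ)
    (h : HasSum (fun i => c i * cexp (π * I * (p i : ℂ) * τ / 28)) s) :
    HasSum (fun n : ℕ => (∑' i : {i // p i = n}, c i) * cexp (π * I * (n : ℂ) * τ / 28)) s := by
  rw [← (Equiv.sigmaFiberEquiv p).hasSum_iff] at h
  refine h.sigma fun n => ?_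
  rw [← tsum_mul_right]
  have hs : Summable fun i : {i // p i = n} => c i * cexp (π * I * (p i : ℂ) * τ / 28) :=
    h.summable.sigma_factor n
  have e : ∀ i : {i // p i = n}, c i * cexp (π * I * (p i : ℂ) * τ / 28) =
    c i * cexp (π * I * (n : ℂ) * τ / 28) := fun i => by rw [i.2]
  rw [← tsum_congr e]
  exact hs.hasSum

lemma hs3 (f g h : ℤ → ℂ) (A B C : ℂ) (hf : HasSum f A) (hg : HasSum g B) (hh : HasSum h C) :
    HasSum (fun u : ℤ × ℤ × ℤ => f u.1 * (g u.2.1 * h u.2.2)) (A * (B * C)) := by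
  have s1 := summable_mul_of_summable_norm hg.summable.norm hh.summable.norm
  have h1 := hg.mul hh s1
  have s2 := summable_mul_of_summable_norm (g := fun x : ℤ × ℤ => g x.1 * h x.2) hf.summable.norm s1.norm
  exact HasSum.mul (g := fun x : ℤ × ℤ => g x.1 * h x.2) hf h1 s2

def md (x : ℤ) : Fin 7 := ⟨(x % 7).toNat, by omega⟩

lemma hsum_md (X : ℤ → ℂ) (hX : Summable X) (a : Fin 7) :
    HasSum (fun x => if md x = a then X x else 0) (∑' n : ℤ, X (7 * n + (a : ℕ))) := by
  have hi : Function.Injective (fun n : ℤ => 7 * n + ((a : ℕ) : ℤ)) := fun m n h => by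
    simp at h; exact h
  have hs : Summable fun n : ℤ => X (7 * n + (a : ℕ)) := hX.comp_injective hi
  rw [← hi.hasSum_iff]
  · convert hs.hasSum using 1
    funext n
    simp only [Function.comp]
    rw [if_pos]
    ext
    have := a.2
    simp only [md]; omega
  · intro x hx
    rw [if_neg]
    intro h
    apply hx
    refine ⟨x / 7, ?_⟩
    have h := congrArg Fin.val h
    simp only [md] at h
    simp only
    omega

lemma hsum_omega (G : Fin 7 → Fin 7 → Fin 7 → ℂ) (X : ℤ → ℂ) (hX : Summable X) :
    HasSum (fun u : ℤ × ℤ × ℤ => G (md u.1) (md u.2.1) (md u.2.2) * (X u.1 * (X u.2.1 * X u.2.2)))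
      (∑ a, ∑ b, ∑ c, G a b c * ((∑' n : ℤ, X (7 * n + (a : ℕ))) * ((∑' n : ℤ, X (7 * n + (b : ℕ))) *
        (∑' n : ℤ, X (7 * n + (c : ℕ)))))) := by
  have := hasSum_sum (s := Finset.univ) fun (a : Fin 7) _ => hasSum_sum (s := Finset.univ) fun (b : Fin 7) _ => hasSum_sum (s := Finset.univ) fun (c : Fin 7) _ =>
    (hs3 _ _ _ _ _ _ (hsum_md X hX a) (hsum_md X hX b) (hsum_md X hX c)).mul_left (G a b c)
  refine Eq.mp (congrArg (fun F => HasSum F _) (funext fun u => ?_)) this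
  simp
end

section
open Complex Real

def om (a b c : Fin 7) : ℤ :=
  if a.val = 0 ∧ b.val = 0 ∧ c.val = 0 then -6 else
    ![1, 2, 2, 0, 2, 0, 0] ⟨(a.val ^ 2 + b.val ^ 2 + c.val ^ 2) % 7, Nat.mod_lt _ (by norm_num)⟩

lemma om_sum (g : Fin 7 → ℂ) (h4 : g 4 = g 3) (h5 : g 5 = g 2) (h6 : g 6 = g 1) :
    ∑ a, ∑ b, ∑ c, (om a b c : ℂ) * (g a * (g b * g c)) =
    6 * (8 * g 1 * g 2 * g 3 - g 0 ^ 3) + 12 * ((g 1 * g 0 ^ 2 + 2 * g 2 ^ 2 * g 0 + 4 * g 3 ^ 2 * g 2) +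
     (g 2 * g 0 ^ 2 + 2 * g 3 ^ 2 * g 0 + 4 * g 1 ^ 2 * g 3) +
     (g 3 * g 0 ^ 2 + 2 * g 1 ^ 2 * g 0 + 4 * g 2 ^ 2 * g 1)) := by
  simp only [Fin.sum_univ_seven, h4, h5, h6]
  simp [om]
  ring

def p1 (u : ℤ × ℤ × ℤ) : ℕ := (4 * (u.1 ^ 2 + u.2.1 ^ 2 + u.2.2 ^ 2)).toNat
def p2 (u : ℤ × ℤ × ℤ) : ℕ := (28 * u.1 ^ 2 + 7 * (2 * u.2.1 + 1) ^ 2 + (2 * u.2.2 + 7) ^ 2).toNat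
def p3 (u : ℤ × ℤ × ℤ) : ℕ := (28 * u.1 ^ 2 + 28 * u.2.1 ^ 2 + 4 * u.2.2 ^ 2).toNat

lemma cast_toNat (m : ℤ) (h : 0 ≤ m) : ((m.toNat : ℕ) : ℂ) = ((m : ℤ) : ℂ) := by
  rw [← Int.cast_natCast, Int.toNat_of_nonneg h]

lemma e_mul3 (a b c : ℤ) (τ : ℂ) : cexp (π * I * (a : ℂ) * τ / 28) * (cexp (π * I * (b : ℂ) * τ / 28) *
    cexp (π * I * (c : ℂ) * τ / 28)) = cexp (π * I * ((a + b + c : ℤ) : ℂ) * τ / 28) := by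
  rw [← Complex.exp_add, ← Complex.exp_add]
  congr 1; push_cast; ring

noncomputable def HH (τ : ℂ) : ℂ := gH 0 τ + 2 * (gH 1 τ + gH 2 τ + gH 3 τ)
noncomputable def KK (τ : ℂ) : ℂ := gK 0 τ + 2 * (gK 1 τ + gK 2 τ + gK 3 τ)
noncomputable def AA (τ : ℂ) : ℂ :=
  6 * ee (vG τ) 0 + 12 * (ee (vG τ) 1 + ee (vG τ) 2 + ee (vG τ) 3)

lemma main_id {τ : ℂ} (h : 0 < τ.im) : AA τ - 6 * (t3 τ * (t2 τ * HH τ)) + 6 * (t3 τ * (t4 τ * KK τ)) = 0 := by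
  have h0 := D3_zero h 0
  have h1 := D3_zero h 1
  have h2 := D3_zero h 2
  have h3 := D3_zero h 3
  simp only [D3, Pi.add_apply, Pi.smul_apply, smul_eq_mul, vH, vK] at h0 h1 h2 h3
  unfold AA HH KK
  norm_num at h0 h1 h2 h3
  linear_combination 6 * h0 + 12 * (h1 + h2 + h3)

lemma S1 {τ : ℂ} (h : 0 < τ.im) :
    HasSum (fun u : ℤ × ℤ × ℤ => (om (md u.1) (md u.2.1) (md u.2.2) : ℂ) * cexp (π * I * (p1 u : ℂ) * τ / 28)) (AA τ) := by
  have hX : Summable fun n : ℤ => cexp (π * I * ((4 * n ^ 2 : ℤ) : ℂ) * τ / 28) := by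
    simpa using ser_summable (fun _ => 1) 4 (by norm_num) (by simp) τ h
  have := hsum_omega (fun a b c => (om a b c : ℂ)) _ hX
  simp only [← gG_ser] at this
  rw [om_sum (fun a => gG ((a : ℕ) : ℤ) τ) (by simpa using gG_per 3 τ) (by simpa using gG_per 2 τ)
    (by simpa using gG_per 1 τ)] at this
  have e : AA τ = _ := rfl
  simp only [AA, ee, vG] at e
  refine Eq.mp (congrArg₂ (fun F s => HasSum F s) (funext fun u => ?_) ?_) this
  · rw [e_mul3]
    congr 1
    rw [p1, cast_toNat _ (by positivity)]
    congr 1; push_cast; ring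
  · simp [AA, ee, vG]

lemma sumH {τ : ℂ} (h : 0 < τ.im) :
    HasSum (fun n : ℤ => cexp (π * I * (((2 * n + 7) ^ 2 : ℤ) : ℂ) * τ / 28)) (HH τ) := by
  have hX : Summable fun n : ℤ => cexp (π * I * (((2 * n + 7) ^ 2 : ℤ) : ℂ) * τ / 28) := by
    refine (Th_summable (1 / 7) (7 / 2) 0 (by norm_num) h).congr fun n => ?_
    congr 1; push_cast; ring
  convert hX.hasSum using 1
  rw [tsum_split _ hX]
  have e : ∀ k : Fin 7, ∑' n : ℤ, cexp (π * I * (((2 * (7 * n + ((k : ℕ) : ℤ)) + 7) ^ 2 : ℤ) : ℂ) * τ / 28) = gH (k : ℕ) τ := by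
    intro k; rw [gH_ser]
    refine tsum_congr fun n => ?_
    congr 1; push_cast; ring
  simp only [e]
  have := gH_per 1 τ
  have := gH_per 2 τ
  have := gH_per 3 τ
  norm_num at *
  rw [Fin.sum_univ_seven]
  norm_num
  unfold HH
  simp_all
  ring

lemma sumK {τ : ℂ} (h : 0 < τ.im) :
    HasSum (fun n : ℤ => sg n * cexp (π * I * ((4 * n ^ 2 : ℤ) : ℂ) * τ / 28)) (KK τ) := by
  have hX := ser_summable sg 4 (by norm_num) sg_norm τ h
  convert hX.hasSum using 1
  rw [tsum_split _ hX]
  simp only [← gK_ser]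
  have := gK_per 1 τ
  have := gK_per 2 τ
  have := gK_per 3 τ
  norm_num at *
  rw [Fin.sum_univ_seven]
  norm_num
  unfold KK
  simp_all
  ring

lemma sum3 {τ : ℂ} (h : 0 < τ.im) :
    HasSum (fun n : ℤ => cexp (π * I * ((28 * n ^ 2 : ℤ) : ℂ) * τ / 28)) (t3 τ) := by
  have hX : Summable fun n : ℤ => cexp (π * I * ((28 * n ^ 2 : ℤ) : ℂ) * τ / 28) := by
    simpa using ser_summable (fun _ => 1) 28 (by norm_num) (by simp) τ h
  rw [t3_ser]; exact hX.hasSum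

lemma sum4 {τ : ℂ} (h : 0 < τ.im) :
    HasSum (fun n : ℤ => sg n * cexp (π * I * ((28 * n ^ 2 : ℤ) : ℂ) * τ / 28)) (t4 τ) := by
  rw [t4_ser]; exact (ser_summable sg 28 (by norm_num) sg_norm τ h).hasSum

lemma sum2 {τ : ℂ} (h : 0 < τ.im) :
    HasSum (fun n : ℤ => cexp (π * I * ((7 * (2 * n + 1) ^ 2 : ℤ) : ℂ) * τ / 28)) (t2 τ) := by
  have hX : Summable fun n : ℤ => cexp (π * I * ((7 * (2 * n + 1) ^ 2 : ℤ) : ℂ) * τ / 28) := by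
    refine (Th_summable 1 (1 / 2) 0 (by norm_num) h).congr fun n => ?_
    congr 1; push_cast; ring
  rw [t2_ser]; exact hX.hasSum

lemma S2 {τ : ℂ} (h : 0 < τ.im) :
    HasSum (fun u : ℤ × ℤ × ℤ => (1 : ℂ) * cexp (π * I * (p2 u : ℂ) * τ / 28)) (t3 τ * (t2 τ * HH τ)) := by
  refine Eq.mp (congrArg (fun F => HasSum F _) (funext fun u => ?_)) (hs3 _ _ _ _ _ _ (sum3 h) (sum2 h) (sumH h))
  rw [e_mul3, one_mul, p2, cast_toNat _ (by positivity)]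

lemma S3 {τ : ℂ} (h : 0 < τ.im) :
    HasSum (fun u : ℤ × ℤ × ℤ => (sg u.2.1 * sg u.2.2) * cexp (π * I * (p3 u : ℂ) * τ / 28)) (t3 τ * (t4 τ * KK τ)) := by
  refine Eq.mp (congrArg (fun F => HasSum F _) (funext fun u => ?_)) (hs3 _ _ _ _ _ _ (sum3 h) (sum4 h) (sumK h))
  rw [p3, cast_toNat _ (by positivity), ← e_mul3]
  ring

lemma coeff_main (n : ℕ) :
    (∑' i : {i // p1 i = n}, (om (md i.1.1) (md i.1.2.1) (md i.1.2.2) : ℂ))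
     - 6 * (∑' i : {i // p2 i = n}, (1 : ℂ))
     + 6 * (∑' i : {i // p3 i = n}, sg i.1.2.1 * sg i.1.2.2) = 0 := by
  refine coeff_zero (fun n => (∑' i : {i // p1 i = n}, (om (md i.1.1) (md i.1.2.1) (md i.1.2.2) : ℂ))
     - 6 * (∑' i : {i // p2 i = n}, (1 : ℂ))
     + 6 * (∑' i : {i // p3 i = n}, sg i.1.2.1 * sg i.1.2.2)) ?_ n
  intro τ h
  have h1 := fib_sum _ _ _ _ (S1 h)
  have h2 := (fib_sum _ _ _ _ (S2 h)).mul_left 6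
  have h3 := (fib_sum _ _ _ _ (S3 h)).mul_left 6
  have := (h1.sub h2).add h3
  rw [main_id h] at this
  refine Eq.mp (congrArg (fun F => HasSum F _) (funext fun u => ?_)) this
  ring
end

section
lemma z8 {M : ℤ} (h8 : M % 8 = 1) : (M : ZMod 8) = 1 := by
  have : (M : ZMod 8) = ((1 : ℤ) : ZMod 8) := by
    rw [ZMod.intCast_eq_intCast_iff]; exact h8
  simpa using this

lemma z8d (a b : ℤ) (h : (a : ZMod 8) * (b : ZMod 8) = 0) : 8 ∣ a * b := by
  rw [← Int.cast_mul] at h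
  exact_mod_cast (ZMod.intCast_zmod_eq_zero_iff_dvd _ 8).1 h

def Rs (a b c M : ℤ) : Set (ℤ × ℤ × ℤ) := {p | M = a * p.1 ^ 2 + b * p.2.1 ^ 2 + c * p.2.2 ^ 2}

lemma rep_eq (a b c M : ℤ) : rep a b c 0 0 0 M = (Rs a b c M).ncard := by
  unfold rep Rs; congr 1; ext p; simp

lemma bd1 (a x M : ℤ) (ha : 0 < a) (h : a * x ^ 2 ≤ M) : -M ≤ x ∧ x ≤ M := by
  have h1 : x ^ 2 ≤ a * x ^ 2 := by nlinarith [sq_nonneg x]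
  constructor <;> nlinarith [sq_nonneg x, sq_nonneg (x - 1), sq_nonneg (x + 1), Int.le_self_sq x, Int.le_self_sq (-x)]

lemma Rs_fin (a b c M : ℤ) (ha : 0 < a) (hb : 0 < b) (hc : 0 < c) : (Rs a b c M).Finite := by
  refine (((Set.finite_Icc (-M) M)).prod ((Set.finite_Icc (-M) M).prod (Set.finite_Icc (-M) M))).subset ?_
  rintro ⟨x, y, z⟩ h
  simp only [Rs, Set.mem_ofPred_eq] at h
  have hx : 0 ≤ a * x ^ 2 := by positivity
  have hy : 0 ≤ b * y ^ 2 := by positivity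
  have hz : 0 ≤ c * z ^ 2 := by positivity
  exact ⟨bd1 a x M ha (by linarith), bd1 b y M hb (by linarith), bd1 c z M hc (by linarith)⟩

set_option maxRecDepth 100000 in
lemma dec1 : ∀ x y z : ZMod 8, x ^ 2 + y ^ 2 + z ^ 2 = 1 →
    (4 * x = 4 ∧ 4 * y = 0 ∧ 4 * z = 0 ∧ 2 * (y + z) = 0 ) ∨
    (4 * y = 4 ∧ 4 * x = 0 ∧ 4 * z = 0 ∧ 2 * (x + z) = 0 ) ∨
    (4 * z = 4 ∧ 4 * x = 0 ∧ 4 * y = 0 ∧ 2 * (x + y) = 0 ) := by decide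

set_option maxRecDepth 100000 in
lemma dec2 : ∀ x y z : ZMod 8, 7 * x ^ 2 + 7 * y ^ 2 + z ^ 2 = 1 →
    4 * (x + y) = 0 ∧ 4 * (y + z) = 4 := by decide

set_option maxRecDepth 100000 in
lemma dec3 : ∀ x y z : ZMod 8, 7 * x ^ 2 + 7 * (y ^ 2 + y) + z ^ 2 + 7 * z + 14 = 1 →
    2 * (y - z - 3) = 0 ∨ 2 * (y + z) = 0 := by decide

set_option maxRecDepth 100000 in
lemma dec4 : ∀ x y z : ZMod 8, 2 * x ^ 2 + 7 * y ^ 2 + 14 * z ^ 2 = 1 →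
    4 * x = 4 ∧ 4 * z = 0 := by decide

lemma z8i (a b : ℤ) (h : (a : ZMod 8) = (b : ZMod 8)) : a % 8 = b % 8 :=
  (ZMod.intCast_eq_intCast_iff a b 8).1 h

lemma cz {M : ℤ} (h8 : M % 8 = 1) (e : ℤ) (h : M = e) : ((e : ℤ) : ZMod 8) = 1 := by
  rw [← h]; exact z8 h8

lemma par1 (M : ℤ) (h8 : M % 8 = 1) (x y z : ℤ) (h : M = 1 * x ^ 2 + 1 * y ^ 2 + 1 * z ^ 2) :
    (x % 2 = 1 ∧ y % 2 = 0 ∧ z % 2 = 0 ∧ (y + z) % 4 = 0) ∨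
    (y % 2 = 1 ∧ x % 2 = 0 ∧ z % 2 = 0 ∧ (x + z) % 4 = 0) ∨
    (z % 2 = 1 ∧ x % 2 = 0 ∧ y % 2 = 0 ∧ (x + y) % 4 = 0) := by
  have h1 := cz h8 _ h
  push_cast at h1
  rw [one_mul, one_mul, one_mul] at h1
  rcases dec1 _ _ _ h1 with ⟨a, b, c, d⟩ | ⟨a, b, c, d⟩ | ⟨a, b, c, d⟩
  · have a := z8i (4 * x) 4 (by push_cast; exact a)
    have b := z8i (4 * y) 0 (by push_cast; exact b)
    have c := z8i (4 * z) 0 (by push_cast; exact c)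
    have d := z8i (2 * (y + z)) 0 (by push_cast; exact d)
    omega
  · have a := z8i (4 * y) 4 (by push_cast; exact a)
    have b := z8i (4 * x) 0 (by push_cast; exact b)
    have c := z8i (4 * z) 0 (by push_cast; exact c)
    have d := z8i (2 * (x + z)) 0 (by push_cast; exact d)
    omega
  · have a := z8i (4 * z) 4 (by push_cast; exact a)
    have b := z8i (4 * x) 0 (by push_cast; exact b)
    have c := z8i (4 * y) 0 (by push_cast; exact c)
    have d := z8i (2 * (x + y)) 0 (by push_cast; exact d)
    omega

def f1 (p : ℤ × ℤ × ℤ) : ℤ × ℤ × ℤ := (p.1, 2 * (p.2.1 + p.2.2), 2 * (p.2.1 - p.2.2))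
def f2 (p : ℤ × ℤ × ℤ) : ℤ × ℤ × ℤ := (2 * (p.2.1 + p.2.2), p.1, 2 * (p.2.1 - p.2.2))
def f3 (p : ℤ × ℤ × ℤ) : ℤ × ℤ × ℤ := (2 * (p.2.1 + p.2.2), 2 * (p.2.1 - p.2.2), p.1)

lemma f1_inj : Function.Injective f1 := by
  rintro ⟨x, y, z⟩ ⟨x', y', z'⟩ h
  simp only [f1, Prod.mk.injEq] at h ⊢; omega
lemma f2_inj : Function.Injective f2 := by
  rintro ⟨x, y, z⟩ ⟨x', y', z'⟩ h
  simp only [f2, Prod.mk.injEq] at h ⊢; omega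
lemma f3_inj : Function.Injective f3 := by
  rintro ⟨x, y, z⟩ ⟨x', y', z'⟩ h
  simp only [f3, Prod.mk.injEq] at h ⊢; omega

lemma r3_eq (M : ℤ) (h8 : M % 8 = 1) : (Rs 1 1 1 M).ncard = 3 * (Rs 1 8 8 M).ncard := by
  have hR := Rs_fin 1 8 8 M (by norm_num) (by norm_num) (by norm_num)
  have hodd : ∀ p ∈ Rs 1 8 8 M, p.1 % 2 = 1 := by
    rintro ⟨x, y, z⟩ h
    simp only [Rs, Set.mem_ofPred_eq] at h ⊢
    by_contra hx
    obtain ⟨k, rfl⟩ : ∃ k, x = 2 * k := ⟨x / 2, by omega⟩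
    have : M = 2 * (2 * k ^ 2 + 4 * y ^ 2 + 4 * z ^ 2) := by rw [h]; ring
    omega
  have hU : Rs 1 1 1 M = f1 '' Rs 1 8 8 M ∪ (f2 '' Rs 1 8 8 M ∪ f3 '' Rs 1 8 8 M) := by
    ext ⟨x, y, z⟩
    constructor
    · intro h
      simp only [Rs, Set.mem_ofPred_eq] at h
      rcases par1 M h8 x y z h with ⟨a, b, c, d⟩ | ⟨a, b, c, d⟩ | ⟨a, b, c, d⟩
      · left
        obtain ⟨s, hs⟩ : ∃ s, y + z = 4 * s := ⟨(y + z) / 4, by omega⟩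
        obtain ⟨t, ht⟩ : ∃ t, y - z = 4 * t := ⟨(y - z) / 4, by omega⟩
        obtain rfl : y = 2 * (s + t) := by omega
        obtain rfl : z = 2 * (s - t) := by omega
        exact ⟨(x, s, t), by simp only [Rs, Set.mem_ofPred_eq]; rw [h]; ring, rfl⟩
      · right; left
        obtain ⟨s, hs⟩ : ∃ s, x + z = 4 * s := ⟨(x + z) / 4, by omega⟩
        obtain ⟨t, ht⟩ : ∃ t, x - z = 4 * t := ⟨(x - z) / 4, by omega⟩
        obtain rfl : x = 2 * (s + t) := by omega
        obtain rfl : z = 2 * (s - t) := by omega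
        exact ⟨(y, s, t), by simp only [Rs, Set.mem_ofPred_eq]; rw [h]; ring, rfl⟩
      · right; right
        obtain ⟨s, hs⟩ : ∃ s, x + y = 4 * s := ⟨(x + y) / 4, by omega⟩
        obtain ⟨t, ht⟩ : ∃ t, x - y = 4 * t := ⟨(x - y) / 4, by omega⟩
        obtain rfl : x = 2 * (s + t) := by omega
        obtain rfl : y = 2 * (s - t) := by omega
        exact ⟨(z, s, t), by simp only [Rs, Set.mem_ofPred_eq]; rw [h]; ring, rfl⟩
    · rintro (⟨⟨a, b, c⟩, h, e⟩ | ⟨⟨a, b, c⟩, h, e⟩ | ⟨⟨a, b, c⟩, h, e⟩) <;>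
      · rw [← e]
        simp only [Rs, Set.mem_ofPred_eq, f1, f2, f3] at h ⊢
        rw [h]; ring
  have d23 : Disjoint (f2 '' Rs 1 8 8 M) (f3 '' Rs 1 8 8 M) := by
    rw [Set.disjoint_left]
    rintro _ ⟨p, hp, rfl⟩ ⟨q, hq, e⟩
    have := hodd p hp
    have := hodd q hq
    simp only [f2, f3, Prod.mk.injEq] at e
    omega
  have d1 : Disjoint (f1 '' Rs 1 8 8 M) (f2 '' Rs 1 8 8 M ∪ f3 '' Rs 1 8 8 M) := by
    rw [Set.disjoint_left]
    rintro _ ⟨p, hp, rfl⟩ (⟨q, hq, e⟩ | ⟨q, hq, e⟩) <;>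
    · have := hodd p hp
      have := hodd q hq
      simp only [f1, f2, f3, Prod.mk.injEq] at e
      omega
  rw [hU, Set.ncard_union_eq d1 (hR.image _) ((hR.image _).union (hR.image _)),
    Set.ncard_union_eq d23 (hR.image _) (hR.image _), Set.ncard_image_of_injective _ f1_inj,
    Set.ncard_image_of_injective _ f2_inj, Set.ncard_image_of_injective _ f3_inj]
  ring

def f4 (p : ℤ × ℤ × ℤ) : ℤ × ℤ × ℤ := (p.2.1 + p.2.2, p.2.1 - p.2.2, p.1)
lemma f4_inj : Function.Injective f4 := by
  rintro ⟨x, y, z⟩ ⟨x', y', z'⟩ h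
  simp only [f4, Prod.mk.injEq] at h ⊢; omega

lemma par2 (M : ℤ) (h8 : M % 8 = 1) (x y z : ℤ) (h : M = 7 * x ^ 2 + 7 * y ^ 2 + 1 * z ^ 2) :
    (x + y) % 2 = 0 ∧ (y + z) % 2 = 1 := by
  have h1 := cz h8 _ h
  push_cast at h1
  rw [one_mul] at h1
  obtain ⟨a, b⟩ := dec2 _ _ _ h1
  have a := z8i (4 * (x + y)) 0 (by push_cast; exact a)
  have b := z8i (4 * (y + z)) 4 (by push_cast; exact b)
  omega

lemma r771_eq (M : ℤ) (h8 : M % 8 = 1) : (Rs 7 7 1 M).ncard = (Rs 1 14 14 M).ncard := by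
  rw [← Set.ncard_image_of_injective (Rs 1 14 14 M) f4_inj]
  congr 1
  ext ⟨x, y, z⟩
  constructor
  · intro h
    simp only [Rs, Set.mem_ofPred_eq] at h
    obtain ⟨a, b⟩ := par2 M h8 x y z h
    obtain ⟨s, hs⟩ : ∃ s, x + y = 2 * s := ⟨(x + y) / 2, by omega⟩
    obtain ⟨t, ht⟩ : ∃ t, x - y = 2 * t := ⟨(x - y) / 2, by omega⟩
    obtain rfl : x = (s + t) := by omega
    obtain rfl : y = (s - t) := by omega
    exact ⟨(z, s, t), by simp only [Rs, Set.mem_ofPred_eq]; rw [h]; ring, rfl⟩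
  · rintro ⟨⟨a, b, c⟩, h, e⟩
    rw [← e]
    simp only [Rs, Set.mem_ofPred_eq, f4] at h ⊢
    rw [h]; ring

def f5 (p : ℤ × ℤ × ℤ) : ℤ × ℤ × ℤ := (p.2.1, (p.2.2 + p.1 - 1) / 2, (p.1 - 7 * p.2.2 - 7) / 2)
def f6 (p : ℤ × ℤ × ℤ) : ℤ × ℤ × ℤ := (p.2.1, (p.2.2 - p.1 - 1) / 2, (p.1 + 7 * p.2.2 - 7) / 2)

def A2 (M : ℤ) : Set (ℤ × ℤ × ℤ) :=
  {u | 4 * M = 28 * u.1 ^ 2 + 7 * (2 * u.2.1 + 1) ^ 2 + (2 * u.2.2 + 7) ^ 2}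

lemma par4 (M : ℤ) (h8 : M % 8 = 1) (x y z : ℤ) (h : M = 2 * x ^ 2 + 7 * y ^ 2 + 14 * z ^ 2) :
    x % 2 = 1 ∧ z % 2 = 0 := by
  have h1 := cz h8 _ h
  push_cast at h1
  obtain ⟨a, b⟩ := dec4 _ _ _ h1
  have a := z8i (4 * x) 4 (by push_cast; exact a)
  have b := z8i (4 * z) 0 (by push_cast; exact b)
  omega

lemma par3 (M : ℤ) (h8 : M % 8 = 1) (x y z : ℤ)
    (h : 4 * M = 28 * x ^ 2 + 7 * (2 * y + 1) ^ 2 + (2 * z + 7) ^ 2) :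
    (y - z - 3) % 4 = 0 ∨ (y + z) % 4 = 0 := by
  have h1 := cz h8 (7 * x ^ 2 + 7 * (y ^ 2 + y) + z ^ 2 + 7 * z + 14) (by linarith)
  push_cast at h1
  rcases dec3 _ _ _ h1 with a | a
  · have a := z8i (2 * (y - z - 3)) 0 (by push_cast; exact a)
    omega
  · have a := z8i (2 * (y + z)) 0 (by push_cast; exact a)
    omega

lemma A2_eq (M : ℤ) (h8 : M % 8 = 1) : (A2 M).ncard = 2 * (Rs 2 7 14 M).ncard := by
  have hR := Rs_fin 2 7 14 M (by norm_num) (by norm_num) (by norm_num)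
  have hp : ∀ p ∈ Rs 2 7 14 M, p.1 % 2 = 1 ∧ p.2.2 % 2 = 0 := fun p h => par4 M h8 _ _ _ h
  have i5 : Set.InjOn f5 (Rs 2 7 14 M) := by
    rintro p h q h' e
    have := hp p h
    have := hp q h'
    simp only [f5, Prod.mk.injEq] at e
    ext <;> omega
  have i6 : Set.InjOn f6 (Rs 2 7 14 M) := by
    rintro p h q h' e
    have := hp p h
    have := hp q h'
    simp only [f6, Prod.mk.injEq] at e
    ext <;> omega
  have hd : Disjoint (f5 '' Rs 2 7 14 M) (f6 '' Rs 2 7 14 M) := by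
    rw [Set.disjoint_left]
    rintro _ ⟨p, h, rfl⟩ ⟨q, h', e⟩
    have := hp p h
    have := hp q h'
    simp only [f5, f6, Prod.mk.injEq] at e
    omega
  have hU : A2 M = f5 '' Rs 2 7 14 M ∪ f6 '' Rs 2 7 14 M := by
    ext ⟨x, y, z⟩
    constructor
    · intro h
      simp only [A2, Set.mem_ofPred_eq] at h
      rcases par3 M h8 x y z h with a | a
      · left
        obtain ⟨b, hb⟩ : ∃ b, y - z - 3 = 4 * b := ⟨(y - z - 3) / 4, by omega⟩
        obtain rfl : z = y - 3 - 4 * b := by omega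
        refine ⟨(2 * y + 1 - b, x, b), ?_, ?_⟩
        · simp only [Rs, Set.mem_ofPred_eq]; linarith
        · refine Prod.ext rfl (Prod.ext ?_ ?_) <;> simp only [f5] <;> omega
      · right
        obtain ⟨b, hb⟩ : ∃ b, y + z = 4 * b - 4 := ⟨(y + z) / 4 + 1, by omega⟩
        obtain rfl : z = 4 * b - 4 - y := by omega
        refine ⟨(b - (2 * y + 1), x, b), ?_, ?_⟩
        · simp only [Rs, Set.mem_ofPred_eq]; linarith
        · refine Prod.ext rfl (Prod.ext ?_ ?_) <;> simp only [f6] <;> omega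
    · rintro (⟨⟨a, x', b⟩, h, e⟩ | ⟨⟨a, x', b⟩, h, e⟩)
      · obtain ⟨h1, h2⟩ := hp _ h
        simp only [f5, Prod.mk.injEq, Rs, Set.mem_ofPred_eq] at e h h1 h2
        obtain ⟨e1, e2, e3⟩ := e
        simp only [A2, Set.mem_ofPred_eq]
        have e2 : 2 * y + 1 = b + a := by omega
        have e3 : 2 * z + 7 = a - 7 * b := by omega
        rw [e2, e3, h, ← e1]; ring
      · obtain ⟨h1, h2⟩ := hp _ h
        simp only [f6, Prod.mk.injEq, Rs, Set.mem_ofPred_eq] at e h h1 h2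
        obtain ⟨e1, e2, e3⟩ := e
        simp only [A2, Set.mem_ofPred_eq]
        have e2 : 2 * y + 1 = b - a := by omega
        have e3 : 2 * z + 7 = a + 7 * b := by omega
        rw [e2, e3, h, ← e1]; ring
  rw [hU, Set.ncard_union_eq hd (hR.image _) (hR.image _), i5.ncard_image,
    i6.ncard_image]
  ring

lemma om_val (M : ℤ) (x y z : ℤ) (h : M = 1 * x ^ 2 + 1 * y ^ 2 + 1 * z ^ 2)
    (hn : ¬ (7 ^ 2 : ℤ) ∣ M) :
    om (md x) (md y) (md z) = ![1, 2, 2, 0, 2, 0, 0] (md M) := by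
  unfold om
  rw [if_neg]
  · congr 1
    ext
    simp only [md]
    zify
    rw [Int.toNat_of_nonneg (by omega), Int.toNat_of_nonneg (by omega), Int.toNat_of_nonneg (by omega),
      Int.toNat_of_nonneg (by omega), h]
    simp [Int.add_emod, pow_two, Int.mul_emod]
  · rintro ⟨a, b, c⟩
    simp only [md] at a b c
    apply hn
    obtain ⟨r, rfl⟩ : ∃ r, x = 7 * r := ⟨x / 7, by omega⟩
    obtain ⟨s, rfl⟩ : ∃ r, y = 7 * r := ⟨y / 7, by omega⟩
    obtain ⟨t, rfl⟩ : ∃ r, z = 7 * r := ⟨z / 7, by omega⟩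
    exact ⟨r ^ 2 + s ^ 2 + t ^ 2, by rw [h]; ring⟩

lemma tc (p : ℤ × ℤ × ℤ → ℕ) (n : ℕ) (S : Set (ℤ × ℤ × ℤ)) (hS : ∀ u, p u = n ↔ u ∈ S) (c : ℤ × ℤ × ℤ → ℂ)
    (k : ℂ) (hc : ∀ u ∈ S, c u = k) : ∑' i : {i // p i = n}, c i = S.ncard * k := by
  have e : ∀ i : {i // p i = n}, c i = k := fun i => hc _ ((hS _).1 i.2)
  rw [tsum_congr e, tsum_const, nsmul_eq_mul]
  congr 2
  rw [← Nat.card_coe_set_eq]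
  exact Nat.card_congr (Equiv.subtypeEquivRight hS)

lemma count (M : ℤ) (hM : 0 < M) (h8 : M % 8 = 1) (hn : ¬ (7 ^ 2 : ℤ) ∣ M) :
    (3 * (Rs 1 8 8 M).ncard : ℤ) * ![1, 2, 2, 0, 2, 0, 0] (md M) =
      6 * (2 * (Rs 2 7 14 M).ncard) + 6 * (Rs 1 14 14 M).ncard := by
  have h := coeff_main (4 * M).toNat
  have q1 := tc p1 (4 * M).toNat (Rs 1 1 1 M) (by
    rintro ⟨x, y, z⟩
    have h1 : 0 ≤ 4 * (x ^ 2 + y ^ 2 + z ^ 2) := by positivity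
    simp only [p1, Rs, Set.mem_ofPred_eq]
    omega) (fun u => (om (md u.1) (md u.2.1) (md u.2.2) : ℂ))
    ((![1, 2, 2, 0, 2, 0, 0] (md M) : ℤ) : ℂ) (by
    rintro ⟨x, y, z⟩ hu
    simp only
    rw [om_val M x y z hu hn])
  have q2 := tc p2 (4 * M).toNat (A2 M) (by
    rintro ⟨x, y, z⟩
    have h1 : 0 ≤ 28 * x ^ 2 + 7 * (2 * y + 1) ^ 2 + (2 * z + 7) ^ 2 := by positivity
    simp only [p2, A2, Set.mem_ofPred_eq]
    constructor <;> intro h <;> omega) (fun _ => 1) 1 (by simp)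
  have q3 := tc p3 (4 * M).toNat (Rs 7 7 1 M) (by
    rintro ⟨x, y, z⟩
    have h1 : 0 ≤ 28 * x ^ 2 + 28 * y ^ 2 + 4 * z ^ 2 := by positivity
    simp only [p3, Rs, Set.mem_ofPred_eq]
    omega) (fun u => sg u.2.1 * sg u.2.2) (-1) (by
    rintro ⟨x, y, z⟩ hu
    have := (par2 M h8 x y z hu).2
    simp only [sg, Int.even_iff]
    rcases Int.emod_two_eq_zero_or_one y with a | a <;> rcases Int.emod_two_eq_zero_or_one z with b | b
    · omega
    · simp [a, b]
    · simp [a, b]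
    · omega)
  rw [q1, q2, q3, r3_eq M h8, A2_eq M h8, r771_eq M h8] at h
  have : (((3 * (Rs 1 8 8 M).ncard : ℤ) * ![1, 2, 2, 0, 2, 0, 0] (md M) : ℤ) : ℂ) =
      ((6 * (2 * (Rs 2 7 14 M).ncard) + 6 * (Rs 1 14 14 M).ncard : ℤ) : ℂ) := by
    push_cast at h ⊢
    linear_combination h
  exact_mod_cast this
end

theorem cor_1_3 (M : ℤ) (hM : 0 < M) (h8 : M % 8 = 1) :
    (jacobiSym M 7 = 1 →
      rep 1 8 8 0 0 0 M = rep 1 14 14 0 0 0 M + 2 * rep 2 7 14 0 0 0 M) ∧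
    (7 ∣ M → ¬ (7 ^ 2 : ℤ) ∣ M →
      rep 1 8 8 0 0 0 M = 2 * rep 1 14 14 0 0 0 M + 4 * rep 2 7 14 0 0 0 M) := by
  simp only [rep_eq]
  constructor
  · intro hj
    have h7 : M % 7 = 1 ∨ M % 7 = 2 ∨ M % 7 = 4 := by
      rw [jacobiSym.mod_left] at hj
      have h0 : 0 ≤ M % 7 := by omega
      have h1 : M % 7 < 7 := by omega
      push_cast at hj
      generalize M % 7 = r at *
      interval_cases r <;> revert hj <;> norm_num
    have := count M hM h8 (by omega)
    have e : (![1, 2, 2, 0, 2, 0, 0] : Fin 7 → ℤ) (md M) = 2 := by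
      rcases h7 with h | h | h <;> simp [md, h]
    rw [e] at this
    omega
  · intro h7 hn
    have := count M hM h8 hn
    have e : (![1, 2, 2, 0, 2, 0, 0] : Fin 7 → ℤ) (md M) = 1 := by
      have h : M % 7 = 0 := by omega
      simp [md, h]
    rw [e] at this
    omega
end

section
/- (Corollary 1.4.) If M is a positive integer with M ≡ 1 (mod 8) and the Jacobi symbol (M|7) = −1, then (1,8,8,0,0,0)(M) = 4·(3,5,14,0,0,2)(M). If M ≡ 1 (mod 8), 7 | M and 7² ∤ M, then (1,8,8,0,0,0)(M) = 8·(3,5,14,0,0,2)(M). -/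
def S188 (M : ℤ) : Set (ℤ × ℤ × ℤ) :=
  {p | p.1 ^ 2 + 8 * p.2.1 ^ 2 + 8 * p.2.2 ^ 2 = M}

lemma S188_finite (M : ℤ) : (S188 M).Finite := by
  apply Set.Finite.subset (Set.finite_Icc ((-M, -M, -M) : ℤ × ℤ × ℤ) (M, M, M))
  rintro ⟨x, y, z⟩ h
  simp only [S188, Set.mem_ofPred_eq] at h
  simp only [Set.mem_Icc, Prod.mk_le_mk]
  have key : ∀ t : ℤ, t ^ 2 ≤ M → -M ≤ t ∧ t ≤ M := by
    intro t ht
    constructor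
    · by_cases h0 : t ≤ -1
      · nlinarith
      · nlinarith [sq_nonneg t]
    · by_cases h0 : 1 ≤ t
      · nlinarith
      · nlinarith [sq_nonneg t]
  have hx := key x (by nlinarith [sq_nonneg x, sq_nonneg y, sq_nonneg z])
  have hy := key y (by nlinarith [sq_nonneg x, sq_nonneg y, sq_nonneg z])
  have hz := key z (by nlinarith [sq_nonneg x, sq_nonneg y, sq_nonneg z])
  tauto

noncomputable def F188 (M : ℤ) : Finset (ℤ × ℤ × ℤ) := (S188_finite M).toFinset

lemma mem_F188 (M x y z : ℤ) : (x, y, z) ∈ F188 M ↔ x ^ 2 + 8 * y ^ 2 + 8 * z ^ 2 = M := by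
  simp [F188, S188]

def Inc (e : ℤ × ℤ) (p : ℤ × ℤ × ℤ) : Prop := (7 : ℤ) ∣ p.1 - e.1 * p.2.1 - e.2 * p.2.2

instance (e : ℤ × ℤ) (p : ℤ × ℤ × ℤ) : Decidable (Inc e p) := by
  unfold Inc; infer_instance

noncomputable def N188 (M : ℤ) (e : ℤ × ℤ) : ℕ := ((F188 M).filter (fun p => Inc e p)).card

lemma mem_filt (M a b x y z : ℤ) : (x, y, z) ∈ (F188 M).filter (fun p => Inc (a, b) p) ↔
    x ^ 2 + 8 * y ^ 2 + 8 * z ^ 2 = M ∧ (7 : ℤ) ∣ x - a * y - b * z := by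
  rw [Finset.mem_filter, mem_F188]
  rfl

lemma N188_neg (M a b : ℤ) : N188 M (-a, b) = N188 M (a, b) := by
  unfold N188
  refine Finset.card_nbij' (fun p => (p.1, -p.2.1, p.2.2)) (fun p => (p.1, -p.2.1, p.2.2))
    ?_ ?_ ?_ ?_
  · rintro ⟨x, y, z⟩ h
    have h' := (mem_filt _ _ _ _ _ _).1 h
    refine (mem_filt _ _ _ _ _ _).2 ⟨by rw [← h'.1]; ring, ?_⟩
    convert h'.2 using 1; ring
  · rintro ⟨x, y, z⟩ h
    have h' := (mem_filt _ _ _ _ _ _).1 h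
    refine (mem_filt _ _ _ _ _ _).2 ⟨by rw [← h'.1]; ring, ?_⟩
    convert h'.2 using 1; ring
  · rintro ⟨x, y, z⟩ h
    simp
  · rintro ⟨x, y, z⟩ h
    simp

lemma N188_swap (M a b : ℤ) : N188 M (a, b) = N188 M (b, a) := by
  unfold N188
  refine Finset.card_nbij' (fun p => (p.1, p.2.2, p.2.1)) (fun p => (p.1, p.2.2, p.2.1))
    ?_ ?_ ?_ ?_
  · rintro ⟨x, y, z⟩ h
    have h' := (mem_filt _ _ _ _ _ _).1 h
    refine (mem_filt _ _ _ _ _ _).2 ⟨by rw [← h'.1]; ring, ?_⟩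
    convert h'.2 using 1; ring
  · rintro ⟨x, y, z⟩ h
    have h' := (mem_filt _ _ _ _ _ _).1 h
    refine (mem_filt _ _ _ _ _ _).2 ⟨by rw [← h'.1]; ring, ?_⟩
    convert h'.2 using 1; ring
  · rintro ⟨x, y, z⟩ h
    rfl
  · rintro ⟨x, y, z⟩ h
    rfl

def E8 : Finset (ℤ × ℤ) :=
  {(2, 3), (-2, 3), (2, -3), (-2, -3), (3, 2), (-3, 2), (3, -2), (-3, -2)}

lemma N188_E8 (M : ℤ) : ∀ e ∈ E8, N188 M e = N188 M (2, 3) := by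
  have h2 : N188 M (3, 2) = N188 M (2, 3) := N188_swap M 3 2
  have h3 : N188 M (-2, 3) = N188 M (2, 3) := N188_neg M 2 3
  have h4 : N188 M (-3, 2) = N188 M (2, 3) := (N188_neg M 3 2).trans h2
  have h5 : N188 M (2, -3) = N188 M (2, 3) := (N188_swap M 2 (-3)).trans h4
  have h6 : N188 M (3, -2) = N188 M (2, 3) := (N188_swap M 3 (-2)).trans h3
  have h7 : N188 M (-2, -3) = N188 M (2, 3) := (N188_neg M 2 (-3)).trans h5
  have h8 : N188 M (-3, -2) = N188 M (2, 3) := (N188_neg M 3 (-2)).trans h6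
  intro e he
  simp only [E8, Finset.mem_insert, Finset.mem_singleton] at he
  rcases he with rfl | rfl | rfl | rfl | rfl | rfl | rfl | rfl <;> first | rfl | assumption

lemma count_double (M : ℤ) (k : ℕ)
    (h : ∀ p ∈ F188 M, (E8.filter (fun e => Inc e p)).card = k) :
    8 * N188 M (2, 3) = k * (F188 M).card := by
  have h1 : ∑ e ∈ E8, N188 M e = 8 * N188 M (2, 3) := by
    rw [Finset.sum_congr rfl (N188_E8 M), Finset.sum_const]
    rfl
  have h2 : ∑ e ∈ E8, N188 M e = ∑ p ∈ F188 M, (E8.filter (fun e => Inc e p)).card := by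
    simp only [N188, Finset.card_filter]
    exact Finset.sum_comm
  rw [← h1, h2, Finset.sum_congr rfl h, Finset.sum_const, smul_eq_mul, mul_comm]

def c7 (x y z : ZMod 7) : ℕ :=
  (E8.filter (fun e => x - (e.1 : ZMod 7) * y - (e.2 : ZMod 7) * z = 0)).card

lemma card_eq_c7 (x y z : ℤ) :
    (E8.filter (fun e => Inc e (x, y, z))).card = c7 x y z := by
  unfold c7
  congr 1
  apply Finset.filter_congr
  intro e _
  unfold Inc
  have := ZMod.intCast_zmod_eq_zero_iff_dvd (x - e.1 * y - e.2 * z) 7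
  push_cast at this
  exact this.symm

lemma c7_two : ∀ x y z : ZMod 7, (x ^ 2 + 8 * y ^ 2 + 8 * z ^ 2 = 3 ∨
    x ^ 2 + 8 * y ^ 2 + 8 * z ^ 2 = 5 ∨ x ^ 2 + 8 * y ^ 2 + 8 * z ^ 2 = 6) → c7 x y z = 2 := by
  decide +kernel

lemma c7_one : ∀ x y z : ZMod 7, x ^ 2 + 8 * y ^ 2 + 8 * z ^ 2 = 0 →
    c7 x y z = 1 ∨ (x = 0 ∧ y = 0 ∧ z = 0) := by
  decide +kernel

lemma rep188 (M : ℤ) : rep 1 8 8 0 0 0 M = (F188 M).card := by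
  unfold rep F188
  rw [← Set.ncard_eq_toFinset_card _ (S188_finite M)]
  congr 1
  ext ⟨x, y, z⟩
  simp only [S188, Set.mem_ofPred_eq]
  constructor <;> intro h <;> linarith

lemma par (a b c M : ℤ) (h8 : M % 8 = 1)
    (h : M = 3 * a ^ 2 + 5 * b ^ 2 + 14 * c ^ 2 + 0 * b * c + 0 * c * a + 2 * a * b) :
    b % 2 = 0 ∧ (a - c) % 2 = 0 := by
  have key : ∀ a b c : ZMod 8, 3 * a ^ 2 + 5 * b ^ 2 + 14 * c ^ 2 + 2 * a * b = 1 →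
      4 * b = 0 ∧ 4 * (a - c) = 0 := by decide +kernel
  have hM : ((M : ℤ) : ZMod 8) = ((1 : ℤ) : ZMod 8) := by
    rw [ZMod.intCast_eq_intCast_iff]; exact h8
  have := key a b c (by
    rw [h] at hM; push_cast at hM; rw [← hM]; ring)
  have h1 := (ZMod.intCast_zmod_eq_zero_iff_dvd (4 * b) 8).1 (by push_cast; exact this.1)
  have h2 := (ZMod.intCast_zmod_eq_zero_iff_dvd (4 * (a - c)) 8).1 (by push_cast; exact this.2)
  push_cast at h1 h2
  omega

lemma rep3514 (M : ℤ) (h8 : M % 8 = 1) : rep 3 5 14 0 0 2 M = N188 M (2, 3) := by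
  unfold rep N188
  rw [← Set.ncard_coe_finset]
  refine Set.ncard_congr (fun p _ => (3 * p.2.2 + (p.1 - p.2.2) - p.2.1,
    (p.1 - p.2.2) / 2 + p.2.1 / 2, p.2.2 + p.2.1 / 2)) ?_ ?_ ?_
  · rintro ⟨a, b, c⟩ h
    simp only [Set.mem_ofPred_eq] at h
    obtain ⟨hb, ha⟩ := par a b c M h8 h
    obtain ⟨B, rfl⟩ : ∃ B, b = 2 * B := ⟨b / 2, by omega⟩
    obtain ⟨A, rfl⟩ : ∃ A, a = c + 2 * A := ⟨(a - c) / 2, by omega⟩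
    have e1 : (c + 2 * A - c) / 2 = A := by omega
    have e2 : 2 * B / 2 = B := by omega
    simp only [e1, e2]
    refine (mem_filt _ _ _ _ _ _).2 ⟨by rw [h]; ring, ⟨-B, by ring⟩⟩
  · rintro ⟨a, b, c⟩ ⟨a', b', c'⟩ h h' heq
    simp only [Set.mem_ofPred_eq] at h h'
    obtain ⟨hb, ha⟩ := par a b c M h8 h
    obtain ⟨hb', ha'⟩ := par a' b' c' M h8 h'
    simp only [Prod.mk.injEq] at heq ⊢
    omega
  · rintro ⟨x, y, z⟩ h
    obtain ⟨h, B, hB⟩ := (mem_filt _ _ _ _ _ _).1 h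
    obtain rfl : x = 2 * y + 3 * z + 7 * B := by linarith
    refine ⟨(z + B + 2 * (y + B), -2 * B, z + B), ?_, ?_⟩
    · simp only [Set.mem_ofPred_eq]
      rw [← h]; ring
    · simp only [Prod.mk.injEq]
      omega

theorem cor_1_4 (M : ℤ) (hM : 0 < M) (h8 : M % 8 = 1) :
    (jacobiSym M 7 = -1 →
      rep 1 8 8 0 0 0 M = 4 * rep 3 5 14 0 0 2 M) ∧
    (7 ∣ M → ¬ (7 ^ 2 : ℤ) ∣ M →
      rep 1 8 8 0 0 0 M = 8 * rep 3 5 14 0 0 2 M) := by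
  rw [rep188, rep3514 M h8]
  constructor
  · intro hj
    have h7 : M % 7 = 3 ∨ M % 7 = 5 ∨ M % 7 = 6 := by
      rw [jacobiSym.mod_left] at hj
      have h0 := Int.emod_nonneg M (show (7 : ℤ) ≠ 0 by norm_num)
      have h1 := Int.emod_lt_of_pos M (show (0 : ℤ) < 7 by norm_num)
      push_cast at hj
      generalize M % 7 = r at *
      interval_cases r <;> first | omega | (exfalso; revert hj; norm_num)
    have := count_double M 2 (by
      rintro ⟨x, y, z⟩ hp
      rw [mem_F188] at hp
      rw [card_eq_c7]
      apply c7_two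
      have hc : ((x : ZMod 7)) ^ 2 + 8 * (y : ZMod 7) ^ 2 + 8 * (z : ZMod 7) ^ 2
          = ((M : ℤ) : ZMod 7) := by rw [← hp]; push_cast; ring
      rw [hc]
      rcases h7 with h | h | h
      · left; exact (ZMod.intCast_eq_intCast_iff M 3 7).2 h
      · right; left; exact (ZMod.intCast_eq_intCast_iff M 5 7).2 h
      · right; right; exact (ZMod.intCast_eq_intCast_iff M 6 7).2 h)
    omega
  · intro h7 h49
    have := count_double M 1 (by
      rintro ⟨x, y, z⟩ hp
      rw [mem_F188] at hp
      rw [card_eq_c7]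
      have hc : ((x : ZMod 7)) ^ 2 + 8 * (y : ZMod 7) ^ 2 + 8 * (z : ZMod 7) ^ 2
          = ((M : ℤ) : ZMod 7) := by rw [← hp]; push_cast; ring
      rw [(ZMod.intCast_zmod_eq_zero_iff_dvd M 7).2 h7] at hc
      rcases c7_one _ _ _ hc with h | ⟨hx, hy, hz⟩
      · exact h
      · exfalso
        obtain ⟨u, rfl⟩ := (ZMod.intCast_zmod_eq_zero_iff_dvd x 7).1 hx
        obtain ⟨v, rfl⟩ := (ZMod.intCast_zmod_eq_zero_iff_dvd y 7).1 hy
        obtain ⟨w, rfl⟩ := (ZMod.intCast_zmod_eq_zero_iff_dvd z 7).1 hz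
        apply h49
        rw [← hp]
        exact ⟨u ^ 2 + 8 * v ^ 2 + 8 * w ^ 2, by push_cast; ring⟩)
    omega
end

section
/- As formal power series in ℤ⟦q⟧: ψ(q²)·φ(q)² = ψ(q²)·φ(q³)² + 4q·ψ(q)·ψ(q³)·ψ(q⁶). -/
open PowerSeries

/-- `phi k` is the theta series `φ(q^k) = ∑_{m ∈ ℤ} q^(k·m²)`, i.e. the formal power
series whose coefficient of `qⁿ` is `#{m ∈ ℤ : n = k·m²}`. -/
noncomputable def phi (k : ℕ) : PowerSeries ℤ :=
  PowerSeries.mk fun n => ({m : ℤ | (n : ℤ) = k * m ^ 2}.ncard : ℤ)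

/-- `psi k` is the theta series `ψ(q^k) = ∑_{m ≥ 0} q^(k·m(m+1)/2)`, i.e. the formal
power series whose coefficient of `qⁿ` is `#{m ∈ ℤ, m ≥ 0 : n = k·m(m+1)/2}`. -/
noncomputable def psi (k : ℕ) : PowerSeries ℤ :=
  PowerSeries.mk fun n => ({m : ℤ | 0 ≤ m ∧ (n : ℤ) = k * (m * (m + 1) / 2)}.ncard : ℤ)

section jtp

noncomputable def PP (x p : ℝ) : ℝ := ∏' i : ℕ, (1 - x * p ^ i)
noncomputable def pt (x p : ℝ) (n : ℕ) : ℝ := ∏ i ∈ Finset.range n, (1 - x * p ^ i)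
noncomputable def gg (p : ℝ) (k : ℤ) : ℝ := if k < 0 then 0 else (pt p p k.toNat)⁻¹
noncomputable def ww (z r : ℝ) (j : ℤ) : ℝ := (-z) ^ j * r ^ (j * (j - 1))
noncomputable def JJ (z r : ℝ) : ℝ := ∑' j : ℤ, ww z r j

open Filter Topology

lemma summ_geo (x : ℝ) {p : ℝ} (h0 : 0 < p) (h1 : p < 1) : Summable fun i : ℕ => ‖-(x * p ^ i)‖ := by
  have := (summable_geometric_of_lt_one h0.le h1).mul_left |x|
  refine this.congr fun i => ?_
  rw [norm_neg, norm_mul, Real.norm_eq_abs, Real.norm_eq_abs, abs_of_pos (pow_pos h0 i)]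

lemma pt_tendsto (x : ℝ) {p : ℝ} (h0 : 0 < p) (h1 : p < 1) :
    Tendsto (pt x p) atTop (𝓝 (PP x p)) := by
  have h := (multipliable_one_add_of_summable (summ_geo x h0 h1)).hasProd.tendsto_prod_nat
  simp only [← sub_eq_add_neg] at h
  exact h

lemma PP_ne (x : ℝ) {p : ℝ} (h0 : 0 < p) (h1 : p < 1) (hx0 : 0 < x) (hx : x < 1) : PP x p ≠ 0 := by
  have := tprod_one_add_ne_zero_of_summable (f := fun i : ℕ => -(x * p ^ i)) ?_ (summ_geo x h0 h1)
  · simpa [PP, sub_eq_add_neg] using this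
  · intro i
    have h2 : p ^ i ≤ 1 := pow_le_one₀ h0.le h1.le
    have h3 : 0 < p ^ i := pow_pos h0 i
    have : x * p ^ i < 1 := by nlinarith
    intro h; linarith

lemma pt_pos {p : ℝ} (h0 : 0 < p) (h1 : p < 1) (n : ℕ) : 0 < pt p p n := by
  apply Finset.prod_pos
  intro i _
  have : p ^ (i+1) < 1 := pow_lt_one₀ h0.le h1 (by omega)
  rw [pow_succ'] at this
  linarith

lemma pt_anti {p : ℝ} (h0 : 0 < p) (h1 : p < 1) : Antitone (pt p p) := by
  apply antitone_nat_of_succ_le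
  intro n
  have h := pt_pos h0 h1 n
  rw [pt, Finset.prod_range_succ]
  change pt p p n * _ ≤ pt p p n
  have h3 : 0 < p ^ n := pow_pos h0 n
  have := mul_pos h (mul_pos h0 h3)
  nlinarith

lemma PP_le_pt {p : ℝ} (h0 : 0 < p) (h1 : p < 1) (n : ℕ) : PP p p ≤ pt p p n :=
  (pt_anti h0 h1).le_of_tendsto (pt_tendsto p h0 h1) n

lemma PP_pos {p : ℝ} (h0 : 0 < p) (h1 : p < 1) : 0 < PP p p :=
  lt_of_le_of_ne (ge_of_tendsto' (pt_tendsto p h0 h1) fun n => (pt_pos h0 h1 n).le)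
    (PP_ne p h0 h1 h0 h1).symm

lemma gg_nonneg {p : ℝ} (h0 : 0 < p) (h1 : p < 1) (k : ℤ) : 0 ≤ gg p k := by
  unfold gg
  split_ifs
  · exact le_rfl
  · exact (inv_pos.2 (pt_pos h0 h1 _)).le

lemma gg_le {p : ℝ} (h0 : 0 < p) (h1 : p < 1) (k : ℤ) : gg p k ≤ (PP p p)⁻¹ := by
  unfold gg
  have := PP_pos h0 h1
  split_ifs
  · positivity
  · exact inv_anti₀ this (PP_le_pt h0 h1 _)

lemma gg_rec {p : ℝ} (h0 : 0 < p) (h1 : p < 1) (k : ℤ) : gg p (k - 1) = (1 - p ^ k) * gg p k := by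
  unfold gg
  rcases lt_trichotomy k 0 with h | h | h
  · rw [if_pos h, if_pos (by omega)]; simp
  · subst h; simp
  · obtain ⟨n, rfl⟩ : ∃ n : ℕ, k = n + 1 := ⟨(k-1).toNat, by omega⟩
    rw [if_neg (by omega), if_neg (by omega)]
    have e1 : ((n : ℤ) + 1 - 1).toNat = n := by omega
    have e2 : ((n : ℤ) + 1).toNat = n + 1 := by omega
    rw [e1, e2]
    have h3 := pt_pos h0 h1 (n+1)
    have h4 := pt_pos h0 h1 n
    have e : pt p p (n+1) = pt p p n * (1 - p ^ (n+1)) := by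
      rw [pt, Finset.prod_range_succ, pow_succ']; rfl
    have e5 : p ^ ((n:ℤ)+1) = p ^ (n+1) := by exact_mod_cast rfl
    rw [e5]
    rw [e] at h3 ⊢
    have : (1 - p ^ (n+1)) ≠ 0 := right_ne_zero_of_mul h3.ne'
    field_simp

lemma gg_tendsto {p : ℝ} (h0 : 0 < p) (h1 : p < 1) : Tendsto (gg p) atTop (𝓝 (PP p p)⁻¹) := by
  have h := ((pt_tendsto p h0 h1).inv₀ (PP_pos h0 h1).ne')
  have ht : Tendsto Int.toNat atTop atTop := by
    refine tendsto_atTop.2 fun n => ?_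
    filter_upwards [eventually_ge_atTop (n:ℤ)] with k hk
    omega
  refine (h.comp ht).congr' ?_
  filter_upwards [eventually_ge_atTop (0:ℤ)] with k hk
  simp [gg, not_lt.2 hk]

lemma ww_succ {z r : ℝ} (hz : z ≠ 0) (hr : 0 < r) (j : ℤ) :
    ww z r (j + 1) = (-z) * (r ^ 2) ^ j * ww z r j := by
  unfold ww
  have : (j + 1) * (j + 1 - 1) = j * (j - 1) + 2 * j := by ring
  rw [this, zpow_add₀ hr.ne', zpow_add₀ (neg_ne_zero.2 hz), zpow_mul r 2 j]
  norm_cast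
  ring

lemma finite_jtp {z r : ℝ} (hz : z ≠ 0) (h0 : 0 < r) (h1 : r < 1) (n : ℕ) :
    HasSum (fun j : ℤ => ww z r j * (pt (r^2) (r^2) (2*n) * gg (r^2) (n - j) * gg (r^2) (n + j)))
      (pt z (r^2) n * pt (r^2 / z) (r^2) n) := by
  have hp0 : 0 < r ^ 2 := by positivity
  have hp1 : r ^ 2 < 1 := pow_lt_one₀ h0.le h1 (by norm_num)
  have hw := ww_succ hz h0
  generalize hpp : r ^ 2 = p at *
  induction n with
  | zero =>
    have : (pt z p 0 * pt (p / z) p 0) = ww z r 0 * (pt p p (2*0) * gg p ((0:ℕ) - (0:ℤ)) * gg p ((0:ℕ) + (0:ℤ))) := by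
      simp [pt, ww, gg]
    rw [this]
    refine hasSum_single (0:ℤ) ?_
    intro j hj
    rcases lt_or_gt_of_ne hj with h | h
    · simp [gg, h]
    · simp [gg, h]
  | succ n ih =>
    have i1 := (Equiv.hasSum_iff (Equiv.subRight (1:ℤ))).2 ih
    have i2 := (Equiv.hasSum_iff (Equiv.addRight (1:ℤ))).2 ih
    have i3 := ((ih.mul_left (1 + p ^ (2*n+1))).add (i1.mul_left (-(z * p ^ n)))).add (i2.mul_left (-(p ^ (n+1) / z)))
    have hv : pt z p (n + 1) * pt (p / z) p (n + 1) =
        (1 + p ^ (2 * n + 1)) * (pt z p n * pt (p / z) p n) + -(z * p ^ n) * (pt z p n * pt (p / z) p n) +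
        -(p ^ (n + 1) / z) * (pt z p n * pt (p / z) p n) := by
      have a1 : ∀ x, pt x p (n+1) = pt x p n * (1 - x * p ^ n) := fun x => Finset.prod_range_succ _ _
      rw [a1, a1]
      field_simp
      ring
    rw [hv]
    refine Eq.subst (motive := fun f : ℤ → ℝ => HasSum f _) (funext fun j => ?_) i3
    symm
    simp only [Function.comp, Equiv.subRight_apply, Equiv.coe_addRight]
    have w1 : ww z r j = (-z) * p ^ (j-1) * ww z r (j-1) := by
      have := hw (j-1); simpa using this
    have w1' : ww z r (j-1) = ww z r j * p / ((-z) * p ^ j) := by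
      rw [w1, zpow_sub_one₀ hp0.ne']
      have : p ^ j ≠ 0 := zpow_ne_zero _ hp0.ne'
      field_simp
    rw [hw j, w1']
    have e1 : gg p (n - j) = (1 - p ^ ((n:ℤ) + 1 - j)) * gg p (n + 1 - j) := by
      rw [← gg_rec hp0 hp1]; congr 1; ring
    have e2 : gg p (n + j) = (1 - p ^ ((n:ℤ) + 1 + j)) * gg p (n + 1 + j) := by
      rw [← gg_rec hp0 hp1]; congr 1; ring
    have e3 : gg p (n - (j + 1)) = (1 - p ^ ((n:ℤ) - j)) * gg p (n - j) := by
      rw [← gg_rec hp0 hp1]; congr 1; ring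
    have e4 : gg p (n + (j - 1)) = (1 - p ^ ((n:ℤ) + j)) * gg p (n + j) := by
      rw [← gg_rec hp0 hp1]; congr 1; ring
    have e5 : gg p (n - (j - 1)) = gg p (n + 1 - j) := by congr 1; ring
    have e6 : gg p (n + (j + 1)) = gg p (n + 1 + j) := by congr 1; ring
    have e7 : gg p (((n+1:ℕ):ℤ) - j) = gg p (n + 1 - j) := by congr 1
    have e8 : gg p (((n+1:ℕ):ℤ) + j) = gg p (n + 1 + j) := by congr 1
    rw [e3, e4, e5, e6, e7, e8, e1, e2]
    have e : pt p p (2*(n+1)) = pt p p (2*n) * (1 - p ^ (2*n+1)) * (1 - p ^ (2*n+2)) := by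
      rw [pt, show 2*(n+1) = 2*n+1+1 by ring, Finset.prod_range_succ, Finset.prod_range_succ]
      simp only [pt]; ring
    rw [e]
    generalize gg p (n+1-j) = u
    generalize gg p (n+1+j) = v
    have hy : p ^ j ≠ 0 := zpow_ne_zero _ hp0.ne'
    simp only [zpow_add₀ hp0.ne', zpow_sub₀ hp0.ne', zpow_natCast, zpow_one]
    generalize p ^ j = y at *
    have hp := hp0.ne'
    field_simp
    ring

lemma ww_summable {z r : ℝ} (hz : z ≠ 0) (h0 : 0 < r) (h1 : r < 1) : Summable fun j => ‖ww z r j‖ := by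
  have hne : ∀ j, ww z r j ≠ 0 := fun j =>
    mul_ne_zero (zpow_ne_zero _ (neg_ne_zero.2 hz)) (zpow_ne_zero _ h0.ne')
  have hp0 : 0 < r ^ 2 := by positivity
  have hp1 : r ^ 2 < 1 := pow_lt_one₀ h0.le h1 (by norm_num)
  have hw := ww_succ hz h0
  have hl : Tendsto (fun n : ℕ => (r^2)^n) atTop (𝓝 0) := tendsto_pow_atTop_nhds_zero_of_lt_one hp0.le hp1
  apply Summable.of_nat_of_neg
  · apply Summable.norm
    refine summable_of_ratio_test_tendsto_lt_one (l := 0) zero_lt_one (Eventually.of_forall fun n => hne n) ?_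
    have : Tendsto (fun n : ℕ => |z| * (r^2)^n) atTop (𝓝 0) := by simpa using hl.const_mul |z|
    refine this.congr fun n => ?_
    have h := hw n
    push_cast
    rw [h, norm_mul, mul_div_assoc, div_self (norm_ne_zero_iff.2 (hne n)), norm_mul, zpow_natCast]
    simp
  · apply Summable.norm
    refine summable_of_ratio_test_tendsto_lt_one (l := 0) zero_lt_one (Eventually.of_forall fun n => hne _) ?_
    have : Tendsto (fun n : ℕ => |z|⁻¹ * r^2 * (r^2)^n) atTop (𝓝 0) := by simpa using hl.const_mul (|z|⁻¹ * r^2)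
    refine this.congr fun n => ?_
    have h := hw (-((n+1:ℕ):ℤ))
    have e : -((n+1:ℕ):ℤ) + 1 = -n := by push_cast; ring
    rw [e] at h
    rw [h, norm_mul, ← div_div, div_right_comm, div_self (norm_ne_zero_iff.2 (hne _)), norm_mul, zpow_neg, zpow_natCast]
    simp
    field_simp
    try ring

lemma jtp {z r : ℝ} (hz : z ≠ 0) (h0 : 0 < r) (h1 : r < 1) :
    JJ z r = PP (r^2) (r^2) * PP z (r^2) * PP (r^2/z) (r^2) := by
  have hp0 : 0 < r ^ 2 := by positivity
  have hp1 : r ^ 2 < 1 := pow_lt_one₀ h0.le h1 (by norm_num)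
  have hf := finite_jtp hz h0 h1
  have hs := ww_summable hz h0 h1
  unfold JJ
  generalize r ^ 2 = p at *
  have hP := PP_pos hp0 hp1
  have t1 : Tendsto (fun n => pt z p n * pt (p/z) p n) atTop (𝓝 (PP z p * PP (p/z) p)) :=
    (pt_tendsto z hp0 hp1).mul (pt_tendsto _ hp0 hp1)
  have t2 : Tendsto (fun n : ℕ => ∑' j : ℤ, ww z r j * (pt p p (2*n) * gg p (n - j) * gg p (n + j))) atTop
      (𝓝 (∑' j : ℤ, ww z r j * (PP p p * (PP p p)⁻¹ * (PP p p)⁻¹))) := by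
    refine tendsto_tsum_of_dominated_convergence (bound := fun j => ‖ww z r j‖ * (1 * (PP p p)⁻¹ * (PP p p)⁻¹)) (hs.mul_right _) ?_ ?_
    · intro j
      have c : Tendsto (fun n : ℕ => (n:ℤ)) atTop atTop := tendsto_natCast_atTop_atTop
      have a1 : Tendsto (fun n : ℕ => pt p p (2*n)) atTop (𝓝 (PP p p)) :=
        (pt_tendsto p hp0 hp1).comp (tendsto_id.const_mul_atTop' (by norm_num))
      have a2 : Tendsto (fun n : ℕ => gg p (n - j)) atTop (𝓝 (PP p p)⁻¹) :=
        (gg_tendsto hp0 hp1).comp (tendsto_atTop_add_const_right _ (-j) c)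
      have a3 : Tendsto (fun n : ℕ => gg p (n + j)) atTop (𝓝 (PP p p)⁻¹) :=
        (gg_tendsto hp0 hp1).comp (tendsto_atTop_add_const_right _ j c)
      exact ((a1.mul a2).mul a3).const_mul _
    · refine Eventually.of_forall fun n j => ?_
      change ‖ww z r j * (pt p p (2*n) * gg p (n - j) * gg p (n + j))‖ ≤ _
      rw [norm_mul]
      have b1 := pt_pos hp0 hp1 (2*n)
      have b2 : pt p p (2*n) ≤ 1 := by
        have := pt_anti hp0 hp1 (Nat.zero_le (2*n)); simpa [pt] using this
      have b3 := gg_nonneg hp0 hp1 (n-j)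
      have b4 := gg_nonneg hp0 hp1 (n+j)
      have b5 := gg_le hp0 hp1 (n-j)
      have b6 := gg_le hp0 hp1 (n+j)
      have b7 : ‖pt p p (2*n) * gg p (n - j) * gg p (n + j)‖ = pt p p (2*n) * gg p (n - j) * gg p (n + j) :=
        Real.norm_of_nonneg (by positivity)
      rw [b7]
      gcongr
  have t3 := tendsto_nhds_unique t1 (t2.congr fun n => (hf n).tsum_eq)
  rw [tsum_mul_right] at t3
  rw [mul_assoc, t3]
  field_simp

end jtp

section prods
open Filter Topology

lemma PP_two (x : ℝ) {p : ℝ} (h0 : 0 < p) (h1 : p < 1) : PP x p = PP x (p^2) * PP (x*p) (p^2) := by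
  have hp0 : 0 < p ^ 2 := by positivity
  have hp1 : p ^ 2 < 1 := pow_lt_one₀ h0.le h1 (by norm_num)
  have a1 : Tendsto (fun n : ℕ => pt x p (2*n)) atTop (𝓝 (PP x p)) :=
    (pt_tendsto x h0 h1).comp (tendsto_id.const_mul_atTop' (by norm_num))
  refine tendsto_nhds_unique a1 (((pt_tendsto x hp0 hp1).mul (pt_tendsto (x*p) hp0 hp1)).congr fun n => ?_)
  simp only [pt]
  induction n with
  | zero => simp
  | succ n ih =>
    rw [show 2*(n+1) = 2*n+1+1 by ring, Finset.prod_range_succ, Finset.prod_range_succ,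
      Finset.prod_range_succ _ (2*n+1), Finset.prod_range_succ _ (2*n), ← ih]
    ring

lemma PP_three (x : ℝ) {p : ℝ} (h0 : 0 < p) (h1 : p < 1) :
    PP x p = PP x (p^3) * PP (x*p) (p^3) * PP (x*p^2) (p^3) := by
  have hp0 : 0 < p ^ 3 := by positivity
  have hp1 : p ^ 3 < 1 := pow_lt_one₀ h0.le h1 (by norm_num)
  have a1 : Tendsto (fun n : ℕ => pt x p (3*n)) atTop (𝓝 (PP x p)) :=
    (pt_tendsto x h0 h1).comp (tendsto_id.const_mul_atTop' (by norm_num))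
  refine tendsto_nhds_unique a1 ((((pt_tendsto x hp0 hp1).mul (pt_tendsto (x*p) hp0 hp1)).mul
    (pt_tendsto (x*p^2) hp0 hp1)).congr fun n => ?_)
  simp only [pt]
  induction n with
  | zero => simp
  | succ n ih =>
    rw [show 3*(n+1) = 3*n+1+1+1 by ring, Finset.prod_range_succ, Finset.prod_range_succ,
      Finset.prod_range_succ _ n, Finset.prod_range_succ _ (3*n+1+1),
      Finset.prod_range_succ _ (3*n+1), Finset.prod_range_succ _ (3*n), ← ih]
    ring

lemma PP_dup (x : ℝ) {p : ℝ} (h0 : 0 < p) (h1 : p < 1) : PP x p * PP (-x) p = PP (x^2) (p^2) := by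
  have hp0 : 0 < p ^ 2 := by positivity
  have hp1 : p ^ 2 < 1 := pow_lt_one₀ h0.le h1 (by norm_num)
  refine tendsto_nhds_unique (((pt_tendsto x h0 h1).mul (pt_tendsto (-x) h0 h1)).congr fun n => ?_)
    (pt_tendsto (x^2) hp0 hp1)
  simp only [pt]
  rw [← Finset.prod_mul_distrib]
  refine Finset.prod_congr rfl fun i _ => ?_
  ring

lemma PP_shift (x : ℝ) {p : ℝ} (h0 : 0 < p) (h1 : p < 1) : PP x p = (1 - x) * PP (x*p) p := by
  have a1 : Tendsto (fun n : ℕ => pt x p (n+1)) atTop (𝓝 (PP x p)) :=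
    (pt_tendsto x h0 h1).comp (tendsto_add_atTop_nat 1)
  refine tendsto_nhds_unique a1 (((pt_tendsto (x*p) h0 h1).const_mul (1-x)).congr fun n => ?_)
  simp only [pt]
  rw [Finset.prod_range_succ', mul_comm]
  congr 1
  · refine Finset.prod_congr rfl fun i _ => ?_
    ring
  · simp

lemma jtp' {z r : ℝ} (y p : ℝ) (hz : z ≠ 0) (h0 : 0 < r) (h1 : r < 1) (hp : p = r^2) (hy : z * y = p) :
    JJ z r = PP p p * PP z p * PP y p := by
  rw [jtp hz h0 h1, ← hp, ← hy, mul_div_cancel_left₀ _ hz]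

lemma jtp_psi {r : ℝ} (p : ℝ) (h0 : 0 < r) (h1 : r < 1) (hp : p = r^2) :
    JJ (-1) r / 2 = PP p p * PP (-p) p ^ 2 := by
  have hp0 : 0 < p := by rw [hp]; positivity
  have hp1 : p < 1 := by rw [hp]; exact pow_lt_one₀ h0.le h1 (by norm_num)
  rw [jtp' (-p) p (by norm_num) h0 h1 hp (by ring), PP_shift (-1) hp0 hp1, neg_one_mul]
  ring

lemma JJ_mul {z z' r : ℝ} (hz : z ≠ 0) (hz' : z' ≠ 0) (h0 : 0 < r) (h1 : r < 1) :
    JJ z r * JJ z' r = ∑' x : ℤ × ℤ, ww z r x.1 * ww z' r x.2 :=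
  tsum_mul_tsum_of_summable_norm (ww_summable hz h0 h1) (ww_summable hz' h0 h1)

lemma ww_sum {z z' r : ℝ} (hz : z ≠ 0) (hz' : z' ≠ 0) (h0 : 0 < r) (h1 : r < 1) :
    Summable fun x : ℤ × ℤ => ww z r x.1 * ww z' r x.2 :=
  (summable_mul_of_summable_norm (ww_summable hz h0 h1) (ww_summable hz' h0 h1))

lemma ww_pow (q : ℝ) (h : 0 < q) (k l : ℕ) (j : ℤ) :
    ww (q^k) (q^l) j = (-1) ^ j * q ^ (k * j + l * (j * (j-1))) := by
  unfold ww
  rw [← neg_one_mul, mul_zpow, zpow_add₀ h.ne', zpow_mul q (k:ℤ) j, zpow_mul q (l:ℤ) _, zpow_natCast, zpow_natCast, mul_assoc]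

lemma ww_npow (q : ℝ) (h : 0 < q) (k l : ℕ) (j : ℤ) :
    ww (-q^k) (q^l) j = q ^ (k * j + l * (j * (j-1))) := by
  unfold ww
  rw [neg_neg, zpow_add₀ h.ne', zpow_mul q (k:ℤ) j, zpow_mul q (l:ℤ) _, zpow_natCast, zpow_natCast]

lemma sgn_sq (j : ℤ) : ((-1:ℝ)^j) = 1 ∧ Even j ∨ ((-1:ℝ)^j) = -1 ∧ Odd j := by
  rcases Int.even_or_odd j with h | h
  · left; exact ⟨h.neg_one_zpow, h⟩
  · right; exact ⟨h.neg_one_zpow, h⟩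

lemma plus_id (q : ℝ) (h0 : 0 < q) (h1 : q < 1) :
    JJ (-q^1) (q^3) * JJ (q^2) (q^3) + JJ (q^1) (q^3) * JJ (-q^2) (q^3)
      = 2 * (JJ (q^3) (q^6) * JJ (q^5) (q^6)) := by
  have p3 : 0 < q^3 := by positivity
  have l3 : q^3 < 1 := pow_lt_one₀ h0.le h1 (by norm_num)
  have p6 : 0 < q^6 := by positivity
  have l6 : q^6 < 1 := pow_lt_one₀ h0.le h1 (by norm_num)
  have n1 : q^1 ≠ 0 := by positivity
  have n2 : q^2 ≠ 0 := by positivity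
  have n5 : q^5 ≠ 0 := by positivity
  have m1 := neg_ne_zero.2 n1
  have m2 := neg_ne_zero.2 n2
  rw [JJ_mul m1 n2 p3 l3, JJ_mul n1 m2 p3 l3, JJ_mul p3.ne' n5 p6 l6,
    ← (ww_sum m1 n2 p3 l3).tsum_add (ww_sum n1 m2 p3 l3), ← tsum_mul_left]
  have hi : Function.Injective (fun x : ℤ × ℤ => (x.1 + x.2, x.1 - x.2)) := by
    rintro ⟨a, b⟩ ⟨c, d⟩ h
    simp only [Prod.mk.injEq] at h ⊢
    omega
  rw [← hi.tsum_eq]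
  · refine tsum_congr fun ⟨s, t⟩ => ?_
    simp only [ww_pow q h0, ww_npow q h0]
    have e1 : ((-1:ℝ))^(s+t) = (-1)^s * (-1)^t := zpow_add₀ (by norm_num) _ _
    have e2 : ((-1:ℝ))^(s-t) = (-1)^s * (-1)^t := by
      rw [zpow_sub₀ (by norm_num)]
      rcases sgn_sq t with ⟨h, _⟩ | ⟨h, _⟩ <;> rw [h] <;> ring
    rw [e1, e2]
    have f1 : ∀ u x y : ℝ, x * (u * y) + u * x * y = 2 * (u * (x * y)) := by intros; ring
    have f2 : ∀ a b x y : ℝ, 2 * (a * x * (b * y)) = 2 * (a * b * (x * y)) := by intros; ring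
    rw [f1, f2 ((-1)^s) ((-1)^t), ← zpow_add₀ h0.ne', ← zpow_add₀ h0.ne']
    congr 3
    push_cast
    ring
  · rintro ⟨m, n⟩ h
    simp only [ww_pow q h0, ww_npow q h0, Function.mem_support] at h
    have : Even (m + n) := by
      by_contra hc
      apply h
      rcases sgn_sq m with ⟨h, hm⟩ | ⟨h, hm⟩ <;> rcases sgn_sq n with ⟨h', hn⟩ | ⟨h', hn⟩ <;> rw [h, h']
      · exact absurd (hm.add hn) hc
      · ring
      · ring
      · exact absurd (hm.add_odd hn) hc
    obtain ⟨k, hk⟩ := this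
    refine ⟨(k, m - k), ?_⟩
    simp only [Prod.mk.injEq]
    omega

lemma minus_id (q : ℝ) (h0 : 0 < q) (h1 : q < 1) :
    JJ (-q^1) (q^3) * JJ (q^2) (q^3) - JJ (q^1) (q^3) * JJ (-q^2) (q^3)
      = 2 * q * (JJ (q^9) (q^6) * JJ (q^11) (q^6)) := by
  have p3 : 0 < q^3 := by positivity
  have l3 : q^3 < 1 := pow_lt_one₀ h0.le h1 (by norm_num)
  have p6 : 0 < q^6 := by positivity
  have l6 : q^6 < 1 := pow_lt_one₀ h0.le h1 (by norm_num)
  have n1 : q^1 ≠ 0 := by positivity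
  have n2 : q^2 ≠ 0 := by positivity
  have n9 : q^9 ≠ 0 := by positivity
  have n11 : q^11 ≠ 0 := by positivity
  have m1 := neg_ne_zero.2 n1
  have m2 := neg_ne_zero.2 n2
  rw [JJ_mul m1 n2 p3 l3, JJ_mul n1 m2 p3 l3, JJ_mul n9 n11 p6 l6,
    ← (ww_sum m1 n2 p3 l3).tsum_sub (ww_sum n1 m2 p3 l3), ← tsum_mul_left]
  have hi : Function.Injective (fun x : ℤ × ℤ => (x.1 + x.2 + 1, x.1 - x.2)) := by
    rintro ⟨a, b⟩ ⟨c, d⟩ h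
    simp only [Prod.mk.injEq] at h ⊢
    omega
  rw [← hi.tsum_eq]
  · refine tsum_congr fun ⟨s, t⟩ => ?_
    simp only [ww_pow q h0, ww_npow q h0]
    have e1 : ((-1:ℝ))^(s+t+1) = -((-1)^s * (-1)^t) := by
      rw [zpow_add₀ (by norm_num), zpow_add₀ (by norm_num)]; simp
    have e2 : ((-1:ℝ))^(s-t) = (-1)^s * (-1)^t := by
      rw [zpow_sub₀ (by norm_num)]
      rcases sgn_sq t with ⟨h, _⟩ | ⟨h, _⟩ <;> rw [h] <;> ring
    rw [e1, e2]
    have f1 : ∀ u x y : ℝ, x * (u * y) - -u * x * y = 2 * (u * (x * y)) := by intros; ring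
    have f2 : ∀ a b x y : ℝ, 2 * q * (a * x * (b * y)) = 2 * (a * b * (q * (x * y))) := by intros; ring
    rw [f1, f2 ((-1)^s) ((-1)^t), ← zpow_add₀ h0.ne', ← zpow_add₀ h0.ne', ← zpow_one_add₀ h0.ne']
    congr 3
    push_cast
    ring
  · rintro ⟨m, n⟩ h
    simp only [ww_pow q h0, ww_npow q h0, Function.mem_support] at h
    have : Odd (m + n) := by
      by_contra hc
      apply h
      rcases sgn_sq m with ⟨h, hm⟩ | ⟨h, hm⟩ <;> rcases sgn_sq n with ⟨h', hn⟩ | ⟨h', hn⟩ <;> rw [h, h']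
      · ring
      · exact absurd (hm.add_odd hn) hc
      · exact absurd (hm.add_even hn) hc
      · ring
    obtain ⟨k, hk⟩ := this
    refine ⟨(k, m - k - 1), ?_⟩
    simp only [Prod.mk.injEq]
    omega

lemma real_id (t : ℝ) (h0 : 0 < t) (h1 : t < 1) :
    JJ (-1) (t^2) / 2 * JJ (-(t^2)^1) ((t^2)^1) ^ 2 = JJ (-1) (t^2) / 2 * JJ (-(t^2)^3) ((t^2)^3) ^ 2
      + 4 * t^2 * (JJ (-1) (t^1) / 2) * (JJ (-1) (t^3) / 2) * (JJ (-1) (t^6) / 2) := by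
  have tp : ∀ k : ℕ, 0 < t ^ k := fun k => pow_pos h0 k
  have tl : ∀ k : ℕ, t ^ (k+1) < 1 := fun k => pow_lt_one₀ h0.le h1 (by omega)
  have g1 := jtp_psi (t^2) (tp 1) (tl 0) (by ring)
  have g2 := jtp_psi ((t^2)^2) (tp 2) (tl 1) (by ring)
  have g3 := jtp_psi ((t^2)^3) (tp 3) (tl 2) (by ring)
  have g6 := jtp_psi ((t^2)^6) (tp 6) (tl 5) (by ring)
  rw [g1, g2, g3, g6]
  have q0 : 0 < t^2 := tp 2
  have q1 : t^2 < 1 := tl 1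
  clear g1 g2 g3 g6 tp tl
  generalize t ^ 2 = q at *
  have qp : ∀ k : ℕ, 0 < q ^ k := fun k => pow_pos q0 k
  have qn : ∀ k : ℕ, q ^ k ≠ 0 := fun k => (pow_pos q0 k).ne'
  have qm : ∀ k : ℕ, -q ^ k ≠ 0 := fun k => neg_ne_zero.2 (qn k)
  have ql : ∀ k : ℕ, q ^ (k+1) < 1 := fun k => pow_lt_one₀ q0.le q1 (by omega)
  have hpl := plus_id q q0 q1
  have hmi := minus_id q q0 q1
  -- theta products
  have jA := jtp' (q^5) (q^6) (qn 1) (qp 3) (ql 2) (by ring) (by ring)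
  have jB := jtp' (-q^5) (q^6) (qm 1) (qp 3) (ql 2) (by ring) (by ring)
  have jC := jtp' (q^4) (q^6) (qn 2) (qp 3) (ql 2) (by ring) (by ring)
  have jD := jtp' (-q^4) (q^6) (qm 2) (qp 3) (ql 2) (by ring) (by ring)
  have jF := jtp' (-q^3) (q^6) (qm 3) (qp 3) (ql 2) (by ring) (by ring)
  have j3 := jtp' (q^9) (q^12) (qn 3) (qp 6) (ql 5) (by ring) (by ring)
  have j5 := jtp' (q^7) (q^12) (qn 5) (qp 6) (ql 5) (by ring) (by ring)
  have j9 := jtp' (q^3) (q^12) (qn 9) (qp 6) (ql 5) (by ring) (by ring)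
  have j11 := jtp' (q^1) (q^12) (qn 11) (qp 6) (ql 5) (by ring) (by ring)
  have jphi := jtp' (-q^1) (q^2) (qm 1) (qp 1) (ql 0) (by ring) (by ring)
  -- splitting
  have six : ∀ x, PP x q = PP x (q^6) * PP (x*q^2) (q^6) * PP (x*q^4) (q^6) *
      (PP (x*q) (q^6) * PP (x*q^3) (q^6) * PP (x*q^5) (q^6)) := by
    intro x
    rw [PP_two x q0 q1, PP_three x (qp 2) (ql 1), PP_three (x*q) (qp 2) (ql 1)]
    ring_nf
  have k1 : PP q q = PP (q^1) (q^6) * PP (q^3) (q^6) * PP (q^5) (q^6) *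
      (PP (q^2) (q^6) * PP (q^4) (q^6) * PP (q^6) (q^6)) := by
    rw [six]; ring_nf
  have k2 : PP (-q) q = PP (-q^1) (q^6) * PP (-q^3) (q^6) * PP (-q^5) (q^6) *
      (PP (-q^2) (q^6) * PP (-q^4) (q^6) * PP (-q^6) (q^6)) := by
    rw [six]; ring_nf
  have k3 : PP (q^2) (q^2) = PP (q^2) (q^6) * PP (q^4) (q^6) * PP (q^6) (q^6) := by
    rw [PP_three _ (qp 2) (ql 1)]; ring_nf
  have k4 : PP (-q^2) (q^2) = PP (-q^2) (q^6) * PP (-q^4) (q^6) * PP (-q^6) (q^6) := by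
    rw [PP_three _ (qp 2) (ql 1)]; ring_nf
  have k5 : PP (q^3) (q^3) = PP (q^3) (q^6) * PP (q^6) (q^6) := by
    rw [PP_two _ (qp 3) (ql 2)]; ring_nf
  have k6 : PP (-q^3) (q^3) = PP (-q^3) (q^6) * PP (-q^6) (q^6) := by
    rw [PP_two _ (qp 3) (ql 2)]; ring_nf
  have k7 : PP (-q^1) (q^2) = PP (-q^1) (q^6) * PP (-q^3) (q^6) * PP (-q^5) (q^6) := by
    rw [PP_three _ (qp 2) (ql 1)]; ring_nf
  have k8 : PP (q^12) (q^12) = PP (q^6) (q^6) * PP (-q^6) (q^6) := by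
    rw [PP_dup _ (qp 6) (ql 5)]; ring_nf
  have k9 : PP (q^3) (q^6) = PP (q^3) (q^12) * PP (q^9) (q^12) := by
    rw [PP_two _ (qp 6) (ql 5)]; ring_nf
  have k10 : PP (q^1) (q^6) = PP (q^1) (q^12) * PP (q^7) (q^12) := by
    rw [PP_two _ (qp 6) (ql 5)]; ring_nf
  have k11 : PP (q^5) (q^6) = PP (q^5) (q^12) * PP (q^11) (q^12) := by
    rw [PP_two _ (qp 6) (ql 5)]; ring_nf
  -- Euler
  have d1 : PP q q * PP (-q) q = PP (q^2) (q^2) := PP_dup q q0 q1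
  have d3 : PP (q^3) (q^3) * PP (-q^3) (q^3) = PP (q^6) (q^6) := by
    rw [PP_dup _ (qp 3) (ql 2)]; ring_nf
  have z1 := PP_ne (q^1) (qp 6) (ql 5) (qp _) (ql _)
  have z2 := PP_ne (q^2) (qp 6) (ql 5) (qp _) (ql _)
  have z3 := PP_ne (q^3) (qp 6) (ql 5) (qp _) (ql _)
  have z4 := PP_ne (q^4) (qp 6) (ql 5) (qp _) (ql _)
  have z5 := PP_ne (q^5) (qp 6) (ql 5) (qp _) (ql _)
  have z6 := PP_ne (q^6) (qp 6) (ql 5) (qp _) (ql _)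
  have zE2 := k3 ▸ mul_ne_zero (mul_ne_zero z2 z4) z6
  rw [jphi, jF, k1, k2, k4, k5, k6, k7, k3]
  rw [k1, k2, k3] at d1
  rw [k5, k6] at d3
  rw [jA, jB, jC, jD] at hpl hmi
  rw [j3, j5] at hpl
  rw [j9, j11] at hmi
  rw [k8] at hpl hmi
  have hprod := congrArg₂ (· * ·) hpl hmi
  generalize PP (q^1) (q^6) = r1 at *
  generalize PP (q^2) (q^6) = r2 at *
  generalize PP (q^3) (q^6) = r3 at *
  generalize PP (q^4) (q^6) = r4 at *
  generalize PP (q^5) (q^6) = r5 at *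
  generalize PP (q^6) (q^6) = r6 at *
  generalize PP (-q^1) (q^6) = s1 at *
  generalize PP (-q^2) (q^6) = s2 at *
  generalize PP (-q^3) (q^6) = s3 at *
  generalize PP (-q^4) (q^6) = s4 at *
  generalize PP (-q^5) (q^6) = s5 at *
  generalize PP (-q^6) (q^6) = s6 at *
  have eu3 : r3 * s3 * s6 = 1 := by
    apply mul_left_cancel₀ z6
    linear_combination d3
  have eu : r1 * r5 * s1 * s2 * s4 * s5 = 1 := by
    apply mul_left_cancel₀ (mul_ne_zero (mul_ne_zero z2 z4) z6)
    linear_combination d1 - r1 * r5 * s1 * s2 * s4 * s5 * r2 * r4 * r6 * eu3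
  have key : (s1*s5*r2*r4)^2 - (r1*r5*s2*s4)^2 = 4 * q * (r3^2 * r1 * r5 * s6^4) := by
    apply mul_left_cancel₀ (pow_ne_zero 4 z6)
    rw [k9, k10, k11]
    rw [k10, k11] at hprod
    linear_combination hprod
  linear_combination (r2*r4*r6*(s2*s4*s6)^2) * r6^2 * s3^4 * (s1*s5)^2 * key +
    (r2*r4*r6*(s2*s4*s6)^2) * r6^2 * s3^4 * (r1 * r5 * s1 * s2 * s4 * s5 + 1) * eu
end prods

section transfer
open Filter Topology

def Ev (F : PowerSeries ℤ) (q v : ℝ) : Prop :=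
  Summable (fun n : ℕ => ‖((coeff n F : ℤ) : ℝ) * q ^ n‖) ∧ ∑' n : ℕ, ((coeff n F : ℤ) : ℝ) * q ^ n = v

lemma Ev.mul {F G : PowerSeries ℤ} {q v w : ℝ} (hF : Ev F q v) (hG : Ev G q w) : Ev (F * G) q (v * w) := by
  have e : ∀ n : ℕ, ((coeff n (F * G) : ℤ) : ℝ) * q ^ n = ∑ kl ∈ Finset.HasAntidiagonal.antidiagonal n,
      (((coeff kl.1 F : ℤ) : ℝ) * q ^ kl.1) * (((coeff kl.2 G : ℤ) : ℝ) * q ^ kl.2) := by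
    intro n
    rw [PowerSeries.coeff_mul]
    push_cast
    rw [Finset.sum_mul]
    refine Finset.sum_congr rfl fun x hx => ?_
    rw [← Finset.HasAntidiagonal.mem_antidiagonal.1 hx, pow_add]
    ring
  have e' : (fun n : ℕ => ((coeff n (F * G) : ℤ) : ℝ) * q ^ n) = _ := funext e
  have i1 := summable_norm_sum_mul_antidiagonal_of_summable_norm
    (f := fun n : ℕ => ((coeff n F : ℤ) : ℝ) * q ^ n) (g := fun n : ℕ => ((coeff n G : ℤ) : ℝ) * q ^ n) hF.1 hG.1
  have i2 := tsum_mul_tsum_eq_tsum_sum_antidiagonal_of_summable_norm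
    (f := fun n : ℕ => ((coeff n F : ℤ) : ℝ) * q ^ n) (g := fun n : ℕ => ((coeff n G : ℤ) : ℝ) * q ^ n) hF.1 hG.1
  refine ⟨?_, ?_⟩
  · refine i1.congr fun n => ?_
    rw [e]
  · rw [e', ← i2, hF.2, hG.2]

lemma Ev.add {F G : PowerSeries ℤ} {q v w : ℝ} (hF : Ev F q v) (hG : Ev G q w) : Ev (F + G) q (v + w) := by
  have e : ∀ n : ℕ, ((coeff n (F + G) : ℤ) : ℝ) * q ^ n =
      ((coeff n F : ℤ) : ℝ) * q ^ n + ((coeff n G : ℤ) : ℝ) * q ^ n := by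
    intro n
    rw [map_add]
    push_cast
    ring
  refine ⟨?_, ?_⟩
  · simp only [e]
    exact (hF.1.of_norm.add hG.1.of_norm).norm
  · simp only [e]
    rw [hF.1.of_norm.tsum_add hG.1.of_norm, hF.2, hG.2]

lemma Ev.mono (k : ℕ) (c : ℤ) (q : ℝ) : Ev (monomial k c) q (c * q ^ k) := by
  have e : ∀ n : ℕ, n ≠ k → ((coeff n (monomial k c) : ℤ) : ℝ) * q ^ n = 0 := by
    intro n hn
    rw [coeff_monomial, if_neg hn]; simp
  have h := hasSum_single k e
  rw [coeff_monomial_same] at h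
  exact ⟨h.summable.norm, h.tsum_eq⟩

lemma Ev_unique {D : PowerSeries ℤ} (h : ∀ q : ℝ, 0 < q → q < 1 → Ev D q 0) : D = 0 := by
  ext n
  rw [map_zero]
  induction n using Nat.strong_induction_on with
  | _ n ih =>
  have sm : ∀ q : ℝ, 0 < q → q < 1 → Summable fun m : ℕ => ‖((coeff (m + (n+1)) D : ℤ) : ℝ) * q ^ m‖ := by
    intro q h0 h1
    have := ((summable_nat_add_iff (n+1)).2 (h q h0 h1).1).mul_right (q^(n+1))⁻¹
    refine this.congr fun m => ?_
    rw [norm_mul, norm_mul, pow_add, norm_mul, Real.norm_of_nonneg (pow_pos h0 (n+1)).le]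
    have := (pow_pos h0 (n+1)).ne'
    field_simp
  have key : ∀ q : ℝ, 0 < q → q < 1/2 →
      |((coeff n D : ℤ) : ℝ)| ≤ q * ∑' m : ℕ, ‖((coeff (m + (n+1)) D : ℤ) : ℝ) * (1/2) ^ m‖ := by
    intro q h0 h1
    have h1' : q < 1 := by linarith
    have hq := h q h0 h1'
    have e := hq.1.of_norm.sum_add_tsum_nat_add (n+1)
    rw [hq.2, Finset.sum_range_succ, Finset.sum_eq_zero, zero_add] at e
    swap
    · intro i hi
      rw [ih i (Finset.mem_range.1 hi)]; simp
    have e2 : ∑' m : ℕ, ((coeff (m + (n+1)) D : ℤ) : ℝ) * q ^ (m + (n+1)) =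
        q ^ n * (q * ∑' m : ℕ, ((coeff (m + (n+1)) D : ℤ) : ℝ) * q ^ m) := by
      rw [← tsum_mul_left, ← tsum_mul_left]
      refine tsum_congr fun m => ?_
      ring
    rw [e2] at e
    have e3 : ((coeff n D : ℤ) : ℝ) = - (q * ∑' m : ℕ, ((coeff (m + (n+1)) D : ℤ) : ℝ) * q ^ m) := by
      apply mul_left_cancel₀ (pow_pos h0 n).ne'
      linear_combination e
    rw [e3, abs_neg, abs_mul, abs_of_pos h0]
    refine mul_le_mul_of_nonneg_left ?_ h0.le
    rw [← Real.norm_eq_abs]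
    refine (norm_tsum_le_tsum_norm (sm q h0 h1')).trans ?_
    refine (sm q h0 h1').tsum_le_tsum (fun m => ?_) (sm (1/2) (by norm_num) (by norm_num))
    rw [norm_mul, norm_mul, Real.norm_of_nonneg (pow_pos h0 m).le,
      Real.norm_of_nonneg (by positivity : (0:ℝ) ≤ (1/2)^m)]
    gcongr
  set M := ∑' m : ℕ, ‖((coeff (m + (n+1)) D : ℤ) : ℝ) * (1/2) ^ m‖
  have hM : 0 ≤ M := tsum_nonneg fun m => norm_nonneg _
  by_contra hne
  have h1 : (1:ℝ) ≤ |((coeff n D : ℤ) : ℝ)| := by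
    exact_mod_cast Int.one_le_abs hne
  have hk := key (1 / (2 * M + 3)) (by positivity) (by
    apply one_div_lt_one_div_of_lt <;> linarith)
  have : 1 / (2 * M + 3) * M < 1 := by
    rw [one_div_mul_eq_div, div_lt_one (by positivity)]; linarith
  linarith

lemma Ev_count {ι : Type} (f : ι → ℕ) {q : ℝ} (h0 : 0 < q) (hs : Summable fun i => q ^ f i) :
    Ev (PowerSeries.mk fun n => (Nat.card {i // f i = n} : ℤ)) q (∑' i, q ^ f i) := by
  have h1 : Summable fun x : (Σ n : ℕ, {i // f i = n}) => q ^ f x.2 :=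
    (Equiv.summable_iff (Equiv.sigmaFiberEquiv f)).2 hs
  have h2 : ∑' x : (Σ n : ℕ, {i // f i = n}), q ^ f x.2 = ∑' i, q ^ f i :=
    (Equiv.sigmaFiberEquiv f).tsum_eq (fun i => q ^ f i)
  have h3 : ∀ n : ℕ, ∑' i : {i // f i = n}, q ^ f i = (Nat.card {i // f i = n} : ℝ) * q ^ n := by
    intro n
    have : ∀ i : {i // f i = n}, q ^ f i = q ^ n := fun i => by rw [i.2]
    simp only [this]
    rw [tsum_const, nsmul_eq_mul]
  have h4 := h1.sigma
  have h5 := h1.tsum_sigma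
  simp only [h3] at h4 h5
  unfold Ev
  simp only [coeff_mk, Int.cast_natCast]
  refine ⟨h4.norm, ?_⟩
  rw [← h2, h5]

lemma Ev_phi (k : ℕ) {q : ℝ} (h0 : 0 < q) (h1 : q ^ k < 1) : Ev (phi k) q (JJ (-q^k) (q^k)) := by
  have hp : 0 < q ^ k := pow_pos h0 k
  have e : ∀ m : ℤ, q ^ (k * m.natAbs ^ 2) = ww (-q^k) (q^k) m := by
    intro m
    rw [ww_npow q h0, ← zpow_natCast]
    congr 1
    push_cast
    rw [sq_abs]
    ring
  have hs : Summable fun m : ℤ => q ^ (k * m.natAbs ^ 2) := by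
    simp only [e]
    exact (ww_summable (neg_ne_zero.2 hp.ne') hp h1).of_norm
  have h := Ev_count _ h0 hs
  simp only [e] at h
  suffices hh : phi k = PowerSeries.mk fun n => (Nat.card {i : ℤ // k * i.natAbs ^ 2 = n} : ℤ) by
    rw [hh]; exact h
  unfold phi
  congr 1
  ext n
  rw [← Nat.card_coe_set_eq]
  congr 1
  refine Nat.card_congr (Equiv.subtypeEquivRight fun m => ?_)
  simp only [Set.mem_ofPred_eq]
  rw [eq_comm, ← Int.natCast_inj]
  push_cast
  rw [sq_abs]

lemma psi_e1 (k : ℕ) (t : ℝ) (m : ℕ) :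
    ww (-1) (t^k) ((m:ℤ) + 1) = (t^2) ^ (k * (m * (m+1) / 2)) := by
  have hev : 2 * (m * (m + 1) / 2) = m * (m+1) :=
    Nat.mul_div_cancel' (Nat.even_mul_succ_self m).two_dvd
  rw [← pow_mul, show 2 * (k * (m * (m+1) / 2)) = k * (2 * (m * (m+1) / 2)) by ring, hev, pow_mul,
    ← zpow_natCast (t^k)]
  unfold ww
  rw [neg_neg, one_zpow, one_mul]
  have : ((m:ℤ) + 1) * ((m:ℤ) + 1 - 1) = ((m * (m+1) : ℕ) : ℤ) := by push_cast; ring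
  rw [this]

lemma psi_e2 (k : ℕ) (t : ℝ) (m : ℕ) :
    ww (-1) (t^k) (-((m:ℤ)+1) + 1) = (t^2) ^ (k * (m * (m+1) / 2)) := by
  rw [← psi_e1]
  unfold ww
  rw [neg_neg, one_zpow, one_zpow]
  have : (-((m:ℤ)+1) + 1) * (-((m:ℤ)+1) + 1 - 1) = ((m:ℤ) + 1) * ((m:ℤ) + 1 - 1) := by ring
  rw [this]

lemma psi_sums (k : ℕ) {t : ℝ} (h0 : 0 < t) (h1 : t ^ k < 1) :
    (Summable fun m : ℕ => (t^2) ^ (k * (m * (m+1) / 2))) ∧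
    JJ (-1) (t^k) / 2 = ∑' m : ℕ, (t^2) ^ (k * (m * (m+1) / 2)) := by
  have hp : 0 < t ^ k := pow_pos h0 k
  have hw : Summable (fun j : ℤ => ww (-1) (t^k) (j + 1)) :=
    (Equiv.summable_iff (f := ww (-1) (t^k)) (Equiv.addRight (1:ℤ))).2
      (ww_summable (z := -1) (neg_ne_zero.2 one_ne_zero) hp h1).of_norm
  have hJ : JJ (-1) (t^k) = ∑' j : ℤ, ww (-1) (t^k) (j + 1) :=
    ((Equiv.addRight (1:ℤ)).tsum_eq (ww (-1) (t^k))).symm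
  have hs0 : Summable (fun m : ℕ => ww (-1) (t^k) ((m:ℤ) + 1)) :=
    hw.comp_injective (i := fun m : ℕ => (m : ℤ)) (Nat.cast_injective (R := ℤ))
  have hs : Summable fun m : ℕ => (t^2) ^ (k * (m * (m+1) / 2)) := by
    simpa only [psi_e1] using hs0
  refine ⟨hs, ?_⟩
  have hs2 : Summable (fun m : ℕ => ww (-1) (t^k) (-((m:ℤ)+1) + 1)) := by
    simpa only [psi_e2] using hs
  have := tsum_of_nat_of_neg_add_one (f := fun j : ℤ => ww (-1) (t^k) (j + 1)) hs0 hs2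
  simp only [psi_e1, psi_e2] at this
  rw [hJ, this]
  ring

lemma psi_count (k : ℕ) :
    psi k = PowerSeries.mk fun n => (Nat.card {m : ℕ // k * (m * (m+1) / 2) = n} : ℤ) := by
  unfold psi
  congr 1
  ext n
  have : {m : ℤ | 0 ≤ m ∧ (n : ℤ) = k * (m * (m + 1) / 2)} =
      (Nat.cast : ℕ → ℤ) '' {m : ℕ | k * (m * (m+1) / 2) = n} := by
    ext m
    simp only [Set.mem_ofPred_eq, Set.mem_image]
    constructor
    · rintro ⟨hm, h⟩
      lift m to ℕ using hm
      exact ⟨m, by exact_mod_cast h.symm, rfl⟩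
    · rintro ⟨m, h, rfl⟩
      exact ⟨by positivity, by exact_mod_cast h.symm⟩
  rw [this, Set.ncard_image_of_injective _ Nat.cast_injective, ← Nat.card_coe_set_eq]
  rfl

lemma Ev_psi (k : ℕ) {t : ℝ} (h0 : 0 < t) (h1 : t ^ k < 1) : Ev (psi k) (t^2) (JJ (-1) (t^k) / 2) := by
  obtain ⟨hs, hv⟩ := psi_sums k h0 h1
  have hq : 0 < t ^ 2 := pow_pos h0 2
  rw [hv, psi_count]
  exact Ev_count (fun m : ℕ => k * (m * (m+1) / 2)) hq hs

end transfer

theorem theta_identity_2_9 :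
    psi 2 * phi 1 ^ 2 = psi 2 * phi 3 ^ 2 + 4 * X * psi 1 * psi 3 * psi 6 := by
  rw [← sub_eq_zero]
  apply Ev_unique
  intro q h0 h1
  obtain ⟨t, ht0, ht1, rfl⟩ : ∃ t : ℝ, 0 < t ∧ t < 1 ∧ t ^ 2 = q :=
    ⟨Real.sqrt q, Real.sqrt_pos.2 h0, (Real.sqrt_lt' one_pos).2 (by simpa using h1), Real.sq_sqrt h0.le⟩
  have tl : ∀ k : ℕ, t ^ (k+1) < 1 := fun k => pow_lt_one₀ ht0.le ht1 (by omega)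
  have p1 := Ev_phi 1 h0 (pow_lt_one₀ h0.le h1 (by norm_num))
  have p3 := Ev_phi 3 h0 (pow_lt_one₀ h0.le h1 (by norm_num))
  have s1 := Ev_psi 1 ht0 (tl _)
  have s2 := Ev_psi 2 ht0 (tl _)
  have s3 := Ev_psi 3 ht0 (tl _)
  have s6 := Ev_psi 6 ht0 (tl _)
  have hX := Ev.mono 1 4 (t^2)
  have hm := Ev.mono 0 (-1) (t^2)
  have L := s2.mul (p1.mul p1)
  have R := (s2.mul (p3.mul p3)).add (((hX.mul s1).mul s3).mul s6)
  have T := L.add (hm.mul R)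
  have hid := real_id t ht0 ht1
  convert T using 1
  · have a1 : (monomial 1 (4:ℤ)) = (4 * X : PowerSeries ℤ) := by
      ext n
      rw [show (4 : PowerSeries ℤ) = C (4:ℤ) from rfl, coeff_C_mul, coeff_X, coeff_monomial]
      split_ifs <;> simp
    have a2 : (monomial 0 (-1:ℤ)) = (-1 : PowerSeries ℤ) := by
      simp
    rw [a1, a2]
    ring
  · push_cast
    linear_combination -hid
end
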